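/- Fix a prime p, an integer n ≥ 2, and a finite field 𝔽_q of characteristic p. Let G := GL_n(ℚ_p), let B̄ ≤ G be the subgroup of invertible lower triangular matrices, T the diagonal torus, and pr : B̄ → T the group homomorphism sending a lower triangular matrix to its diagonal part. Let χ, χ′, χ″ : T → 𝔽_qˣ be three pairwise distinct smooth characters such that the principal series representations Ind_{B̄}^G χ, Ind_{B̄}^G χ′ and Ind_{B̄}^G χ″ are all irreducible. Then there exists no smooth representation π of G over 𝔽_q admitting G-stable subspaces 0 ⊊ π₁ ⊊ π₂ ⊊ π with π₁ ≅ Ind_{B̄}^G χ, π₂/π₁ ≅ Ind_{B̄}^G χ′ and π/π₂ ≅ Ind_{B̄}^G χ″ such that neither the extension 0 → π₁ → π₂ → π₂/π₁ → 0 nor the extension 0 → π₂/π₁ → π/π₁ → π/π₂ → 0 splits. (Equivalently: there is no smooth representation of G over 𝔽_q of length 3 with socle isomorphic to Ind_{B̄}^G χ, cosocle isomorphic to Ind_{B̄}^G χ″, and unique intermediate constituent isomorphic to Ind_{B̄}^G χ′.) -/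

import Mathlib

/-- The group of lower triangular unipotent matrices in `GL_n(ℚ_p)`, as a set. -/
def lowerUnipotent (p : ℕ) [Fact p.Prime] (n : ℕ) : Set (GL (Fin n) ℚ_[p]) :=
  {g | (∀ i j : Fin n, i < j → (g : Matrix (Fin n) (Fin n) ℚ_[p]) i j = 0) ∧
    ∀ i : Fin n, (g : Matrix (Fin n) (Fin n) ℚ_[p]) i i = 1}

/-- The principal series `Ind_{B̄}^G χ` attached to a character `χ` of the diagonal torus `T`:
the space of locally constant functions `f : G → 𝔽` with `f(b̄g) = χ(pr(b̄))·f(g)` for all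
lower triangular `b̄` (equivalently `f(tg) = χ(t)·f(g)` for diagonal `t` and `f(ug) = f(g)` for
lower triangular unipotent `u`), realized as a subset of the space of all functions `G → 𝔽`
on which `G` acts by right translation. -/
def principalSeries (p : ℕ) [Fact p.Prime] (n : ℕ) (𝔽 : Type*) [Field 𝔽]
    (T : Subgroup (GL (Fin n) ℚ_[p])) (χ : T →* 𝔽ˣ) : Set (GL (Fin n) ℚ_[p] → 𝔽) :=
  {f | IsLocallyConstant f ∧
    (∀ t : T, ∀ g : GL (Fin n) ℚ_[p], f (↑t * g) = (χ t : 𝔽) * f g) ∧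
    ∀ u ∈ lowerUnipotent p n, ∀ g : GL (Fin n) ℚ_[p], f (u * g) = f g}

/-- The principal series `Ind_{B̄}^G χ` is an irreducible representation of `G`: it is nonzero,
and the only `G`-stable subspaces of the function space contained in it are `0` and the whole
principal series. -/
def principalSeriesIrreducible (p : ℕ) [Fact p.Prime] (n : ℕ) (𝔽 : Type*) [Field 𝔽]
    (T : Subgroup (GL (Fin n) ℚ_[p])) (χ : T →* 𝔽ˣ) : Prop :=
  (∃ f ∈ principalSeries p n 𝔽 T χ, f ≠ 0) ∧
  ∀ W : Submodule 𝔽 (GL (Fin n) ℚ_[p] → 𝔽),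
    (W : Set (GL (Fin n) ℚ_[p] → 𝔽)) ⊆ principalSeries p n 𝔽 T χ →
    (∀ g : GL (Fin n) ℚ_[p], ∀ f ∈ W, (fun x => f (x * g)) ∈ W) →
    W = ⊥ ∨ (W : Set (GL (Fin n) ℚ_[p] → 𝔽)) = principalSeries p n 𝔽 T χ

namespace HX

abbrev GG (p n : ℕ) [Fact p.Prime] := GL (Fin n) ℚ_[p]
abbrev MM (p n : ℕ) [Fact p.Prime] := Matrix (Fin n) (Fin n) ℚ_[p]

set_option linter.unusedSectionVars false
set_option linter.unusedSimpArgs false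

section A
variable {p n : ℕ} [hp : Fact p.Prime]

noncomputable def ep (p s : ℕ) : ℝ := ((p : ℝ) ^ s)⁻¹

lemma ep_pos (s : ℕ) : 0 < ep p s := by
  have := hp.out.pos
  unfold ep; positivity

lemma ep_anti {s t : ℕ} (h : s ≤ t) : ep p t ≤ ep p s := by
  unfold ep
  have h1 : (1:ℝ) ≤ p := by exact_mod_cast hp.out.one_lt.le
  exact inv_anti₀ (by positivity) (pow_le_pow_right₀ h1 h)

lemma ep_zero : ep p 0 = 1 := by simp [ep]

lemma ep_le_one (s : ℕ) : ep p s ≤ 1 := by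
  rw [← ep_zero (p := p)]; exact ep_anti (Nat.zero_le s)

lemma ep_add (s t : ℕ) : ep p (s+t) = ep p s * ep p t := by
  unfold ep; rw [pow_add, mul_inv]

lemma norm_p_pow (s : ℕ) : ‖((p:ℚ_[p])^s)‖ = ep p s := by
  rw [norm_pow, Padic.norm_p, inv_pow]; rfl

lemma norm_p_zpow_neg (s : ℕ) : ‖((p:ℚ_[p])^s)⁻¹‖ = (ep p s)⁻¹ := by
  rw [norm_inv, norm_p_pow]

lemma p_ne : (p : ℚ_[p]) ≠ 0 := by exact_mod_cast hp.out.ne_zero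

lemma ep_small {ε : ℝ} (hε : 0 < ε) : ∃ s : ℕ, 1 ≤ s ∧ ep p s ≤ ε := by
  have h1 : (1:ℝ) < p := by exact_mod_cast hp.out.one_lt
  obtain ⟨N, hN⟩ := pow_unbounded_of_one_lt (ε⁻¹) h1
  refine ⟨N+1, by omega, ?_⟩
  refine (ep_anti (Nat.le_succ N)).trans ?_
  unfold ep
  exact inv_le_of_inv_le₀ hε hN.le

/-- all entries bounded by `c` -/
def MB (c : ℝ) (X : MM p n) : Prop := ∀ i j, ‖X i j‖ ≤ c

lemma MB.mono {c d : ℝ} {X : MM p n} (h : MB c X) (hcd : c ≤ d) : MB d X :=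
  fun i j => (h i j).trans hcd

lemma MB.add {c : ℝ} {X Y : MM p n} (h : MB c X) (h' : MB c Y) : MB c (X+Y) := fun i j =>
  (Padic.nonarchimedean _ _).trans (max_le (h i j) (h' i j))

lemma MB.neg {c : ℝ} {X : MM p n} (h : MB c X) : MB c (-X) := fun i j => by
  simpa using h i j

lemma MB.sub {c : ℝ} {X Y : MM p n} (h : MB c X) (h' : MB c Y) : MB c (X-Y) := by
  rw [sub_eq_add_neg]; exact h.add h'.neg

lemma norm_sum_le' {ι : Type*} (s : Finset ι) (f : ι → ℚ_[p]) {c : ℝ} (hc : 0 ≤ c)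
    (h : ∀ i ∈ s, ‖f i‖ ≤ c) : ‖∑ i ∈ s, f i‖ ≤ c :=
  IsUltrametricDist.norm_sum_le_of_forall_le_of_nonneg hc h

lemma MB.mul {c d : ℝ} (hc : 0 ≤ c) (hd : 0 ≤ d) {X Y : MM p n} (h : MB c X) (h' : MB d Y) :
    MB (c*d) (X*Y) := fun i j => by
  rw [Matrix.mul_apply]
  refine norm_sum_le' _ _ (by positivity) fun k _ => ?_
  rw [norm_mul]
  exact mul_le_mul (h i k) (h' k j) (norm_nonneg _) hc

lemma MB.mul_left {c : ℝ} (hc : 0 ≤ c) {X Y : MM p n} (h : MB 1 X) (h' : MB c Y) :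
    MB c (X*Y) := by simpa using MB.mul zero_le_one hc h h'
lemma MB.mul_right {c : ℝ} (hc : 0 ≤ c) {X Y : MM p n} (h : MB c X) (h' : MB 1 Y) :
    MB c (X*Y) := by simpa using MB.mul hc zero_le_one h h'

lemma MB_one : MB 1 (1 : MM p n) := fun i j => by
  rw [Matrix.one_apply]; split_ifs <;> simp

lemma MB_zero {c : ℝ} (hc : 0 ≤ c) : MB c (0 : MM p n) := fun i j => by simpa using hc

lemma MB.smul {c : ℝ} {X : MM p n} (h : MB c X) (a : ℚ_[p]) : MB (‖a‖*c) (a • X) := fun i j => by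
  simp only [Matrix.smul_apply, smul_eq_mul, norm_mul]
  exact mul_le_mul_of_nonneg_left (h i j) (norm_nonneg _)

lemma MB_exists (X : MM p n) : ∃ c : ℝ, 0 < c ∧ MB c X := by
  refine ⟨1 + ∑ i, ∑ j, ‖X i j‖, by positivity, fun i j => ?_⟩
  have h1 : ‖X i j‖ ≤ ∑ j, ‖X i j‖ :=
    Finset.single_le_sum (f := fun j => ‖X i j‖) (fun _ _ => norm_nonneg _) (Finset.mem_univ j)
  have h2 : ∑ j, ‖X i j‖ ≤ ∑ i, ∑ j, ‖X i j‖ :=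
    Finset.single_le_sum (f := fun i => ∑ j, ‖X i j‖)
      (fun _ _ => Finset.sum_nonneg fun _ _ => norm_nonneg _) (Finset.mem_univ i)
  linarith

/-- congruence subgroups -/
def Kc (p n : ℕ) [Fact p.Prime] (s : ℕ) : Subgroup (GG p n) where
  carrier := {g | MB (ep p s) ((g : MM p n) - 1) ∧ MB (ep p s) (((g⁻¹ : GG p n) : MM p n) - 1)}
  one_mem' := by
    constructor <;> simpa using MB_zero (ep_pos s).le
  mul_mem' := by
    intro a b ha hb
    have key : ∀ X Y : MM p n, MB (ep p s) (X - 1) → MB (ep p s) (Y - 1) →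
        MB (ep p s) (X * Y - 1) := by
      intro X Y hX hY
      have : X * Y - 1 = X * (Y - 1) + (X - 1) := by noncomm_ring
      rw [this]
      refine MB.add (MB.mul_left (ep_pos s).le ?_ hY) hX
      have : X = (X - 1) + 1 := by simp
      rw [this]
      exact (hX.mono (ep_le_one s)).add MB_one
    refine ⟨?_, ?_⟩
    · simpa using key _ _ ha.1 hb.1
    · rw [mul_inv_rev]; simpa using key _ _ hb.2 ha.2
  inv_mem' := by
    intro a ha
    exact ⟨ha.2, by simpa using ha.1⟩

lemma mem_Kc {s : ℕ} {g : GG p n} : g ∈ Kc p n s ↔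
    MB (ep p s) ((g : MM p n) - 1) ∧ MB (ep p s) (((g⁻¹ : GG p n) : MM p n) - 1) := Iff.rfl

lemma mem_K0 {g : GG p n} : g ∈ Kc p n 0 ↔
    MB 1 (g : MM p n) ∧ MB 1 ((g⁻¹ : GG p n) : MM p n) := by
  rw [mem_Kc, ep_zero]
  have key : ∀ X : MM p n, MB 1 (X - 1) ↔ MB 1 X := fun X =>
    ⟨fun h => by simpa using h.add MB_one, fun h => h.sub MB_one⟩
  rw [key, key]

lemma Kc_anti {s t : ℕ} (h : s ≤ t) : Kc p n t ≤ Kc p n s := fun _ hg =>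
  ⟨hg.1.mono (ep_anti h), hg.2.mono (ep_anti h)⟩

lemma Kc_conj {s : ℕ} {g k : GG p n} (hg : g ∈ Kc p n 0) (hk : k ∈ Kc p n s) :
    g * k * g⁻¹ ∈ Kc p n s := by
  have key : ∀ k : GG p n, MB (ep p s) ((k : MM p n) - 1) →
      MB (ep p s) (((g * k * g⁻¹ : GG p n) : MM p n) - 1) := by
    intro k hk
    have : ((g * k * g⁻¹ : GG p n) : MM p n) - 1
        = (g : MM p n) * (((k : MM p n) - 1) * ((g⁻¹ : GG p n) : MM p n)) := by
      have h : (g : MM p n) * ((g⁻¹ : GG p n) : MM p n) = 1 := by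
        rw [← Units.val_mul, mul_inv_cancel, Units.val_one]
      simp only [Units.val_mul, sub_mul, mul_sub, one_mul, mul_assoc, h]
    rw [this]
    exact MB.mul_left (ep_pos s).le (mem_K0.1 hg).1 (MB.mul_right (ep_pos s).le hk (mem_K0.1 hg).2)
  refine ⟨key k hk.1, ?_⟩
  have : (g * k * g⁻¹)⁻¹ = g * k⁻¹ * g⁻¹ := by group
  rw [this]; exact key _ hk.2

lemma Kc_conj' {s : ℕ} {g k : GG p n} (hg : g ∈ Kc p n 0) (hk : k ∈ Kc p n s) :
    g⁻¹ * k * g ∈ Kc p n s := by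
  simpa using Kc_conj (inv_mem hg) hk

lemma cast_mul_sub (s : ℕ) {X : MM p n} : MB (ep p s) X ↔ MB 1 (((p:ℚ_[p])^s)⁻¹ • X) := by
  have := ep_pos (p := p) s
  constructor
  · intro h
    have := h.smul (((p:ℚ_[p])^s)⁻¹)
    rwa [norm_p_zpow_neg, inv_mul_cancel₀ (ep_pos s).ne'] at this
  · intro h
    have := h.smul (((p:ℚ_[p])^s))
    rwa [norm_p_pow, smul_smul, mul_inv_cancel₀ (pow_ne_zero _ p_ne), one_smul, mul_one] at this

/-- `1+X` invertible for small `X` -/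
lemma exists_Kc {s : ℕ} (hs : 1 ≤ s) {X : MM p n} (hX : MB (ep p s) X) :
    ∃ g ∈ Kc p n s, (g : MM p n) = 1 + X := by
  have h1 : MB (ep p 1) X := hX.mono (ep_anti hs)
  rw [cast_mul_sub] at h1
  set M : Matrix (Fin n) (Fin n) ℤ_[p] := fun i j => ⟨_, h1 i j⟩ with hM
  have hXM : 1 + X = (1 + (p:ℤ_[p]) • M).map (PadicInt.Coe.ringHom) := by
    ext i j
    have e1 : PadicInt.Coe.ringHom ((1 : Matrix (Fin n) (Fin n) ℤ_[p]) i j) = (1 : MM p n) i j := by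
      simp only [Matrix.one_apply]; split_ifs <;> simp
    have e2 : PadicInt.Coe.ringHom (M i j) = (p:ℚ_[p])⁻¹ * X i j := by
      change (((p:ℚ_[p])^1)⁻¹ • X) i j = _
      simp
    rw [Matrix.map_apply, Matrix.add_apply, Matrix.add_apply, Matrix.smul_apply, map_add, e1,
      smul_eq_mul, map_mul, e2, map_natCast, mul_inv_cancel_left₀ p_ne]
  have hu : IsUnit (1 + (p:ℤ_[p]) • M).det := by
    by_contra hcon
    have hz : PadicInt.toZMod (1 + (p:ℤ_[p]) • M).det = 0 := by
      have : (1 + (p:ℤ_[p]) • M).det ∈ IsLocalRing.maximalIdeal ℤ_[p] := hcon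
      rw [← PadicInt.ker_toZMod] at this
      exact this
    rw [RingHom.map_det] at hz
    have : (PadicInt.toZMod (p := p)).mapMatrix (1 + (p:ℤ_[p]) • M) = 1 := by
      ext i j
      simp [Matrix.one_apply]
    rw [this] at hz
    simp at hz
  obtain ⟨U, hU⟩ := (Matrix.isUnit_iff_isUnit_det _).2 hu
  set R : Matrix (Fin n) (Fin n) ℤ_[p] →+* MM p n := (PadicInt.Coe.ringHom (p := p)).mapMatrix
  have hb : ∀ N, MB 1 (R N) := fun N i j => (N i j).2
  set g : GG p n := Units.map (R : _ →* _) U with hg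
  have hgX : (g : MM p n) = 1 + X := by rw [hXM, ← hU]; rfl
  refine ⟨g, ⟨?_, ?_⟩, hgX⟩
  · rw [hgX]; simpa using hX
  · have h2 : MB 1 ((g⁻¹ : GG p n) : MM p n) := hb _
    have : ((g⁻¹ : GG p n) : MM p n) - 1 = - (((g⁻¹ : GG p n) : MM p n) * X) := by
      have h3 : ((g⁻¹ : GG p n) : MM p n) * (1 + X) = 1 := by
        rw [← hgX, ← Units.val_mul, inv_mul_cancel, Units.val_one]
      rw [mul_add, mul_one] at h3
      rw [← h3]; abel
    rw [this]
    exact (MB.mul_left (ep_pos s).le h2 hX).neg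

lemma mem_Kc_of {s : ℕ} (hs : 1 ≤ s) {g : GG p n} (h : MB (ep p s) ((g : MM p n) - 1)) :
    g ∈ Kc p n s := by
  obtain ⟨g', h1, h2⟩ := exists_Kc hs h
  have : g' = g := by ext1; rw [h2]; simp
  rwa [← this]

lemma Kc_pow_p {s : ℕ} (hs : 1 ≤ s) {g : GG p n} (h : g ∈ Kc p n s) : g ^ p ∈ Kc p n (s+1) := by
  apply mem_Kc_of (by omega)
  rw [Units.val_pow_eq_pow_val, ← mul_geom_sum, ep_add]
  refine MB.mul (ep_pos s).le (ep_pos 1).le h.1 ?_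
  have : ∑ i ∈ Finset.range p, (g : MM p n)^i
      = (∑ i ∈ Finset.range p, ((g : MM p n)^i - 1)) + (p : ℚ_[p]) • (1 : MM p n) := by
    rw [Finset.sum_sub_distrib]; simp [Nat.cast_smul_eq_nsmul]
  rw [this]
  refine MB.add ?_ ?_
  · have : ∀ S : Finset ℕ, MB (ep p 1) (∑ i ∈ S, ((g : MM p n)^i - 1)) := by
      intro S
      induction S using Finset.induction_on with
      | empty => simpa using MB_zero (ep_pos 1).le
      | insert a S ha ih =>
        rw [Finset.sum_insert ha]
        refine MB.add ?_ ih
        have := (Kc_anti hs (pow_mem h a)).1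
        simpa using this
    exact this _
  · have := (MB_one (p := p) (n := n)).smul (p : ℚ_[p])
    rwa [mul_one, ← pow_one (p : ℚ_[p]), norm_p_pow, pow_one] at this

lemma Kc_pow_pp {s : ℕ} (hs : 1 ≤ s) {g : GG p n} (h : g ∈ Kc p n s) (j : ℕ) :
    g ^ (p^j) ∈ Kc p n (s+j) := by
  induction j with
  | zero => simpa using h
  | succ j ih =>
    rw [pow_succ, pow_mul]; exact Kc_pow_p (s := s+j) (by omega) ih

lemma Kc_open (s : ℕ) : IsOpen (Kc p n s : Set (GG p n)) := by
  have : (Kc p n s : Set (GG p n)) =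
    (⋂ i, ⋂ j, (fun g : GG p n => ((g : MM p n) - 1) i j) ⁻¹' Metric.closedBall 0 (ep p s)) ∩
    (⋂ i, ⋂ j, (fun g : GG p n => (((g⁻¹ : GG p n) : MM p n) - 1) i j) ⁻¹' Metric.closedBall 0 (ep p s)) := by
    ext g
    simp only [Set.mem_inter_iff, Set.mem_iInter, Set.mem_preimage, mem_closedBall_zero_iff]
    exact Iff.rfl
  rw [this]
  have hb : IsOpen (Metric.closedBall (0:ℚ_[p]) (ep p s)) :=
    IsUltrametricDist.isOpen_closedBall _ (ep_pos s).ne'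
  have c1 : ∀ i j, Continuous (fun g : GG p n => ((g : MM p n) - 1) i j) := fun i j => by
    have : Continuous (fun g : GG p n => (g : MM p n)) := Units.continuous_val
    exact ((this.sub continuous_const).matrix_elem i j)
  refine IsOpen.inter ?_ ?_ <;> refine isOpen_iInter_of_finite fun i => isOpen_iInter_of_finite fun j => ?_
  · exact hb.preimage (c1 i j)
  · exact hb.preimage ((c1 i j).comp continuous_inv)

lemma Kc_basis {U : Set (GG p n)} (hU : IsOpen U) (h1 : (1 : GG p n) ∈ U) :
    ∃ s, 1 ≤ s ∧ (Kc p n s : Set (GG p n)) ⊆ U := by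
  have hn : U ∈ nhds (1 : GG p n) := hU.mem_nhds h1
  rw [Units.isInducing_embedProduct.nhds_eq_comap, Filter.mem_comap] at hn
  obtain ⟨t, ht, htU⟩ := hn
  rw [Units.embedProduct_apply, nhds_prod_eq, Filter.mem_prod_iff] at ht
  obtain ⟨t1, ht1, t2, ht2, ht⟩ := ht
  have ht2' : MulOpposite.op ⁻¹' t2 ∈ nhds (1 : MM p n) := by
    refine MulOpposite.continuous_op.continuousAt.preimage_mem_nhds ?_
    simpa using ht2
  have key : ∀ t ∈ nhds (1 : MM p n), ∃ s, 1 ≤ s ∧ ∀ X : MM p n, MB (ep p s) (X - 1) → X ∈ t := by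
    intro t ht
    obtain ⟨ε, hε, hb⟩ := (Metric.mem_nhds_iff (α := Fin n → Fin n → ℚ_[p])).1 ht
    obtain ⟨s, hs, hs'⟩ := ep_small (p := p) (half_pos hε)
    refine ⟨s, hs, fun X hX => hb ?_⟩
    refine (dist_pi_lt_iff hε).2 fun i => (dist_pi_lt_iff hε).2 fun j => ?_
    have := hX i j
    rw [Matrix.sub_apply] at this
    rw [dist_eq_norm]
    linarith
  obtain ⟨s1, hs1, h1'⟩ := key t1 (by simpa using ht1)
  obtain ⟨s2, hs2, h2'⟩ := key _ ht2'
  refine ⟨max s1 s2, by omega, fun g hg => htU (ht ?_)⟩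
  constructor
  · exact h1' _ (hg.1.mono (ep_anti (le_max_left _ _)))
  · exact h2' _ (hg.2.mono (ep_anti (le_max_right _ _)))

lemma K0_compact : IsCompact (Kc p n 0 : Set (GG p n)) := by
  let S : Submonoid (MM p n) :=
    { carrier := {X | MB 1 X}
      one_mem' := MB_one
      mul_mem' := fun h h' => MB.mul_left zero_le_one h h' }
  have hS : IsCompact (S : Set (MM p n)) := by
    have : (S : Set (MM p n)) = Set.pi Set.univ fun _ => Set.pi Set.univ fun _ =>
        Metric.closedBall (0:ℚ_[p]) 1 := by
      ext X
      exact ⟨fun h i _ j _ => mem_closedBall_zero_iff.2 (h i j),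
        fun h i j => mem_closedBall_zero_iff.1 (h i trivial j trivial)⟩
    rw [this]
    exact isCompact_univ_pi fun _ => isCompact_univ_pi fun _ => isCompact_closedBall _ _
  have := Submonoid.units_isCompact hS
  convert this using 1
  ext g
  rw [SetLike.mem_coe, mem_K0, SetLike.mem_coe, Submonoid.mem_units_iff]
  exact Iff.rfl

end A
end HX

namespace HX
set_option linter.unusedSectionVars false
set_option linter.unusedSimpArgs false
set_option linter.unusedVariables false
section B
variable {p n : ℕ} [hp : Fact p.Prime]

lemma gmul_inv (g : GG p n) : (g : MM p n) * ((g⁻¹ : GG p n) : MM p n) = 1 := by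
  rw [← Units.val_mul, mul_inv_cancel, Units.val_one]
lemma ginv_mul (g : GG p n) : ((g⁻¹ : GG p n) : MM p n) * (g : MM p n) = 1 := by
  rw [← Units.val_mul, inv_mul_cancel, Units.val_one]

/-- upper right `k`-block zero -/
def UZ (k : ℕ) (X : MM p n) : Prop := ∀ i j : Fin n, i.val < k → k ≤ j.val → X i j = 0

lemma UZ_iff (k : ℕ) (X : MM p n) : UZ k X ↔
    X.BlockTriangular (fun i : Fin n => if i.val < k then 1 else 0) := by
  constructor
  · intro h i j hij
    simp only at hij
    apply h
    · by_contra hc; rw [if_neg hc] at hij; omega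
    · by_contra hc; rw [if_pos (by omega : j.val < k)] at hij; split_ifs at hij <;> omega
  · intro h i j hi hj
    apply h
    simp only [if_pos hi, if_neg (by omega : ¬ j.val < k)]; omega

lemma UZ.mul {k : ℕ} {X Y : MM p n} (h : UZ k X) (h' : UZ k Y) : UZ k (X*Y) := by
  rw [UZ_iff] at *; exact h.mul h'

lemma UZ.inv {k : ℕ} {g : GG p n} (h : UZ k (g : MM p n)) : UZ k ((g⁻¹ : GG p n) : MM p n) := by
  rw [UZ_iff] at *
  have : Invertible (g : MM p n) := g.invertible
  have := Matrix.blockTriangular_inv_of_blockTriangular h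
  rwa [Matrix.coe_units_inv]

def Pb (p n : ℕ) [Fact p.Prime] (k : ℕ) : Subgroup (GG p n) where
  carrier := {g | UZ k (g : MM p n)}
  one_mem' := fun i j hi hj => by
    rw [Units.val_one, Matrix.one_apply_ne]; rintro rfl; omega
  mul_mem' := fun h h' => by
    show UZ k _
    rw [Units.val_mul]; exact UZ.mul h h'
  inv_mem' := fun h => UZ.inv h

lemma mem_Pb {k : ℕ} {g : GG p n} : g ∈ Pb p n k ↔
  ∀ i j : Fin n, i.val < k → k ≤ j.val → (g : MM p n) i j = 0 := Iff.rfl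

noncomputable def Bb (p n : ℕ) [Fact p.Prime] : Subgroup (GG p n) := ⨅ k, Pb p n k

lemma mem_Bb {g : GG p n} : g ∈ Bb p n ↔ ∀ i j : Fin n, i < j → (g : MM p n) i j = 0 := by
  rw [Bb, Subgroup.mem_iInf]
  constructor
  · intro h i j hij
    exact h j.val i j hij le_rfl
  · intro h k i j hi hj
    exact h i j (Fin.lt_def.2 (by omega))

lemma Bb_le (k : ℕ) : Bb p n ≤ Pb p n k := iInf_le _ k

lemma Bb_diag_ne {g : GG p n} (h : g ∈ Bb p n) (i : Fin n) : (g : MM p n) i i ≠ 0 := by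
  have h1 : (g : MM p n).det ≠ 0 := by
    have := (Matrix.isUnit_iff_isUnit_det _).1 g.isUnit
    exact this.ne_zero
  rw [Matrix.det_of_isLowerTriangular _ (fun i j hij => mem_Bb.1 h i j hij)] at h1
  exact (Finset.prod_ne_zero_iff.1 h1) i (Finset.mem_univ i)

/-- diagonal elements -/
noncomputable def dgl (d : Fin n → ℚ_[p]ˣ) : GG p n :=
  ⟨Matrix.diagonal (fun i => (d i : ℚ_[p])), Matrix.diagonal (fun i => ((d i)⁻¹ : ℚ_[p])),
    by rw [Matrix.diagonal_mul_diagonal]; simp, by rw [Matrix.diagonal_mul_diagonal]; simp⟩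

@[simp] lemma dgl_val (d : Fin n → ℚ_[p]ˣ) :
    ((dgl d : GG p n) : MM p n) = Matrix.diagonal (fun i => (d i : ℚ_[p])) := rfl
@[simp] lemma dgl_inv_val (d : Fin n → ℚ_[p]ˣ) :
    (((dgl d)⁻¹ : GG p n) : MM p n) = Matrix.diagonal (fun i => ((d i)⁻¹ : ℚ_[p])) := rfl

lemma dgl_mem_Bb (d : Fin n → ℚ_[p]ˣ) : dgl d ∈ Bb p n := by
  rw [mem_Bb]; intro i j hij
  rw [dgl_val, Matrix.diagonal_apply_ne _ hij.ne]

lemma Bb_mul_diag {a b : GG p n} (ha : a ∈ Bb p n) (hb : b ∈ Bb p n) (i : Fin n) :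
    ((a * b : GG p n) : MM p n) i i = (a : MM p n) i i * (b : MM p n) i i := by
  rw [Units.val_mul, Matrix.mul_apply, Finset.sum_eq_single i]
  · intro j _ hj
    rcases lt_or_gt_of_ne hj with h | h
    · rw [mem_Bb.1 hb _ _ h, mul_zero]
    · rw [mem_Bb.1 ha _ _ h, zero_mul]
  · simp

lemma Bb_decomp {b : GG p n} (hb : b ∈ Bb p n) : ∃ d : Fin n → ℚ_[p]ˣ,
    (∀ i, (d i : ℚ_[p]) = (b : MM p n) i i) ∧ ∃ u ∈ lowerUnipotent p n, b = dgl d * u := by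
  refine ⟨fun i => Units.mk0 _ (Bb_diag_ne hb i), fun i => rfl, _, ?_, (mul_inv_cancel_left _ b).symm⟩
  have hm : (dgl fun i => Units.mk0 _ (Bb_diag_ne hb i))⁻¹ * b ∈ Bb p n :=
    mul_mem (inv_mem (dgl_mem_Bb _)) hb
  refine ⟨fun i j hij => mem_Bb.1 hm i j hij, fun i => ?_⟩
  rw [Units.val_mul, dgl_inv_val, Matrix.diagonal_mul]
  simp [Bb_diag_ne hb i]

lemma lowerUnipotent_sub {u : GG p n} (h : u ∈ lowerUnipotent p n) : u ∈ Bb p n := mem_Bb.2 h.1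

/-- lower left block -/
def LB (k : ℕ) (X : MM p n) : Prop := ∀ i j : Fin n, (k ≤ i.val → k ≤ j.val) → X i j = 0

lemma LB.mul_zero {k : ℕ} {X Y : MM p n} (h : LB k X) (h' : LB k Y) : X * Y = 0 := by
  ext i j
  rw [Matrix.mul_apply, Matrix.zero_apply]
  refine Finset.sum_eq_zero fun l _ => ?_
  by_cases hl : k ≤ l.val
  · rw [h i l (fun _ => hl), zero_mul]
  · rw [h' l j (fun hc => absurd hc hl), mul_zero_class_aux]
where mul_zero_class_aux {a : ℚ_[p]} : a * 0 = 0 := MulZeroClass.mul_zero a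

lemma LB.add {k : ℕ} {X Y : MM p n} (h : LB k X) (h' : LB k Y) : LB k (X+Y) := fun i j hij => by
  rw [Matrix.add_apply, h i j hij, h' i j hij, add_zero]
lemma LB.neg {k : ℕ} {X : MM p n} (h : LB k X) : LB k (-X) := fun i j hij => by
  rw [Matrix.neg_apply, h i j hij, neg_zero]
lemma LB.smul {k : ℕ} {X : MM p n} (h : LB k X) (a : ℚ_[p]) : LB k (a • X) := fun i j hij => by
  rw [Matrix.smul_apply, h i j hij, smul_zero]
lemma LB_zero {k : ℕ} : LB k (0 : MM p n) := fun i j _ => rfl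

noncomputable def mkV (k : ℕ) (X : MM p n) (h : LB k X) : GG p n :=
  ⟨1 + X, 1 - X, by have := h.mul_zero h; noncomm_ring; simp [this],
    by have := h.mul_zero h; noncomm_ring; simp [this]⟩

@[simp] lemma mkV_val {k : ℕ} (X : MM p n) (h : LB k X) : ((mkV k X h : GG p n) : MM p n) = 1 + X := rfl
@[simp] lemma mkV_inv_val {k : ℕ} (X : MM p n) (h : LB k X) :
    (((mkV k X h)⁻¹ : GG p n) : MM p n) = 1 - X := rfl

lemma mkV_mul {k : ℕ} {X Y : MM p n} (h : LB k X) (h' : LB k Y) :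
    mkV k X h * mkV k Y h' = mkV k (X+Y) (h.add h') := by
  ext1
  rw [Units.val_mul, mkV_val, mkV_val, mkV_val, add_mul, mul_add, mul_add, h.mul_zero h']
  simp; abel

lemma mkV_inv {k : ℕ} {X : MM p n} (h : LB k X) : (mkV k X h)⁻¹ = mkV k (-X) h.neg := by
  ext1
  rw [mkV_inv_val, mkV_val, sub_eq_add_neg]

lemma mkV_congr {k : ℕ} {X Y : MM p n} (h : LB k X) (e : X = Y) : mkV k X h = mkV k Y (e ▸ h) := by
  subst e; rfl

def V (p n : ℕ) [Fact p.Prime] (k : ℕ) : Subgroup (GG p n) where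
  carrier := {g | ∃ X, ∃ h : LB k X, g = mkV k X h}
  one_mem' := ⟨0, LB_zero, by ext1; simp⟩
  mul_mem' := by
    rintro _ _ ⟨X, hX, rfl⟩ ⟨Y, hY, rfl⟩
    exact ⟨_, _, mkV_mul hX hY⟩
  inv_mem' := by
    rintro _ ⟨X, hX, rfl⟩
    exact ⟨_, _, mkV_inv hX⟩

lemma mem_V {k : ℕ} {g : GG p n} : g ∈ V p n k ↔ ∃ X, ∃ h : LB k X, g = mkV k X h := Iff.rfl

lemma mkV_mem {k : ℕ} {X : MM p n} (h : LB k X) : mkV k X h ∈ V p n k := ⟨X, h, rfl⟩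

lemma V_comm {k : ℕ} {a b : GG p n} (ha : a ∈ V p n k) (hb : b ∈ V p n k) : a * b = b * a := by
  obtain ⟨X, hX, rfl⟩ := ha
  obtain ⟨Y, hY, rfl⟩ := hb
  rw [mkV_mul, mkV_mul]
  exact mkV_congr _ (add_comm _ _)

lemma mkV_pow {k : ℕ} {X : MM p n} (h : LB k X) (m : ℕ) :
    mkV k X h ^ m = mkV k ((m : ℚ_[p]) • X) (h.smul _) := by
  induction m with
  | zero => ext1; simp
  | succ m ih =>
    rw [pow_succ, ih, mkV_mul]
    exact mkV_congr _ (by push_cast; rw [add_smul, one_smul])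

lemma mkV_mem_Kc {k s : ℕ} {X : MM p n} (h : LB k X) : mkV k X h ∈ Kc p n s ↔ MB (ep p s) X := by
  rw [mem_Kc]; simp only [mkV_val, mkV_inv_val, add_sub_cancel_left]
  constructor
  · exact fun h => h.1
  · intro h; exact ⟨h, by simpa using h.neg⟩

/-- `V_{s+1}` consists of `p`-th powers of elements of `V_s`. -/
lemma V_root {k s : ℕ} {v : GG p n} (hv : v ∈ V p n k) (hs : v ∈ Kc p n (s+1)) :
    ∃ w ∈ V p n k, w ∈ Kc p n s ∧ w ^ p = v := by
  obtain ⟨X, hX, rfl⟩ := hv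
  rw [mkV_mem_Kc] at hs
  refine ⟨mkV k ((p:ℚ_[p])⁻¹ • X) (hX.smul _), mkV_mem _, ?_, ?_⟩
  · rw [mkV_mem_Kc]
    have := hs.smul (p:ℚ_[p])⁻¹
    rwa [← pow_one (p:ℚ_[p]), norm_p_zpow_neg, ep_add, mul_comm (ep p s), inv_mul_cancel_left₀ (ep_pos 1).ne', pow_one] at this
  · rw [mkV_pow]
    exact mkV_congr _ (by rw [smul_smul, mul_inv_cancel₀ p_ne, one_smul])

lemma UZ_LB_mul {k : ℕ} {A X : MM p n} (hA : UZ k A) (hX : LB k X) : LB k (A * X) := by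
  intro i j hij
  rw [Matrix.mul_apply]
  refine Finset.sum_eq_zero fun l _ => ?_
  by_cases hl : k ≤ l.val
  · by_cases hi : k ≤ i.val
    · rw [hX l j (fun _ => hij hi), mul_zero]
    · rw [hA i l (by omega) hl, zero_mul]
  · rw [hX l j (fun h => absurd h hl), mul_zero]

lemma LB_UZ_mul {k : ℕ} {A X : MM p n} (hA : UZ k A) (hX : LB k X) : LB k (X * A) := by
  intro i j hij
  rw [Matrix.mul_apply]
  refine Finset.sum_eq_zero fun l _ => ?_
  by_cases hl : k ≤ l.val
  · rw [hX i l (fun _ => hl), zero_mul]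
  · by_cases hi : k ≤ i.val
    · rw [hA l j (by omega) (hij hi), mul_zero]
    · rw [hX i l (fun h => absurd h hi), zero_mul]

lemma mkV_conj {k : ℕ} {g : GG p n} (hg : g ∈ Pb p n k) {X : MM p n} (h : LB k X) :
    g * mkV k X h * g⁻¹ = mkV k ((g : MM p n) * X * ((g⁻¹ : GG p n) : MM p n))
      (LB_UZ_mul (inv_mem hg) (UZ_LB_mul hg h)) := by
  ext1
  rw [Units.val_mul, Units.val_mul, mkV_val, mkV_val, mul_add, add_mul, mul_one, gmul_inv]

lemma V_conj {k : ℕ} {g v : GG p n} (hg : g ∈ Pb p n k) (hv : v ∈ V p n k) :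
    g * v * g⁻¹ ∈ V p n k := by
  obtain ⟨X, hX, rfl⟩ := hv
  rw [mkV_conj hg]; exact mkV_mem _

lemma V_conj' {k : ℕ} {g v : GG p n} (hg : g ∈ Pb p n k) (hv : v ∈ V p n k) :
    g⁻¹ * v * g ∈ V p n k := by
  simpa using V_conj (inv_mem hg) hv

lemma V_le_lowerUnipotent {k : ℕ} {v : GG p n} (hv : v ∈ V p n k) : v ∈ lowerUnipotent p n := by
  obtain ⟨X, hX, rfl⟩ := hv
  refine ⟨fun i j hij => ?_, fun i => ?_⟩
  · rw [mkV_val, Matrix.add_apply, Matrix.one_apply_ne hij.ne, zero_add]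
    apply hX
    intro h; have := Fin.lt_def.1 hij; omega
  · rw [mkV_val, Matrix.add_apply, Matrix.one_apply_eq, hX i i id, add_zero]

lemma V_le_Bb {k : ℕ} : V p n k ≤ Bb p n := fun _ h => lowerUnipotent_sub (V_le_lowerUnipotent h)
lemma V_le_Pb {k : ℕ} : V p n k ≤ Pb p n k := V_le_Bb.trans (Bb_le k)

/-- permutation -/
noncomputable def sw (a b : Fin n) : GG p n := Matrix.GeneralLinearGroup.swap ℚ_[p] a b

lemma mul_sw (g : GG p n) (a b i j : Fin n) :
    ((g * sw a b : GG p n) : MM p n) i j = (g : MM p n) i (Equiv.swap a b j) := by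
  change ((g : MM p n) * Matrix.swap ℚ_[p] a b) i j = _
  simp [Matrix.swap, PEquiv.mul_toMatrix_toPEquiv]
lemma sw_mul (g : GG p n) (a b i j : Fin n) :
    ((sw a b * g : GG p n) : MM p n) i j = (g : MM p n) (Equiv.swap a b i) j := by
  change (Matrix.swap ℚ_[p] a b * (g : MM p n)) i j = _
  simp [Matrix.swap, PEquiv.toMatrix_toPEquiv_mul]
lemma sw_inv (a b : Fin n) : (sw a b : GG p n)⁻¹ = sw a b := rfl
lemma sw_sw (a b : Fin n) : (sw a b : GG p n) * sw a b = 1 := by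
  nth_rewrite 1 [← sw_inv]; simp
lemma sw_mem_K0 (a b : Fin n) : (sw a b : GG p n) ∈ Kc p n 0 := by
  have : MB 1 ((sw a b : GG p n) : MM p n) := fun i j => by
    have := mul_sw (1 : GG p n) a b i j
    rw [one_mul] at this
    rw [this]; exact MB_one _ _
  rw [mem_K0, sw_inv]; exact ⟨this, this⟩

/-- Iwasawa decomposition -/
lemma iwasawa (g : GG p n) : ∃ k ∈ Kc p n 0, g * k ∈ Bb p n := by
  have key : ∀ m : ℕ, ∃ k ∈ Kc p n 0, ∀ i j : Fin n, i.val < m → i < j →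
      ((g * k : GG p n) : MM p n) i j = 0 := by
    intro m
    induction m with
    | zero => exact ⟨1, one_mem _, fun i j h => absurd h (Nat.not_lt_zero _)⟩
    | succ m ih =>
      obtain ⟨k, hk, h⟩ := ih
      by_cases hm : m < n
      swap
      · exact ⟨k, hk, fun i j hi => h i j (by have := i.2; omega)⟩
      set m' : Fin n := ⟨m, hm⟩ with hm'
      set S : Finset (Fin n) := Finset.univ.filter (fun j => m' ≤ j) with hS
      obtain ⟨j0, hj0, hmax⟩ := Finset.exists_max_image S
        (fun j => ‖((g * k : GG p n) : MM p n) m' j‖) ⟨m', by simp [hS]⟩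
      have hj0' : m' ≤ j0 := by simpa [hS] using hj0
      set k1 := k * sw m' j0 with hk1
      have hk1K : k1 ∈ Kc p n 0 := mul_mem hk (sw_mem_K0 _ _)
      have hsw : ∀ j, m' ≤ j → m' ≤ Equiv.swap m' j0 j := by
        intro j hj
        rw [Equiv.swap_apply_def]; split_ifs <;> first | assumption | exact le_rfl
      have hA : ∀ i j, ((g * k1 : GG p n) : MM p n) i j
          = ((g * k : GG p n) : MM p n) i (Equiv.swap m' j0 j) := fun i j => by
        rw [hk1, ← mul_assoc, mul_sw]
      set A := ((g * k1 : GG p n) : MM p n) with hAdef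
      have hA0 : ∀ i j : Fin n, i.val < m → i < j → A i j = 0 := by
        intro i j hi hij
        rw [hA]
        apply h i _ hi
        rw [Equiv.swap_apply_def]; split_ifs
        · exact lt_of_lt_of_le (Fin.lt_def.2 hi) hj0'
        · exact Fin.lt_def.2 hi
        · exact hij
      have hAm : ∀ j, m' ≤ j → ‖A m' j‖ ≤ ‖A m' m'‖ := by
        intro j hj
        rw [hA, hA, Equiv.swap_apply_left]
        exact hmax _ (by simpa [hS] using hsw j hj)
      set E : MM p n := fun i j => if i = m' ∧ m' < j then A m' j / A m' m' else 0 with hE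
      have hEb : MB 1 E := by
        intro i j
        simp only [hE]
        split_ifs with hc
        · rw [norm_div]
          exact div_le_one_of_le₀ (hAm j hc.2.le) (norm_nonneg _)
        · simp
      have hEE : E * E = 0 := by
        ext i j
        rw [Matrix.mul_apply, Matrix.zero_apply]
        refine Finset.sum_eq_zero fun l _ => ?_
        simp only [hE]
        by_cases hl : l = m'
        · subst hl; simp
        · rw [if_neg (fun hc => hl hc.1 : ¬ (l = m' ∧ m' < j)), mul_zero]
      let e : GG p n := ⟨1 - E, 1 + E, by noncomm_ring; simp [hEE], by noncomm_ring; simp [hEE]⟩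
      have heK : e ∈ Kc p n 0 := mem_K0.2 ⟨MB_one.sub hEb, MB_one.add hEb⟩
      refine ⟨k1 * e, mul_mem hk1K heK, ?_⟩
      intro i j hi hij
      have e1 : ((g * (k1 * e) : GG p n) : MM p n) i j = A i j - A i m' * E m' j := by
        rw [← mul_assoc, Units.val_mul]
        change (A * (1 - E)) i j = _
        rw [mul_sub, mul_one, Matrix.sub_apply, Matrix.mul_apply, Finset.sum_eq_single m']
        · intro l _ hl
          simp only [hE]
          rw [if_neg (fun hc => hl hc.1), mul_zero]
        · simp
      rw [e1]
      rcases Nat.lt_succ_iff_lt_or_eq.1 hi with hi' | hi'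
      · rw [hA0 i j hi' hij, hA0 i m' hi' (Fin.lt_def.2 hi'), zero_mul, sub_zero]
      · have : i = m' := Fin.ext hi'
        rw [this] at hij ⊢
        have e2 : E m' j = A m' j / A m' m' := by
          simp only [hE]
          exact if_pos ⟨trivial, hij⟩
        rw [e2]
        by_cases hz : A m' m' = 0
        · have := hAm j hij.le
          rw [hz, norm_zero, norm_le_zero_iff] at this
          rw [this, hz]; simp
        · rw [mul_div_cancel₀ _ hz, sub_self]
  obtain ⟨k, hk, h⟩ := key n
  exact ⟨k, hk, mem_Bb.2 fun i j hij => h i j i.2 hij⟩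

lemma iwasawa' (g : GG p n) : ∃ b ∈ Bb p n, ∃ k ∈ Kc p n 0, g = b * k := by
  obtain ⟨k, hk, h⟩ := iwasawa g
  exact ⟨_, h, k⁻¹, inv_mem hk, by simp⟩

end B
end HX

namespace HX
set_option linter.unusedSectionVars false
set_option linter.unusedSimpArgs false
set_option linter.unusedVariables false
open Classical in
lemma psum {p : ℕ} [hp : Fact p.Prime] {𝔽 : Type*} [Field 𝔽] [CharP 𝔽 p]
    {X Q : Type*} [Fintype X] [Group Q] [MulAction Q X]
    (hQ : ∀ q : Q, ∃ j : ℕ, ∀ x : X, q ^ (p^j) • x = x) {U : Type*} [AddCommGroup U] [Module 𝔽 U]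
    (F : X → U) (hF : ∀ (q : Q) x, F (q • x) = F x) (h0 : ∀ x, (∀ q : Q, q • x = x) → F x = 0) :
    ∑ x, F x = 0 := by
  set P := (MulAction.toPermHom Q X).range with hP
  have hPg : IsPGroup p P := by
    rintro ⟨_, q, rfl⟩
    obtain ⟨j, hj⟩ := hQ q
    refine ⟨j, Subtype.ext ?_⟩
    change (MulAction.toPermHom Q X q)^(p^j) = 1
    rw [← map_pow]
    ext x
    exact hj x
  rw [Finset.sum_comp (fun u => u) F]
  refine Finset.sum_eq_zero fun u hu => ?_
  by_cases hu0 : u = 0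
  · rw [hu0, smul_zero]
  let Y : SubMulAction P X :=
    { carrier := {x | F x = u}
      smul_mem' := by
        rintro ⟨_, q, rfl⟩ x hx
        change F (q • x) = u
        rw [hF]; exact hx }
  have hc := hPg.card_modEq_card_fixedPoints Y
  have hfix : Nat.card (MulAction.fixedPoints P Y) = 0 := by
    rw [Nat.card_eq_zero]; left
    refine ⟨fun y => hu0 ?_⟩
    rw [← y.1.2]
    refine h0 _ fun q => ?_
    have := y.2 ⟨MulAction.toPermHom Q X q, q, rfl⟩
    exact congrArg Subtype.val this
  rw [hfix] at hc
  have hcard : Nat.card Y = (Finset.univ.filter (fun x => F x = u)).card := by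
    rw [Nat.card_eq_fintype_card, ← Fintype.card_subtype]
    exact Fintype.card_congr (Equiv.refl _)
  rw [hcard] at hc
  have h2 : ((Finset.univ.filter (fun x => F x = u)).card : 𝔽) = 0 :=
    (CharP.cast_eq_zero_iff 𝔽 p _).2 ((Nat.modEq_zero_iff_dvd).1 hc)
  rw [← Nat.cast_smul_eq_nsmul 𝔽, h2, zero_smul]

section C
variable {p n : ℕ} [hp : Fact p.Prime]
variable {𝔽 : Type*} [Field 𝔽]

noncomputable def act (g : GG p n) : (GG p n → 𝔽) →ₗ[𝔽] (GG p n → 𝔽) where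
  toFun f := fun x => f (x * g)
  map_add' _ _ := rfl
  map_smul' _ _ := rfl

@[simp] lemma act_apply (g : GG p n) (f : GG p n → 𝔽) (x : GG p n) : act g f x = f (x * g) := rfl
lemma act_mul (g h : GG p n) (f : GG p n → 𝔽) : act (g * h) f = act g (act h f) := by
  ext x; simp [mul_assoc]
@[simp] lemma act_one (f : GG p n → 𝔽) : act 1 f = f := by ext x; simp

lemma K0_unif (P : GG p n → ℕ → Prop) (hmono : ∀ x s t, s ≤ t → P x s → P x t)
    (h : ∀ x ∈ Kc p n 0, ∃ s, ∀ k ∈ Kc p n s, P (x * k) s) :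
    ∃ s, 1 ≤ s ∧ ∀ x ∈ Kc p n 0, P x s := by
  choose! S hS using h
  have hcov := K0_compact (p := p) (n := n)
  obtain ⟨F, hFc⟩ := hcov.elim_nhds_subcover' (fun x _ => {y | x⁻¹ * y ∈ Kc p n (S x)}) (by
    intro x hx
    have hc : Continuous (fun y : GG p n => x⁻¹ * y) := continuous_const.mul continuous_id
    exact ((Kc_open (S x)).preimage hc).mem_nhds (by simp [one_mem]))
  refine ⟨F.sup (fun x => S x.1) + 1, by omega, fun x hx => ?_⟩
  have := hFc hx
  simp only [Set.mem_iUnion] at this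
  obtain ⟨y, hy, hxy⟩ := this
  have := hS y.1 y.2 _ hxy
  rw [mul_inv_cancel_left] at this
  exact hmono _ _ _ ((Finset.le_sup (f := fun x : (Kc p n 0 : Set (GG p n)) => S x.1) hy).trans (Nat.le_succ _)) this

lemma K0_fin (s : ℕ) : ∃ F : Finset (GG p n), ∀ g, ∃ x ∈ F, ∃ b ∈ Bb p n, ∃ k ∈ Kc p n s,
    g = b * x * k := by
  obtain ⟨F, hFc⟩ := (K0_compact (p := p) (n := n)).elim_nhds_subcover' (fun x _ => {y | x⁻¹ * y ∈ Kc p n s}) (by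
    intro x hx
    have hc : Continuous (fun y : GG p n => x⁻¹ * y) := continuous_const.mul continuous_id
    exact ((Kc_open s).preimage hc).mem_nhds (by simp [one_mem]))
  classical
  refine ⟨F.image Subtype.val, fun g => ?_⟩
  obtain ⟨b, hb, k, hk, rfl⟩ := iwasawa' g
  have := hFc hk
  simp only [Set.mem_iUnion] at this
  obtain ⟨y, hy, hxy⟩ := this
  exact ⟨y, Finset.mem_image_of_mem _ hy, b, hb, _, hxy, by group⟩

/-- right `K_s`-invariance -/
def Inv (s : ℕ) (f : GG p n → 𝔽) : Prop := ∀ k ∈ Kc p n s, ∀ x, f (x * k) = f x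

lemma Inv.mono {s t : ℕ} (h : s ≤ t) {f : GG p n → 𝔽} (hf : Inv s f) : Inv t f :=
  fun k hk x => hf k (Kc_anti h hk) x

variable (T : Subgroup (GG p n)) (ψ : T →* 𝔽ˣ)

noncomputable def PS : Submodule 𝔽 (GG p n → 𝔽) where
  carrier := principalSeries p n 𝔽 T ψ
  zero_mem' := ⟨IsLocallyConstant.const 0, by simp, by simp⟩
  add_mem' := by
    rintro f g ⟨h1, h2, h3⟩ ⟨h1', h2', h3'⟩
    refine ⟨h1.add h1', fun t x => ?_, fun u hu x => ?_⟩
    · simp [h2, h2', mul_add]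
    · simp [h3 u hu, h3' u hu]
  smul_mem' := by
    rintro c f ⟨h1, h2, h3⟩
    refine ⟨h1.comp (fun y => c • y), fun t x => ?_, fun u hu x => ?_⟩
    · simp [h2]; ring
    · simp [h3 u hu]

def IsT : Prop := ∀ g : GG p n, g ∈ T ↔ ∀ i j : Fin n, i ≠ j → (g : MM p n) i j = 0

variable {T ψ}

lemma IsT.dgl (hT : IsT T) (d : Fin n → ℚ_[p]ˣ) : dgl d ∈ T :=
  (hT _).2 fun i j hij => by rw [dgl_val, Matrix.diagonal_apply_ne _ hij]

lemma IsT.le_Bb (hT : IsT T) {t : GG p n} (ht : t ∈ T) : t ∈ Bb p n :=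
  mem_Bb.2 fun i j hij => (hT t).1 ht i j hij.ne

lemma PS_B' (hT : IsT T) {f : GG p n → 𝔽} (hf : f ∈ PS T ψ) {b : GG p n} (hb : b ∈ Bb p n)
    (t : T) (ht : ∀ i, ((t : GG p n) : MM p n) i i = (b : MM p n) i i) (g : GG p n) :
    f (b * g) = (ψ t : 𝔽) * f g := by
  obtain ⟨d, hd, u, hu, rfl⟩ := Bb_decomp hb
  have : (t : GG p n) = HX.dgl d := by
    ext i j
    by_cases hij : i = j
    · subst hij
      rw [dgl_val, Matrix.diagonal_apply_eq, ht, hd]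
    · rw [(hT _).1 t.2 i j hij, dgl_val, Matrix.diagonal_apply_ne _ hij]
  rw [← this, mul_assoc, hf.2.1, hf.2.2 u hu]

lemma PS_B (hT : IsT T) {b : GG p n} (hb : b ∈ Bb p n) : ∃ c : 𝔽, c ≠ 0 ∧
    ∀ f ∈ PS T ψ, ∀ g : GG p n, f (b * g) = c * f g := by
  obtain ⟨d, hd, u, hu, h⟩ := Bb_decomp hb
  refine ⟨ψ ⟨dgl d, hT.dgl d⟩, Units.ne_zero _, fun f hf g => ?_⟩
  rw [PS_B' hT hf hb ⟨dgl d, hT.dgl d⟩]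
  intro i
  simp [← hd]

lemma PS_ne (hT : IsT T) {b : GG p n} (hb : b ∈ Bb p n) {f : GG p n → 𝔽} (hf : f ∈ PS T ψ) (g : GG p n) :
    f (b * g) = 0 ↔ f g = 0 := by
  obtain ⟨c, hc, h⟩ := PS_B (ψ := ψ) hT hb
  rw [h f hf]; simp [hc]

lemma PS_smooth (hT : IsT T) {f : GG p n → 𝔽} (hf : f ∈ PS T ψ) : ∃ s, 1 ≤ s ∧ Inv s f := by
  obtain ⟨s, hs, h⟩ := K0_unif (p := p) (n := n) (fun x s => ∀ k ∈ Kc p n s, f (x * k) = f x)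
    (fun x s t hst h k hk => h k (Kc_anti hst hk)) (by
      intro x hx
      have ho : IsOpen {k : GG p n | f (x * k) = f x} := by
        have := hf.1.isOpen_fiber (f x)
        exact this.preimage (continuous_const.mul continuous_id : Continuous fun k : GG p n => x * k)
      obtain ⟨s, hs, h⟩ := Kc_basis ho (by simp)
      refine ⟨s, fun k hk k' hk' => ?_⟩
      rw [mul_assoc]
      exact (h (mul_mem hk hk') : f (x * (k * k')) = f x).trans (h hk : f (x * k) = f x).symm)
  refine ⟨s, hs, fun k hk x => ?_⟩
  obtain ⟨b, hb, y, hy, rfl⟩ := iwasawa' x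
  obtain ⟨c, hc, h'⟩ := PS_B (ψ := ψ) hT hb
  rw [mul_assoc, h' f hf, h' f hf, h y hy k hk]

lemma Inv.loc {f : GG p n → 𝔽} {s : ℕ} (h : Inv s f) : IsLocallyConstant f := by
  rw [IsLocallyConstant.iff_exists_open]
  intro x
  refine ⟨{y | x⁻¹ * y ∈ Kc p n s}, ?_, by simp [one_mem], ?_⟩
  · exact (Kc_open s).preimage (continuous_const.mul continuous_id : Continuous fun k : GG p n => x⁻¹ * k)
  · intro y hy
    have := h _ hy x
    rwa [mul_inv_cancel_left] at this

lemma PS_act {f : GG p n → 𝔽} (hf : f ∈ PS T ψ) (g : GG p n) : act g f ∈ PS T ψ := by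
  refine ⟨?_, fun t x => ?_, fun u hu x => ?_⟩
  · exact hf.1.comp_continuous (continuous_id.mul continuous_const : Continuous fun x : GG p n => x * g)
  · simp [mul_assoc, hf.2.1]
  · simp [mul_assoc, hf.2.2 u hu]

lemma PS_cut (hT : IsT T) {f : GG p n → 𝔽} (hf : f ∈ PS T ψ) {S : Set (GG p n)} {s : ℕ}
    (h1 : ∀ b ∈ Bb p n, ∀ x ∈ S, b * x ∈ S) (h2 : ∀ k ∈ Kc p n s, ∀ x ∈ S, x * k ∈ S) :
    S.indicator f ∈ PS T ψ := by
  classical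
  have h1' : ∀ b ∈ Bb p n, ∀ x, b * x ∈ S ↔ x ∈ S := fun b hb x =>
    ⟨fun h => by simpa using h1 _ (inv_mem hb) _ h, h1 b hb x⟩
  have h2' : ∀ k ∈ Kc p n s, ∀ x, x * k ∈ S ↔ x ∈ S := fun b hb x =>
    ⟨fun h => by simpa using h2 _ (inv_mem hb) _ h, h2 b hb x⟩
  obtain ⟨s', hs', hi⟩ := PS_smooth hT hf
  refine ⟨?_, fun t x => ?_, fun u hu x => ?_⟩
  · apply Inv.loc (s := max s s')
    intro k hk x
    simp only [Set.indicator_apply, h2' k (Kc_anti (le_max_left _ _) hk), hi k (Kc_anti (le_max_right _ _) hk)]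
  · simp only [Set.indicator_apply, h1' _ (hT.le_Bb t.2), hf.2.1]
    split_ifs <;> simp
  · simp only [Set.indicator_apply, h1' _ (lowerUnipotent_sub hu), hf.2.2 u hu]

/-- the subgroup `R K_s` -/
def RK (R : Subgroup (GG p n)) (hR : R ≤ Kc p n 0) (s : ℕ) : Subgroup (GG p n) where
  carrier := {h | ∃ r ∈ R, ∃ k ∈ Kc p n s, h = r * k}
  one_mem' := ⟨1, one_mem _, 1, one_mem _, by simp⟩
  mul_mem' := by
    rintro _ _ ⟨r, hr, k, hk, rfl⟩ ⟨r', hr', k', hk', rfl⟩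
    exact ⟨r * r', mul_mem hr hr', (r'⁻¹ * k * r') * k', mul_mem (Kc_conj' (hR hr') hk) hk', by group⟩
  inv_mem' := by
    rintro _ ⟨r, hr, k, hk, rfl⟩
    exact ⟨r⁻¹, inv_mem hr, r * k⁻¹ * r⁻¹, Kc_conj (hR hr) (inv_mem hk), by group⟩


abbrev DQ (H : Subgroup (GG p n)) := DoubleCoset.Quotient (Bb p n : Set (GG p n)) (H : Set (GG p n))
noncomputable abbrev dmk (H : Subgroup (GG p n)) (x : GG p n) : DQ H := DoubleCoset.mk (Bb p n) H x
lemma dmk_eq (H : Subgroup (GG p n)) {a b : GG p n} :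
    dmk H a = dmk H b ↔ ∃ c ∈ Bb p n, ∃ k ∈ H, b = c * a * k := DoubleCoset.eq _ _ _ _
lemma dmk_B (H : Subgroup (GG p n)) {b x : GG p n} (hb : b ∈ Bb p n) : dmk H (b * x) = dmk H x := by
  symm; rw [dmk_eq]; exact ⟨b, hb, 1, one_mem _, by simp⟩
lemma dmk_H (H : Subgroup (GG p n)) {h x : GG p n} (hh : h ∈ H) : dmk H (x * h) = dmk H x := by
  symm; rw [dmk_eq]; exact ⟨1, one_mem _, h, hh, by simp⟩
lemma dmk_surj (H : Subgroup (GG p n)) (y : DQ H) : ∃ x, dmk H x = y :=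
  ⟨y.out, DoubleCoset.out_eq' _ _ y⟩

lemma DC_finite (H : Subgroup (GG p n)) {s : ℕ} (hH : Kc p n s ≤ H) : Finite (DQ H) := by
  obtain ⟨F, hF⟩ := K0_fin (p := p) (n := n) s
  refine Finite.of_surjective (fun x : F => dmk H x.1) ?_
  intro y
  obtain ⟨g, rfl⟩ := dmk_surj H y
  obtain ⟨x, hx, b, hb, k, hk, rfl⟩ := hF g
  exact ⟨⟨x, hx⟩, (dmk_eq H).2 ⟨b, hb, k, hH hk, rfl⟩⟩

noncomputable def cut (H : Subgroup (GG p n)) (β : DQ H) (f : GG p n → 𝔽) : GG p n → 𝔽 :=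
  {x | dmk H x = β}.indicator f

lemma cut_apply_of {H : Subgroup (GG p n)} {β : DQ H} {f : GG p n → 𝔽} {x : GG p n} (h : dmk H x = β) :
    cut H β f x = f x := Set.indicator_of_mem (s := {x | dmk H x = β}) h f
lemma cut_apply_ne {H : Subgroup (GG p n)} {β : DQ H} {f : GG p n → 𝔽} {x : GG p n} (h : dmk H x ≠ β) :
    cut H β f x = 0 := Set.indicator_of_notMem (s := {x | dmk H x = β}) h f

lemma cut_mem (hT : IsT T) {H : Subgroup (GG p n)} {s : ℕ} (hH : Kc p n s ≤ H) (β : DQ H)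
    {f : GG p n → 𝔽} (hf : f ∈ PS T ψ) : cut H β f ∈ PS T ψ :=
  PS_cut (s := s) hT hf (fun b hb x hx => (dmk_B H hb).trans hx) (fun k hk x hx => (dmk_H H (hH hk)).trans hx)

lemma cut_H {H : Subgroup (GG p n)} (β : DQ H) {f : GG p n → 𝔽} {h : GG p n} (hh : h ∈ H)
    (hf : ∀ x, f (x * h) = f x) (x : GG p n) : cut H β f (x * h) = cut H β f x := by
  by_cases hx : dmk H x = β
  · rw [cut_apply_of hx, cut_apply_of ((dmk_H H hh).trans hx), hf]
  · rw [cut_apply_ne hx, cut_apply_ne (fun h => hx ((dmk_H H hh).symm.trans h))]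

lemma cut_sum (H : Subgroup (GG p n)) [Fintype (DQ H)] (f : GG p n → 𝔽) :
    f = ∑ β : DQ H, cut H β f := by
  classical
  ext x
  rw [Finset.sum_apply, Finset.sum_eq_single (dmk H x)]
  · rw [cut_apply_of rfl]
  · intro β _ h; exact cut_apply_ne (Ne.symm h)
  · simp

lemma Klemma [CharP 𝔽 p] (hT : IsT T) {U : Type*} [AddCommGroup U] [Module 𝔽 U]
    (Q R : Subgroup (GG p n)) (hQ : Q ≤ Kc p n 1) (hRQ : R ≤ Q)
    (hnorm : ∀ q ∈ Q, ∀ r ∈ R, q * r * q⁻¹ ∈ R) (Λ : (GG p n → 𝔽) →ₗ[𝔽] U)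
    (hΛ : ∀ h ∈ PS T ψ, (∀ r ∈ R, ∀ x, h (x * r) = h x) → ∀ q ∈ Q, Λ (act q h) = Λ h)
    {f : GG p n → 𝔽} (hf : f ∈ PS T ψ) (hfQ : ∀ q ∈ Q, ∀ x, f (x * q) = f x)
    (good : ∀ x, f x ≠ 0 → ∃ q ∈ Q, ∃ s, ∀ b ∈ Bb p n, ∀ r ∈ R, ∀ k ∈ Kc p n s,
      x * q ≠ b * x * r * k) : Λ f = 0 := by
  classical
  have hQ0 : Q ≤ Kc p n 0 := hQ.trans (Kc_anti (Nat.zero_le _))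
  have hR0 : R ≤ Kc p n 0 := hRQ.trans hQ0
  obtain ⟨s0, hs0, hinv⟩ := PS_smooth hT hf
  obtain ⟨s1, hs1, hgood⟩ := K0_unif (p := p) (n := n) (fun x s => f x ≠ 0 → ∃ q ∈ Q, ∀ b ∈ Bb p n, ∀ r ∈ R,
      ∀ k ∈ Kc p n s, x * q ≠ b * x * r * k)
    (by
      intro x s t hst h hx
      obtain ⟨q, hq, h⟩ := h hx
      exact ⟨q, hq, fun b hb r hr k hk => h b hb r hr k (Kc_anti hst hk)⟩) (by
      intro x hx
      by_cases hfx : f x = 0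
      · refine ⟨s0, fun k hk h => ?_⟩
        rw [hinv k hk] at h; exact absurd hfx h
      obtain ⟨q, hq, s, h⟩ := good x hfx
      refine ⟨s, fun k' hk' _ => ⟨q, hq, fun b hb r hr k hk e => ?_⟩⟩
      refine h b hb r hr ((r⁻¹ * k' * r) * k * (q⁻¹ * k'⁻¹ * q)) (mul_mem (mul_mem (Kc_conj' (hR0 hr) hk') hk)
        (Kc_conj' (hQ0 hq) (inv_mem hk'))) ?_
      calc x * q = (x * k' * q) * (q⁻¹ * k'⁻¹ * q) := by group
        _ = _ := by rw [e]; group)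
  set s := max s0 s1 with hs
  set H := RK R hR0 s with hHdef
  have hHK : Kc p n s ≤ H := fun k hk => ⟨1, one_mem _, k, hk, by simp⟩
  have hHR : R ≤ H := fun r hr => ⟨r, hr, 1, one_mem _, by simp⟩
  have hHQ : ∀ q ∈ Q, ∀ h ∈ H, q * h * q⁻¹ ∈ H := by
    rintro q hq _ ⟨r, hr, k, hk, rfl⟩
    exact ⟨q * r * q⁻¹, hnorm q hq r hr, q * k * q⁻¹, Kc_conj (hQ0 hq) hk, by group⟩
  have : Finite (DQ H) := DC_finite H hHK
  have : Fintype (DQ H) := Fintype.ofFinite _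
  have hwd : ∀ (q : Q) (x y : GG p n), dmk H x = dmk H y → dmk H (x * (q:GG p n)⁻¹) = dmk H (y * (q:GG p n)⁻¹) := by
    intro q x y h
    obtain ⟨b, hb, k, hk, rfl⟩ := (dmk_eq H).1 h
    exact (dmk_eq H).2 ⟨b, hb, _, hHQ q q.2 k hk, by group⟩
  let a : MulAction Q (DQ H) :=
    { smul := fun q β => dmk H (β.out * (q:GG p n)⁻¹)
      one_smul := fun β => by
        change dmk H (β.out * ((1 : Q) : GG p n)⁻¹) = β
        simp only [OneMemClass.coe_one, inv_one, mul_one]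
        exact DoubleCoset.out_eq' _ _ β
      mul_smul := fun q q' β => by
        change dmk H (β.out * ((q * q' : Q) : GG p n)⁻¹) = dmk H ((dmk H (β.out * (q':GG p n)⁻¹)).out * (q:GG p n)⁻¹)
        rw [hwd q _ (β.out * (q':GG p n)⁻¹) (DoubleCoset.out_eq' _ _ _)]
        congr 1
        simp [mul_assoc] }
  have hsm : ∀ (q : Q) (x : GG p n), q • dmk H x = dmk H (x * (q:GG p n)⁻¹) := fun q x =>
    hwd q _ _ (DoubleCoset.out_eq' _ _ _)
  rw [cut_sum H f, map_sum]
  refine psum (p := p) (𝔽 := 𝔽) (Q := Q) ?_ _ ?_ ?_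
  · rintro ⟨q, hq⟩
    refine ⟨s, fun β => ?_⟩
    obtain ⟨x, rfl⟩ := dmk_surj H β
    rw [hsm]
    apply dmk_H
    apply hHK
    apply inv_mem
    have := Kc_pow_pp le_rfl (hQ hq) s
    simpa using Kc_anti (Nat.le_add_left s 1) this
  · intro q β
    obtain ⟨x0, rfl⟩ := dmk_surj H β
    have : cut H (q • dmk H x0) f = act (q : GG p n) (cut H (dmk H x0) f) := by
      ext x
      rw [act_apply, hsm]
      by_cases hx : dmk H x = dmk H (x0 * (q : GG p n)⁻¹)
      · rw [cut_apply_of hx, cut_apply_of, hfQ _ q.2]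
        have := hwd q⁻¹ _ _ hx
        simpa using this
      · rw [cut_apply_ne hx, cut_apply_ne]
        intro h
        apply hx
        have := hwd q _ _ h
        simpa using this
    rw [this]
    exact hΛ _ (cut_mem hT hHK _ hf) (fun r hr x => cut_H _ (hHR hr) (hfQ r (hRQ hr)) x) q q.2
  · intro β hβ
    suffices cut H β f = 0 by rw [this, map_zero]
    ext x
    by_cases hx : dmk H x = β
    swap
    · exact cut_apply_ne hx
    rw [cut_apply_of hx]
    by_contra hfx
    obtain ⟨b, hb, y, hy, rfl⟩ := iwasawa' x
    have hfy : f y ≠ 0 := fun h => hfx ((PS_ne hT hb hf y).2 h)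
    obtain ⟨q, hq, h⟩ := hgood y hy hfy
    rw [dmk_B H hb] at hx
    have h2 := hβ ⟨q, hq⟩⁻¹
    rw [← hx, hsm] at h2
    obtain ⟨c, hc, _, ⟨r, hr, k, hk, rfl⟩, e⟩ := (dmk_eq H).1 h2.symm
    refine h c hc r hr k (Kc_anti (le_max_right _ _) hk) ?_
    simpa [mul_assoc] using e

end C
end HX

namespace HX
set_option linter.unusedSectionVars false
set_option linter.unusedSimpArgs false
set_option linter.unusedVariables false
section D
variable {p n : ℕ} [hp : Fact p.Prime]

/-- bad points -/
def Bad (R : Subgroup (GG p n)) (x q : GG p n) : Prop :=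
  ∀ s, ∃ b ∈ Bb p n, ∃ r ∈ R, ∃ k ∈ Kc p n s, x * q = b * x * r * k

lemma Bad.eps {R : Subgroup (GG p n)} (hR : R ≤ Kc p n 0) {x q : GG p n} (hq : q ∈ Kc p n 0)
    (h : Bad R x q) {ε : ℝ} (hε : 0 < ε) :
    ∃ r ∈ R, ∀ i j : Fin n, i < j → ‖((x * (q * r⁻¹) * x⁻¹ : GG p n) : MM p n) i j‖ ≤ ε := by
  obtain ⟨c, hc, hcx⟩ := MB_exists (x : MM p n)
  obtain ⟨d, hd, hdx⟩ := MB_exists ((x⁻¹ : GG p n) : MM p n)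
  obtain ⟨s, hs, hse⟩ := ep_small (p := p) (ε := ε / ((c*d)*(c*d))) (by positivity)
  obtain ⟨b, hb, r, hr, k, hk, e⟩ := h s
  refine ⟨r, hr, fun i j hij => ?_⟩
  set Z : GG p n := x * (q * r⁻¹) * x⁻¹ with hZ
  set k' := r * k⁻¹ * r⁻¹ with hk'
  have hk'K : k' ∈ Kc p n s := Kc_conj (hR hr) (inv_mem hk)
  have h1 : b = Z * (x * k' * x⁻¹) := by
    have : b = x * q * k⁻¹ * r⁻¹ * x⁻¹ := by rw [e]; group
    rw [this, hZ, hk']; group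
  set E : MM p n := (x : MM p n) * (((k' : GG p n) : MM p n) - 1) * ((x⁻¹ : GG p n) : MM p n) with hE
  have h2 : (b : MM p n) = (Z : MM p n) + (Z : MM p n) * E := by
    rw [h1, Units.val_mul, Units.val_mul, Units.val_mul, hE, mul_sub, sub_mul, mul_one, gmul_inv,
      mul_sub, mul_one]; abel
  have h3 := congrFun (congrFun h2 i) j
  rw [mem_Bb.1 hb i j hij, Matrix.add_apply] at h3
  have h4 : (Z : MM p n) i j = - ((Z : MM p n) * E) i j := by linear_combination -h3
  rw [h4, norm_neg]
  have hZb : MB (c*d) (Z : MM p n) := by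
    rw [hZ, Units.val_mul, Units.val_mul]
    exact MB.mul hc.le hd.le (MB.mul_right hc.le hcx (mem_K0.1 (mul_mem hq (inv_mem (hR hr)))).1) hdx
  have hEb : MB (c * ep p s * d) E := MB.mul (by have := ep_pos (p:=p) s; positivity) hd.le
    (MB.mul hc.le (ep_pos s).le hcx hk'K.1) hdx
  have := MB.mul (by positivity) (by have := ep_pos (p:=p) s; positivity) hZb hEb i j
  refine this.trans ?_
  rw [le_div_iff₀ (by positivity)] at hse
  linarith

lemma lin_vanish {k m : ℕ} (ψ : MM p n →ₗ[ℚ_[p]] ℚ_[p])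
    (h : ∀ X, LB k X → MB (ep p m) X → ∀ ε : ℝ, 0 < ε → ∃ X', LB k X' ∧ MB (ep p (m+1)) X' ∧
      ‖ψ X - ψ X'‖ ≤ ε) : ∀ X, LB k X → ψ X = 0 := by
  have hb : ∃ C : ℝ, 0 < C ∧ ∀ X, LB k X → MB (ep p m) X → ‖ψ X‖ ≤ C := by
    obtain ⟨c, hc, hcc⟩ := MB_exists (fun i j => ψ (Matrix.single i j 1) : MM p n)
    refine ⟨c, hc, fun X _ hX => ?_⟩
    rw [Matrix.matrix_eq_sum_single X, map_sum]
    refine norm_sum_le' _ _ hc.le fun i _ => ?_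
    rw [map_sum]
    refine norm_sum_le' _ _ hc.le fun j _ => ?_
    have : Matrix.single i j (X i j) = X i j • Matrix.single i j (1:ℚ_[p]) := by
      rw [Matrix.smul_single, smul_eq_mul, mul_one]
    rw [this, map_smul, smul_eq_mul, norm_mul]
    calc _ ≤ 1 * c := mul_le_mul ((hX i j).trans (ep_le_one m)) (hcc i j) (norm_nonneg _) zero_le_one
      _ = c := one_mul c
  obtain ⟨C, hC, hb⟩ := hb
  have hstep : ∀ t : ℕ, ∀ X, LB k X → MB (ep p m) X → ‖ψ X‖ ≤ C * ep p t := by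
    intro t
    induction t with
    | zero => simpa [ep_zero] using hb
    | succ t ih =>
      intro X hX hXb
      have hpos : 0 < C * ep p (t+1) := mul_pos hC (ep_pos _)
      obtain ⟨X', hX', hXb', hd⟩ := h X hX hXb _ hpos
      have h1 : ‖ψ X'‖ ≤ C * ep p (t+1) := by
        have hb' : MB (ep p m) ((p:ℚ_[p])⁻¹ • X') := by
          have := hXb'.smul (p:ℚ_[p])⁻¹
          rwa [← pow_one (p:ℚ_[p]), norm_p_zpow_neg, ep_add, mul_comm (ep p m),
            inv_mul_cancel_left₀ (ep_pos 1).ne', pow_one] at this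
        have := ih _ (hX'.smul _) hb'
        rw [map_smul, smul_eq_mul, norm_mul, ← pow_one (p:ℚ_[p]), norm_p_zpow_neg] at this
        have h5 := ep_pos (p := p) 1
        rw [inv_mul_le_iff₀ h5] at this
        rw [ep_add]; linarith
      have : ψ X = (ψ X - ψ X') + ψ X' := by ring
      rw [this]
      exact (Padic.nonarchimedean _ _).trans (max_le hd h1)
  have hz : ∀ X, LB k X → MB (ep p m) X → ψ X = 0 := by
    intro X hX hXb
    rw [← norm_le_zero_iff]
    refine le_of_forall_pos_le_add fun ε hε => ?_
    obtain ⟨t, _, ht⟩ := ep_small (p := p) (ε := ε / C) (by positivity)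
    rw [le_div_iff₀ hC] at ht
    have := hstep t X hX hXb
    linarith
  intro X hX
  obtain ⟨c, hc, hcc⟩ := MB_exists X
  obtain ⟨t, _, ht⟩ := ep_small (p := p) (ε := ep p m / c) (by have := ep_pos (p:=p) m; positivity)
  have := hz ((p:ℚ_[p])^t • X) (hX.smul _) (by
    refine (hcc.smul _).mono ?_
    rw [norm_p_pow]
    rwa [le_div_iff₀ hc] at ht)
  rw [map_smul, smul_eq_mul, mul_eq_zero] at this
  exact this.resolve_left (pow_ne_zero _ p_ne)

/-- the functional `X ↦ (x X x⁻¹)_{ij}` -/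
noncomputable def phi (x : GG p n) (i j : Fin n) : MM p n →ₗ[ℚ_[p]] ℚ_[p] where
  toFun X := ((x : MM p n) * X * ((x⁻¹ : GG p n) : MM p n)) i j
  map_add' X Y := by rw [mul_add, add_mul, Matrix.add_apply]
  map_smul' c X := by simp

lemma phi_single (x : GG p n) (i j a b : Fin n) (c : ℚ_[p]) : phi x i j (Matrix.single a b c)
    = c * ((x : MM p n) i a * ((x⁻¹ : GG p n) : MM p n) b j) := by
  change ((x : MM p n) * Matrix.single a b c * ((x⁻¹ : GG p n) : MM p n)) i j = _
  rw [Matrix.mul_apply, Finset.sum_eq_single b]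
  · rw [Matrix.mul_single_apply_same]; ring
  · intro l _ hl
    rw [Matrix.mul_single_apply_of_ne _ _ _ _ _ hl, zero_mul]
  · simp

lemma LB_single {k : ℕ} {a b : Fin n} (ha : k ≤ a.val) (hb : b.val < k) (c : ℚ_[p]) :
    LB k (Matrix.single a b c : MM p n) := by
  intro i j hij
  apply Matrix.single_apply_of_ne
  rintro ⟨rfl, rfl⟩
  have := hij ha; omega

lemma G1 {k : ℕ} {x : GG p n} (h : ∀ i j : Fin n, i < j → ∀ X, LB k X → phi x i j X = 0) :
    x ∈ Pb p n k := by
  intro i a hi ha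
  by_contra hc
  apply hc
  have : x⁻¹ ∈ Pb p n k := by
    intro b j hb hj
    have := h i j (Fin.lt_def.2 (by omega)) _ (LB_single ha hb 1)
    rw [phi_single, one_mul, mul_eq_zero] at this
    exact this.resolve_left hc
  have := inv_mem this
  rw [inv_inv] at this
  exact this i a hi ha

structure Gd (k n : ℕ) : Prop where
  one_le : 1 ≤ k
  lt : k < n

def Gd.lo {k n : ℕ} (h : Gd k n) : Fin n := ⟨k-1, by have := h.1; have := h.2; omega⟩
def Gd.hi {k n : ℕ} (h : Gd k n) : Fin n := ⟨k, h.2⟩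
lemma Gd.lo_val {k n : ℕ} (h : Gd k n) : h.lo.val + 1 = k := by
  have := h.1; simp only [Gd.lo]; omega
lemma Gd.lo_lt {k n : ℕ} (h : Gd k n) : h.lo.val < k := by have := h.lo_val; omega
lemma Gd.hi_val {k n : ℕ} (h : Gd k n) : h.hi.val = k := rfl
lemma Gd.lo_lt_hi {k n : ℕ} (h : Gd k n) : h.lo < h.hi := Fin.lt_def.2 h.lo_lt
lemma Gd.lo_ne {k n : ℕ} (h : Gd k n) : h.lo ≠ h.hi := h.lo_lt_hi.ne

noncomputable def sk {k : ℕ} (h : Gd k n) : GG p n := sw h.lo h.hi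

lemma u0_LB {k : ℕ} (h : Gd k n) (b : ℚ_[p]) : LB k (Matrix.single h.hi h.lo b : MM p n) :=
  LB_single h.hi_val.ge h.lo_lt b

noncomputable def u0 {k : ℕ} (h : Gd k n) (b : ℚ_[p]) : GG p n := mkV k _ (u0_LB h b)

lemma u0_mem {k : ℕ} (h : Gd k n) (b : ℚ_[p]) : u0 h b ∈ V p n k := mkV_mem _

lemma u0_val {k : ℕ} (h : Gd k n) (b : ℚ_[p]) : ((u0 h b : GG p n) : MM p n) = 1 + Matrix.single h.hi h.lo b := rfl
lemma u0_add {k : ℕ} (h : Gd k n) (b c : ℚ_[p]) : (u0 h b : GG p n) * u0 h c = u0 h (b + c) := by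
  rw [u0, u0, mkV_mul]; exact mkV_congr _ (Matrix.single_add _ _ _ _).symm
lemma u0_inv {k : ℕ} (h : Gd k n) (b : ℚ_[p]) : (u0 h b : GG p n)⁻¹ = u0 h (-b) := by
  change (mkV k _ (u0_LB h b))⁻¹ = mkV k _ (u0_LB h (-b))
  rw [mkV_inv]; exact mkV_congr _ (by rw [Matrix.single_neg])
lemma u0_mul_apply {k : ℕ} (h : Gd k n) (b : ℚ_[p]) (g : GG p n) (i j : Fin n) :
    ((u0 h b * g : GG p n) : MM p n) i j = (g : MM p n) i j + if i = h.hi then b * (g : MM p n) h.lo j else 0 := by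
  rw [Units.val_mul, u0_val, add_mul, one_mul, Matrix.add_apply]
  congr 1
  split_ifs with hi
  · rw [hi, Matrix.single_mul_apply_same]
  · rw [Matrix.single_mul_apply_of_ne _ _ _ _ _ hi]

end D
end HX

namespace HX
set_option linter.unusedSectionVars false
set_option linter.unusedSimpArgs false
set_option linter.unusedVariables false
section E
variable {p n : ℕ} [hp : Fact p.Prime]

/-- the group `w^ℤ V_s` -/
def Rw {k : ℕ} {W : MM p n} (hW : LB k W) (s : ℕ) : Subgroup (GG p n) where
  carrier := {g | ∃ a : ℤ, ∃ X, ∃ hX : LB k X, MB (ep p s) X ∧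
    g = mkV k ((a : ℚ_[p]) • W + X) ((hW.smul _).add hX)}
  one_mem' := ⟨0, 0, LB_zero, MB_zero (ep_pos s).le, by ext1; simp⟩
  mul_mem' := by
    rintro _ _ ⟨a, X, hX, hX', rfl⟩ ⟨b, Y, hY, hY', rfl⟩
    refine ⟨a + b, X + Y, hX.add hY, hX'.add hY', ?_⟩
    rw [mkV_mul]; exact mkV_congr _ (by push_cast; rw [add_smul]; abel)
  inv_mem' := by
    rintro _ ⟨a, X, hX, hX', rfl⟩
    refine ⟨-a, -X, hX.neg, hX'.neg, ?_⟩
    rw [mkV_inv]; exact mkV_congr _ (by push_cast; rw [neg_smul]; abel)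

lemma Rw_le_V {k : ℕ} {W : MM p n} (hW : LB k W) (s : ℕ) : Rw hW s ≤ V p n k := by
  rintro _ ⟨a, X, hX, hX', rfl⟩; exact mkV_mem _

lemma norm_int_smul {c : ℝ} {W : MM p n} (h : MB c W) (a : ℤ) : MB c ((a : ℚ_[p]) • W) := by
  intro i j
  rw [Matrix.smul_apply, smul_eq_mul, norm_mul]
  have h1 := Padic.norm_int_le_one (p := p) a
  have h2 := h i j
  nlinarith [norm_nonneg (W i j)]

lemma Rw_le_Kc {k : ℕ} {W : MM p n} (hW : LB k W) {s t : ℕ} (h : MB (ep p t) W) (hts : t ≤ s) :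
    Rw hW s ≤ Kc p n t := by
  rintro _ ⟨a, X, hX, hX', rfl⟩
  rw [mkV_mem_Kc]
  exact (norm_int_smul h a).add (hX'.mono (ep_anti hts))

lemma Rw_w {k : ℕ} {W : MM p n} (hW : LB k W) (s : ℕ) : mkV k W hW ∈ Rw hW s :=
  ⟨1, 0, LB_zero, MB_zero (ep_pos s).le, mkV_congr _ (by simp)⟩

lemma Rw_V {k : ℕ} {W : MM p n} (hW : LB k W) {s : ℕ} {v : GG p n} (hv : v ∈ V p n k)
    (h : v ∈ Kc p n s) : v ∈ Rw hW s := by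
  obtain ⟨X, hX, rfl⟩ := hv
  exact ⟨0, X, hX, (mkV_mem_Kc hX).1 h, mkV_congr _ (by simp)⟩

lemma Rw_ind {k : ℕ} {W : MM p n} (hW : LB k W) {s : ℕ} (S : Subgroup (GG p n))
    (h1 : mkV k W hW ∈ S) (h2 : ∀ v ∈ V p n k, v ∈ Kc p n s → v ∈ S) : Rw hW s ≤ S := by
  rintro _ ⟨a, X, hX, hX', rfl⟩
  have e : mkV k ((a : ℚ_[p]) • W + X) ((hW.smul _).add hX) = mkV k ((a : ℚ_[p]) • W) (hW.smul _) * mkV k X hX :=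
    (mkV_mul _ _).symm
  rw [e]
  refine mul_mem ?_ (h2 _ (mkV_mem _) ((mkV_mem_Kc hX).2 hX'))
  obtain ⟨m, rfl | rfl⟩ := a.eq_nat_or_neg
  · have := pow_mem h1 m
    rw [mkV_pow] at this
    exact_mod_cast this
  · have := inv_mem (pow_mem h1 m)
    rw [mkV_pow, mkV_inv] at this
    convert this using 1
    exact mkV_congr _ (by push_cast; rw [neg_smul])

lemma Vbad_lin {k m : ℕ} {W : MM p n} (hW : LB k W) (hW0 : MB 1 W) {x : GG p n}
    (hbad : ∀ q ∈ V p n k, q ∈ Kc p n m → Bad (Rw hW (m+1)) x q) {X : MM p n} (hX : LB k X)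
    (hXm : MB (ep p m) X) {ε : ℝ} (hε : 0 < ε) : ∃ a : ℤ, ∃ X', LB k X' ∧ MB (ep p (m+1)) X' ∧
      ∀ i j : Fin n, i < j → ‖phi x i j X - a * phi x i j W - phi x i j X'‖ ≤ ε := by
  have hR : Rw hW (m+1) ≤ Kc p n 0 := Rw_le_Kc hW (by rwa [ep_zero]) (Nat.zero_le _)
  have hq : mkV k X hX ∈ Kc p n m := (mkV_mem_Kc hX).2 hXm
  obtain ⟨r, ⟨a, X', hX', hX'b, rfl⟩, hr⟩ :=
    Bad.eps hR (Kc_anti (Nat.zero_le _) hq) (hbad _ (mkV_mem hX) hq) hε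
  refine ⟨a, X', hX', hX'b, fun i j hij => ?_⟩
  have := hr i j hij
  rw [mkV_inv, mkV_mul, Units.val_mul, Units.val_mul, mkV_val, mul_add, mul_one, add_mul, gmul_inv,
    Matrix.add_apply, Matrix.one_apply_ne hij.ne, zero_add] at this
  convert this using 2
  change _ = phi x i j _
  rw [map_add, map_neg, map_add, map_smul, smul_eq_mul]; ring

lemma G2 {k : ℕ} (h : Gd k n) {x : GG p n} {u v : Fin n → ℚ_[p]} {c : Fin n → Fin n → ℚ_[p]}
    (hx : x ∉ Pb p n k)
    (H : ∀ i j : Fin n, i < j → ∀ a b : Fin n, k ≤ a.val → b.val < k →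
      (x : MM p n) i a * ((x⁻¹ : GG p n) : MM p n) b j = c i j * (u a * v b)) :
    ∃ b ∈ Bb p n, ∃ g ∈ Pb p n k, x = b * sk h * g := by
  classical
  set X : MM p n := (x : MM p n) with hX
  set Y : MM p n := ((x⁻¹ : GG p n) : MM p n) with hY
  have hYX : Y * X = 1 := ginv_mul x
  have hXY : X * Y = 1 := gmul_inv x
  have hex : ∃ i : Fin n, ∃ a : Fin n, k ≤ a.val ∧ X i a ≠ 0 ∧ i.val < k := by
    by_contra hc; push Not at hc
    apply hx; intro i a hi ha
    by_contra hne
    exact absurd (hc i a ha hne) (by omega)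
  obtain ⟨i0, hi0, hmin⟩ : ∃ i0 : Fin n, (∃ a : Fin n, k ≤ a.val ∧ X i0 a ≠ 0 ∧ i0.val < k) ∧
      ∀ i < i0, ∀ a : Fin n, k ≤ a.val → X i a = 0 := by
    obtain ⟨i0, h0, hm⟩ := WellFounded.has_min (wellFounded_lt (α := Fin n))
      {i | ∃ a : Fin n, k ≤ a.val ∧ X i a ≠ 0 ∧ i.val < k} hex
    refine ⟨i0, h0, fun i hi a ha => ?_⟩
    by_contra hne
    obtain ⟨_, _, _, h5⟩ := h0
    exact hm i ⟨a, ha, hne, by have := Fin.lt_def.1 hi; omega⟩ hi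
  obtain ⟨a0, ha0, hne, hi0k⟩ := hi0
  -- columns
  have hyx : ∀ b a : Fin n, b.val < k → k ≤ a.val → ∑ j, Y b j * X j a = 0 := by
    intro b a hb ha
    have := congrFun (congrFun hYX b) a
    rwa [Matrix.mul_apply, Matrix.one_apply_ne (Fin.ne_of_lt (by rw [Fin.lt_def]; omega))] at this
  obtain ⟨d, hd⟩ : ∃ d : Fin n → ℚ_[p], ∀ j, i0 < j → ∀ b : Fin n, b.val < k → Y b j = d j * v b := by
    refine ⟨fun j => c i0 j * u a0 / X i0 a0, fun j hj b hb => ?_⟩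
    have := H i0 j hj a0 b ha0 hb
    field_simp
    linear_combination this
  have hd0 : ∃ d0 : ℚ_[p], ∀ b : Fin n, b.val < k → Y b i0 = d0 * v b := by
    refine ⟨-(∑ j ∈ Finset.univ.filter (fun j => i0 < j), d j * X j a0) / X i0 a0, fun b hb => ?_⟩
    have h1 := hyx b a0 hb ha0
    have h2 : ∑ j, Y b j * X j a0 = Y b i0 * X i0 a0 +
        ∑ j ∈ Finset.univ.filter (fun j => i0 < j), Y b j * X j a0 := by
      rw [← Finset.add_sum_erase _ _ (Finset.mem_univ i0)]
      congr 1
      symm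
      apply Finset.sum_subset
      · intro j hj
        simp only [Finset.mem_filter, Finset.mem_univ, true_and] at hj
        simp [hj.ne']
      · intro j hj hj'
        simp only [Finset.mem_filter, Finset.mem_univ, true_and, Finset.mem_erase, ne_eq, and_true, not_lt] at hj hj'
        rw [hmin j (lt_of_le_of_ne hj' hj) a0 ha0, mul_zero]
    have h3 : ∑ j ∈ Finset.univ.filter (fun j => i0 < j), Y b j * X j a0
        = (∑ j ∈ Finset.univ.filter (fun j => i0 < j), d j * X j a0) * v b := by
      rw [Finset.sum_mul]
      refine Finset.sum_congr rfl fun j hj => ?_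
      simp only [Finset.mem_filter, Finset.mem_univ, true_and] at hj
      rw [hd j hj b hb]; ring
    rw [h2, h3] at h1
    field_simp
    linear_combination h1
  obtain ⟨d0, hd0⟩ := hd0
  have hkn := h.lt
  have hi0v : i0.val + 1 = k := by
    by_contra hcon
    have hlt : i0.val + 1 < k := by omega
    let f : (Fin k → ℚ_[p]) →ₗ[ℚ_[p]] (Fin (i0.val+1) → ℚ_[p]) :=
      Matrix.toLin' (fun (j : Fin (i0.val+1)) (b : Fin k) =>
        if j.val = i0.val then v ⟨b.val, by omega⟩ else Y ⟨b.val, by omega⟩ ⟨j.val, by omega⟩)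
    have hker : LinearMap.ker f ≠ ⊥ := LinearMap.ker_ne_bot_of_finrank_lt (by simpa using hlt)
    obtain ⟨l, hl, hl0⟩ := (Submodule.ne_bot_iff _).1 hker
    have hf : ∀ j : Fin (i0.val+1), ∑ b : Fin k, (if j.val = i0.val then v ⟨b.val, by omega⟩ else
        Y ⟨b.val, by omega⟩ ⟨j.val, by omega⟩) * l b = 0 := fun j => congrFun (LinearMap.mem_ker.1 hl) j
    have hv0 : ∑ b : Fin k, v ⟨b.val, by omega⟩ * l b = 0 := by
      have := hf ⟨i0.val, by omega⟩
      simpa using this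
    let l' : Fin n → ℚ_[p] := fun b => if hb : b.val < k then l ⟨b.val, hb⟩ else 0
    have hsum : ∀ g : Fin n → ℚ_[p], ∑ b, l' b * g b = ∑ b : Fin k, l b * g ⟨b.val, by omega⟩ := by
      intro g
      symm
      refine Finset.sum_of_injOn (fun b : Fin k => (⟨b.val, by omega⟩ : Fin n)) ?_ ?_ ?_ ?_
      · intro a _ b _ hab
        simpa [Fin.ext_iff] using hab
      · intro a _; simp
      · intro b _ hb
        have : ¬ b.val < k := fun hlt => hb ⟨⟨b.val, hlt⟩, by simp, rfl⟩
        simp [l', this]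
      · intro b _; simp [l']
    have hz : Matrix.vecMul l' Y = 0 := by
      ext j
      change ∑ b, l' b * Y b j = 0
      rw [hsum]
      rcases lt_trichotomy j i0 with hj | hj | hj
      · have := hf ⟨j.val, by have := Fin.lt_def.1 hj; omega⟩
        simp only [(Fin.lt_def.1 hj).ne, if_false] at this
        rw [← this]; exact Finset.sum_congr rfl fun b _ => mul_comm _ _
      · rw [hj]
        calc _ = d0 * ∑ b : Fin k, v ⟨b.val, by omega⟩ * l b := by
              rw [Finset.mul_sum]; refine Finset.sum_congr rfl fun b _ => ?_
              rw [hd0 _ b.2]; ring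
          _ = 0 := by rw [hv0, mul_zero]
      · calc _ = d j * ∑ b : Fin k, v ⟨b.val, by omega⟩ * l b := by
              rw [Finset.mul_sum]; refine Finset.sum_congr rfl fun b _ => ?_
              rw [hd j hj _ b.2]; ring
          _ = 0 := by rw [hv0, mul_zero]
    have : l' = 0 := by
      have := congrArg (fun w => Matrix.vecMul w X) hz
      simpa [Matrix.vecMul_vecMul, hYX] using this
    apply hl0
    ext b
    have := congrFun this ⟨b.val, by omega⟩
    simpa [l'] using this
  have hlo : i0 = h.lo := Fin.ext (by have := h.lo_val; omega)
  subst hlo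
  -- find c'
  have hc' : ∃ c' : ℚ_[p], ∀ a : Fin n, k ≤ a.val → X h.hi a = c' * X h.lo a := by
    by_cases hcase : ∃ j : Fin n, h.hi < j ∧ ∃ b : Fin n, b.val < k ∧ Y b j ≠ 0
    · obtain ⟨j, hj, b, hb, hbj⟩ := hcase
      have e0 := H h.lo j (h.lo_lt_hi.trans hj) a0 b ha0 hb
      have hcne : c h.lo j * v b ≠ 0 := by
        intro h0
        apply mul_ne_zero hne hbj
        rw [e0]; linear_combination u a0 * h0
      refine ⟨c h.hi j * v b / (c h.lo j * v b), fun a ha => ?_⟩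
      have e1 := H h.lo j (h.lo_lt_hi.trans hj) a b ha hb
      have e2 := H h.hi j hj a b ha hb
      rw [div_mul_eq_mul_div, eq_div_iff hcne]
      apply mul_right_cancel₀ hbj
      linear_combination c h.lo j * v b * e2 - c h.hi j * v b * e1
    · push Not at hcase
      have : ∃ b : Fin n, b.val < k ∧ Y b h.hi ≠ 0 := by
        by_contra hc; push Not at hc
        apply hx
        rw [← inv_mem_iff]
        intro b j hb hj
        rcases (show h.hi ≤ j from Fin.le_def.2 hj).eq_or_lt with e | e
        · rw [← e]; exact hc b hb
        · exact hcase j e b hb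
      obtain ⟨b, hb, hbn⟩ := this
      refine ⟨- Y b h.lo / Y b h.hi, fun a ha => ?_⟩
      have h1 := hyx b a hb ha
      rw [← Finset.add_sum_erase _ _ (Finset.mem_univ h.lo),
        ← Finset.add_sum_erase _ _ (Finset.mem_erase.2 ⟨h.lo_ne.symm, Finset.mem_univ h.hi⟩),
        Finset.sum_eq_zero (s := (Finset.univ.erase h.lo).erase h.hi), add_zero] at h1
      · field_simp; linear_combination h1
      · intro j hj
        simp only [Finset.mem_erase, Finset.mem_univ, and_true, ne_eq] at hj
        rcases lt_trichotomy j h.hi with e | e | e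
        · rw [hmin j (lt_of_le_of_ne (by
            have := Fin.lt_def.1 e; have := h.hi_val; have := h.lo_val; rw [Fin.le_def]; omega) hj.2) a ha, mul_zero]
        · exact absurd e hj.1
        · rw [hcase j e b hb, zero_mul]
  obtain ⟨c', hc'⟩ := hc'
  refine ⟨u0 h c', V_le_Bb (u0_mem h c'), sk h * (u0 h (-c') * x), ?_, ?_⟩
  · intro i a hi ha
    rw [sk, sw_mul, u0_mul_apply]
    by_cases hil : i = h.lo
    · rw [hil, Equiv.swap_apply_left, if_pos rfl]
      have := hc' a ha
      rw [hX] at this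
      rw [this]; ring
    · have hih : i ≠ h.hi := by rintro rfl; have := h.hi_val; omega
      rw [Equiv.swap_apply_of_ne_of_ne hil hih, if_neg hih, add_zero]
      apply hmin _ _ a ha
      rw [Fin.lt_def]
      have := h.lo_val
      have : i.val ≠ h.lo.val := fun e => hil (Fin.ext e)
      omega
  · rw [← u0_inv]
    have : (sk h : GG p n) * sk h = 1 := sw_sw _ _
    calc x = u0 h c' * (sk h * sk h) * ((u0 h c')⁻¹ * x) := by rw [this]; group
      _ = _ := by group

lemma Vpart {k m : ℕ} (h : Gd k n) {W : MM p n} (hW : LB k W) (hW0 : MB 1 W) {x : GG p n}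
    (hbad : ∀ q ∈ V p n k, q ∈ Kc p n m → Bad (Rw hW (m+1)) x q) :
    x ∈ Pb p n k ∨ ∃ b ∈ Bb p n, ∃ g ∈ Pb p n k, x = b * sk h * g := by
  by_cases hx : x ∈ Pb p n k
  · exact Or.inl hx
  right
  have hex : ∃ i' j' : Fin n, i' < j' ∧ phi x i' j' W ≠ 0 := by
    by_contra hc; push Not at hc
    apply hx
    refine G1 fun i j hij => lin_vanish (m := m) _ fun X hX hXm ε hε => ?_
    obtain ⟨a, X', hX', hX'b, hh⟩ := Vbad_lin hW hW0 hbad hX hXm hε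
    refine ⟨X', hX', hX'b, ?_⟩
    have := hh i j hij
    rwa [hc i j hij, mul_zero, sub_zero] at this
  obtain ⟨i', j', hij', hne⟩ := hex
  refine G2 h (u := fun a => (x : MM p n) i' a) (v := fun b => ((x⁻¹ : GG p n) : MM p n) b j')
    (c := fun i j => phi x i j W / phi x i' j' W) hx fun i j hij a b ha hb => ?_
  have := lin_vanish (k := k) (m := m) (phi x i' j' W • phi x i j - phi x i j W • phi x i' j')
    (fun X hX hXm ε hε => by
      set C := ‖phi x i' j' W‖ + ‖phi x i j W‖ with hC
      have hCp : 0 < C := by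
        have := norm_pos_iff.2 hne
        have := norm_nonneg (phi x i j W)
        linarith
      obtain ⟨a, X', hX', hX'b, hh⟩ := Vbad_lin hW hW0 hbad hX hXm (ε := ε / C) (by positivity)
      refine ⟨X', hX', hX'b, ?_⟩
      have h1 := hh i j hij
      have h2 := hh i' j' hij'
      simp only [LinearMap.sub_apply, LinearMap.smul_apply, smul_eq_mul]
      have e : phi x i' j' W * phi x i j X - phi x i j W * phi x i' j' X -
          (phi x i' j' W * phi x i j X' - phi x i j W * phi x i' j' X') =
          phi x i' j' W * (phi x i j X - a * phi x i j W - phi x i j X') -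
          phi x i j W * (phi x i' j' X - a * phi x i' j' W - phi x i' j' X') := by ring
      rw [e]
      refine (norm_sub_le _ _).trans ?_
      rw [norm_mul, norm_mul]
      have h3 := mul_le_mul_of_nonneg_left h1 (norm_nonneg (phi x i' j' W))
      have h4 := mul_le_mul_of_nonneg_left h2 (norm_nonneg (phi x i j W))
      have : C * (ε / C) = ε := by field_simp
      rw [hC] at this h3 h4
      nlinarith) _ (LB_single ha hb 1)
  simp only [LinearMap.sub_apply, LinearMap.smul_apply, smul_eq_mul, phi_single] at this
  field_simp
  linear_combination this

lemma Vpart1 {k m : ℕ} {x : GG p n}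
    (hbad : ∀ q ∈ V p n k, q ∈ Kc p n m → Bad (Rw (LB_zero (p := p) (n := n) (k := k)) (m+1)) x q) :
    x ∈ Pb p n k := by
  refine G1 fun i j hij => lin_vanish (m := m) _ fun X hX hXm ε hε => ?_
  obtain ⟨a, X', hX', hX'b, hh⟩ := Vbad_lin LB_zero (MB_zero zero_le_one) hbad hX hXm hε
  refine ⟨X', hX', hX'b, ?_⟩
  have := hh i j hij
  rwa [map_zero, mul_zero, sub_zero] at this

end E
end HX

namespace HX
set_option linter.unusedSectionVars false
set_option linter.unusedSimpArgs false
set_option linter.unusedVariables false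
section F
variable {p n : ℕ} [hp : Fact p.Prime]

/-- lower unipotent subgroup -/
def Nb (p n : ℕ) [Fact p.Prime] : Subgroup (GG p n) where
  carrier := lowerUnipotent p n
  one_mem' := ⟨fun i j h => by simp [h.ne], fun i => by simp⟩
  mul_mem' := by
    intro a b ha hb
    refine ⟨mem_Bb.1 (mul_mem (lowerUnipotent_sub ha) (lowerUnipotent_sub hb)), fun i => ?_⟩
    rw [Bb_mul_diag (lowerUnipotent_sub ha) (lowerUnipotent_sub hb), ha.2, hb.2, one_mul]
  inv_mem' := by
    intro a ha
    refine ⟨mem_Bb.1 (inv_mem (lowerUnipotent_sub ha)), fun i => ?_⟩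
    have := Bb_mul_diag (lowerUnipotent_sub ha) (inv_mem (lowerUnipotent_sub ha)) i
    rw [ha.2, one_mul, mul_inv_cancel] at this
    rw [← this]; simp

lemma Nb_le : Nb p n ≤ Bb p n := fun _ h => lowerUnipotent_sub h
lemma V_le_Nb {k : ℕ} : V p n k ≤ Nb p n := fun _ h => V_le_lowerUnipotent h

lemma Bad.B {R : Subgroup (GG p n)} {b x q : GG p n} (hb : b ∈ Bb p n) (h : Bad R (b * x) q) : Bad R x q := by
  intro s
  obtain ⟨b', hb', r, hr, k, hk, e⟩ := h s
  refine ⟨b⁻¹ * b' * b, mul_mem (mul_mem (inv_mem hb) hb') hb, r, hr, k, hk, ?_⟩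
  calc x * q = b⁻¹ * (b * x * q) := by group
    _ = _ := by rw [e]; group

/-- `s_k B̄ ⊂ B̄ s_k u_0(ℚ_p)` -/
lemma sk_B {k : ℕ} (h : Gd k n) {g : GG p n} (hg : g ∈ Bb p n) :
    ∃ b ∈ Bb p n, ∃ c, sk h * g = b * sk h * u0 h c := by
  set c := (g : MM p n) h.hi h.lo / (g : MM p n) h.hi h.hi with hc
  have hne := Bb_diag_ne hg h.hi
  set g' := g * u0 h (-c) with hg'
  have hg'B : g' ∈ Bb p n := mul_mem hg (V_le_Bb (u0_mem h _))
  have h0 : (g' : MM p n) h.hi h.lo = 0 := by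
    rw [hg', Units.val_mul, u0_val, mul_add, mul_one, Matrix.add_apply, Matrix.mul_single_apply_same, hc]
    field_simp; ring
  refine ⟨sk h * g' * sk h, ?_, c, ?_⟩
  · rw [mem_Bb]
    intro i j hij
    have e : ((sk h * g' * sk h : GG p n) : MM p n) i j
        = (g' : MM p n) (Equiv.swap h.lo h.hi i) (Equiv.swap h.lo h.hi j) := by
      rw [sk, mul_sw, sw_mul]
    rw [e]
    have hlv := h.lo_val
    have hhv := h.hi_val
    rw [Fin.lt_def] at hij
    by_cases hcase : i = h.lo ∧ j = h.hi
    · rw [hcase.1, hcase.2, Equiv.swap_apply_left, Equiv.swap_apply_right, h0]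
    · apply mem_Bb.1 hg'B
      rw [Equiv.swap_apply_def, Equiv.swap_apply_def]
      simp only [Fin.ext_iff] at hcase ⊢
      rw [Fin.lt_def]
      split_ifs <;> omega
  · have : (sk h : GG p n) * sk h = 1 := sw_sw _ _
    rw [hg', ← u0_inv]
    calc sk h * g = sk h * g * (u0 h c)⁻¹ * (1 : GG p n) * u0 h c := by group
      _ = _ := by rw [← this]; group

lemma G3 {t : ℕ} {g : GG p n} (h : ∀ v ∈ Nb p n, v ∈ Kc p n t → g * v * g⁻¹ ∈ Bb p n) : g ∈ Bb p n := by
  rw [Bb, Subgroup.mem_iInf]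
  intro l
  refine G1 fun i j hij X hX => ?_
  obtain ⟨c, hc, hcc⟩ := MB_exists X
  obtain ⟨s, _, hs⟩ := ep_small (p := p) (ε := ep p t / c) (by have := ep_pos (p:=p) t; positivity)
  have hm : mkV l ((p:ℚ_[p])^s • X) (hX.smul _) ∈ Kc p n t := by
    rw [mkV_mem_Kc]
    refine (hcc.smul _).mono ?_
    rw [norm_p_pow]
    rwa [le_div_iff₀ hc] at hs
  have := mem_Bb.1 (h _ (V_le_Nb (mkV_mem _)) hm) i j hij
  rw [Units.val_mul, Units.val_mul, mkV_val, mul_add, mul_one, add_mul, gmul_inv,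
    Matrix.add_apply, Matrix.one_apply_ne hij.ne, zero_add] at this
  change phi g i j _ = 0 at this
  rw [map_smul, smul_eq_mul, mul_eq_zero] at this
  exact this.resolve_left (pow_ne_zero _ p_ne)

/-- block parts -/
lemma UZ_LB_apply {k : ℕ} {A X : MM p n} (hA : UZ k A) (hX : LB k X) {i j : Fin n} (hij : k ≤ i.val → k ≤ j.val) :
    (A * X) i j = 0 := UZ_LB_mul hA hX i j hij

lemma Nbad {k m t : ℕ} (h : Gd k n) {W : MM p n} (hW : LB k W) (hW0 : MB 1 W) {g : GG p n} (hg : g ∈ Pb p n k)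
    (hbad : ∀ q ∈ Nb p n, q ∈ Kc p n t → Bad (Rw hW (m+1)) (sk h * g) q) : g ∈ Bb p n := by
  refine G3 (t := t) fun v hv hvt => ?_
  have hR : Rw hW (m+1) ≤ Kc p n 0 := Rw_le_Kc hW (by rwa [ep_zero]) (Nat.zero_le _)
  have hvP : v ∈ Pb p n k := Bb_le k (Nb_le hv)
  rw [mem_Bb]
  intro i j hij
  by_cases hblock : i.val < k ∧ k ≤ j.val
  · exact mem_Pb.1 (mul_mem (mul_mem hg hvP) (inv_mem hg)) i j hblock.1 hblock.2
  rw [← norm_le_zero_iff]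
  refine le_of_forall_pos_le_add fun ε hε => ?_
  rw [zero_add]
  obtain ⟨r, hr, hh⟩ := Bad.eps hR (Kc_anti (Nat.zero_le _) hvt) (hbad v hv hvt) hε
  obtain ⟨X, hX, hrX⟩ := inv_mem (Rw_le_V hW _ hr)
  have e1 : ((g * v * g⁻¹ : GG p n) : MM p n) i j = ((g * (v * r⁻¹) * g⁻¹ : GG p n) : MM p n) i j := by
    have : ((g * (v * r⁻¹) * g⁻¹ : GG p n) : MM p n) = ((g * v * g⁻¹ : GG p n) : MM p n) +
        ((g * v : GG p n) : MM p n) * (X * ((g⁻¹ : GG p n) : MM p n)) := by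
      rw [hrX]; push_cast; rw [mkV_val]; noncomm_ring
    rw [this, Matrix.add_apply, UZ_LB_apply (k := k) (mem_Pb.1 (mul_mem hg hvP))
      (LB_UZ_mul (mem_Pb.1 (inv_mem hg)) hX), add_zero]
    intro hi; omega
  rw [e1]
  set Z := g * (v * r⁻¹) * g⁻¹ with hZ
  have e2 : ∀ i j, ((sk h * g * (v * r⁻¹) * (sk h * g)⁻¹ : GG p n) : MM p n) i j =
      (Z : MM p n) (Equiv.swap h.lo h.hi i) (Equiv.swap h.lo h.hi j) := by
    intro i j
    have : sk h * g * (v * r⁻¹) * (sk h * g)⁻¹ = sk h * Z * sk h := by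
      have : (sk h : GG p n)⁻¹ = sk h := sw_inv _ _
      rw [hZ, mul_inv_rev, this]; group
    rw [this, sk, mul_sw, sw_mul]
  have hlv := h.lo_val
  have hhv := h.hi_val
  rw [Fin.lt_def] at hij
  have hlt : Equiv.swap h.lo h.hi i < Equiv.swap h.lo h.hi j := by
    rw [Equiv.swap_apply_def, Equiv.swap_apply_def]
    simp only [Fin.ext_iff]
    rw [Fin.lt_def]
    split_ifs <;> omega
  have := hh _ _ hlt
  rw [e2] at this
  simpa using this

variable {𝔽 : Type*} [Field 𝔽] {T : Subgroup (GG p n)} {ψ : T →* 𝔽ˣ}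

/-- extension context -/
structure IsExt (T : Subgroup (GG p n)) (ψ : T →* 𝔽ˣ) {B : Type*} [AddCommGroup B] [Module 𝔽 B]
    (ρ : Representation 𝔽 (GG p n) B) (A : Submodule 𝔽 B) (φ : B →ₗ[𝔽] (GG p n → 𝔽)) : Prop where
  stab : ∀ g, ∀ x ∈ A, ρ g x ∈ A
  mem : ∀ x, φ x ∈ PS T ψ
  surj : ∀ f ∈ PS T ψ, ∃ x, φ x = f
  ker : ∀ x, φ x = 0 ↔ x ∈ A
  equi : ∀ g x, φ (ρ g x) = act g (φ x)

/-- span of `vx - x` -/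
def IV {B : Type*} [AddCommGroup B] [Module 𝔽 B] (ρ : Representation 𝔽 (GG p n) B) (k : ℕ) (A : Submodule 𝔽 B) :
    Submodule 𝔽 B := Submodule.span 𝔽 {y | ∃ v ∈ V p n k, ∃ x ∈ A, y = ρ v x - x}

lemma lemma1 [CharP 𝔽 p] (hT : IsT T) (k : ℕ) {f : GG p n → 𝔽} (hf : f ∈ PS T ψ) (h0 : ∀ x ∈ Pb p n k, f x = 0) :
    f ∈ Submodule.span 𝔽 {y | ∃ v ∈ V p n k, ∃ g ∈ PS T ψ, y = act v g - g} := by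
  set S := Submodule.span 𝔽 {y | ∃ v ∈ V p n k, ∃ g ∈ PS T ψ, y = act v g - g} with hS
  obtain ⟨m, hm, hinv⟩ := PS_smooth hT hf
  have hz : LB k (0 : MM p n) := LB_zero
  have hRQ : Rw hz (m+1) ≤ Rw hz m := Rw_ind hz _ (Rw_w _ _) fun v hv hv' => Rw_V hz hv (Kc_anti (Nat.le_succ _) hv')
  have := Klemma (ψ := ψ) hT (Rw hz m) (Rw hz (m+1))
    (Rw_le_Kc hz (MB_zero (ep_pos _).le) hm) hRQ
    (fun q hq r hr => by
      rw [V_comm (Rw_le_V hz _ hq) (Rw_le_V hz _ hr), mul_inv_cancel_right]; exact hr)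
    S.mkQ (fun h hh hR q hq => by
      rw [← sub_eq_zero, ← map_sub, Submodule.mkQ_apply, Submodule.Quotient.mk_eq_zero]
      exact Submodule.subset_span ⟨q, Rw_le_V hz _ hq, h, hh, rfl⟩) hf
    (fun q hq x => hinv q (Rw_le_Kc hz (MB_zero (ep_pos _).le) le_rfl hq) x)
    (fun x hx => by
      by_contra hc
      apply hx
      apply h0
      refine Vpart1 (m := m) fun q hq hqm s => ?_
      by_contra hc'
      push Not at hc'
      exact hc ⟨q, Rw_V hz hq hqm, s, hc'⟩)
  rwa [Submodule.mkQ_apply, Submodule.Quotient.mk_eq_zero] at this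

variable {B : Type*} [AddCommGroup B] [Module 𝔽 B] {ρ : Representation 𝔽 (GG p n) B} {A : Submodule 𝔽 B}
  {φ : B →ₗ[𝔽] (GG p n → 𝔽)} {U : Type*} [AddCommGroup U] [Module 𝔽 U]

lemma IsExt.fix (E : IsExt T ψ ρ A φ) {g : GG p n} {x : B} : ρ g x - x ∈ A ↔ ∀ y, φ x (y * g) = φ x y := by
  rw [← E.ker, map_sub, E.equi, sub_eq_zero, funext_iff]; rfl

lemma IsExt.sub (E : IsExt T ψ ρ A φ) {x y : B} : x - y ∈ A ↔ φ x = φ y := by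
  rw [← E.ker, map_sub, sub_eq_zero]

lemma IsExt.section_ (E : IsExt T ψ ρ A φ) : ∃ σ : (GG p n → 𝔽) →ₗ[𝔽] B, ∀ f ∈ PS T ψ, φ (σ f) = f := by
  obtain ⟨σ, hσ⟩ := (φ.codRestrict (PS T ψ) E.mem).exists_rightInverse_of_surjective (by
    rw [LinearMap.range_eq_top]
    rintro ⟨f, hf⟩
    obtain ⟨x, hx⟩ := E.surj f hf
    exact ⟨x, Subtype.ext hx⟩)
  obtain ⟨τ, hτ⟩ := σ.exists_extend
  refine ⟨τ, fun f hf => ?_⟩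
  have h1 : τ f = σ ⟨f, hf⟩ := by rw [← hτ]; rfl
  rw [h1]
  exact congrArg Subtype.val (LinearMap.congr_fun hσ ⟨f, hf⟩)

/-- invariance of `D` on `A` under a subgroup -/
def DInv (ρ : Representation 𝔽 (GG p n) B) (A : Submodule 𝔽 B) (D : B →ₗ[𝔽] U) (H : Subgroup (GG p n)) : Prop :=
  ∀ v ∈ H, ∀ a ∈ A, D (ρ v a) = D a

lemma D_pow (E : IsExt T ψ ρ A φ) {D : B →ₗ[𝔽] U} {H : Subgroup (GG p n)} (hD : DInv ρ A D H) {u : GG p n}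
    (hu : u ∈ H) {x : B} (hx : ρ u x - x ∈ A) (j : ℕ) : ρ (u^j) x - x ∈ A ∧ D (ρ (u ^ j) x - x) = (j : 𝔽) • D (ρ u x - x) := by
  induction j with
  | zero => simp
  | succ j ih =>
    have e : ρ (u ^ (j+1)) x - x = ρ (u ^ j) (ρ u x - x) + (ρ (u^j) x - x) := by
      rw [pow_succ, map_mul, Module.End.mul_apply, map_sub]; abel
    rw [e]
    refine ⟨add_mem (E.stab _ _ hx) ih.1, ?_⟩
    rw [map_add, ih.2, hD _ (pow_mem hu j) _ hx, Nat.cast_succ, add_smul, one_smul, add_comm]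

lemma D_root [CharP 𝔽 p] (E : IsExt T ψ ρ A φ) {D : B →ₗ[𝔽] U} {H : Subgroup (GG p n)} (hD : DInv ρ A D H) {u : GG p n}
    (hu : u ∈ H) {x : B} (hx : ρ u x - x ∈ A) : D (ρ (u ^ p) x - x) = 0 := by
  rw [(D_pow E hD hu hx p).2, CharP.cast_eq_zero, zero_smul]

lemma D_mul (E : IsExt T ψ ρ A φ) {D : B →ₗ[𝔽] U} {H : Subgroup (GG p n)} (hD : DInv ρ A D H) {u w : GG p n}
    (hw : w ∈ H) {x : B} (hx : ρ u x - x ∈ A) : D (ρ (w * u) x - x) = D (ρ w x - x) + D (ρ u x - x) := by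
  have e : ρ (w * u) x - x = ρ w (ρ u x - x) + (ρ w x - x) := by
    rw [map_mul, Module.End.mul_apply, map_sub]; abel
  rw [e, map_add, hD _ hw _ hx, add_comm]

lemma kill_core [CharP 𝔽 p] (hT : IsT T) (E : IsExt T ψ ρ A φ) {k m : ℕ} (hm : 1 ≤ m) {W : MM p n}
    (hW : LB k W) (hW1 : MB (ep p 1) W) {D : B →ₗ[𝔽] U} (hD : DInv ρ A D (V p n k))
    {Γ : Subgroup (GG p n)} (hΓP : Γ ≤ Pb p n k) (hΓK : Γ ≤ Kc p n (m+2)) (hDΓ : DInv ρ A D Γ)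
    {x : B} (hinv : Inv m (φ x)) (hwx : ρ (mkV k W hW) x - x ∈ A)
    (good : ∀ y, φ x y ≠ 0 → ∃ q ∈ Rw hW m ⊔ Γ, ¬ Bad (Rw hW (m+1)) y q) :
    D (ρ (mkV k W hW) x - x) = 0 := by
  classical
  obtain ⟨σ, hσ⟩ := E.section_
  set w := mkV k W hW with hw
  set R := Rw hW (m+1) with hR
  set Q := Rw hW m ⊔ Γ with hQ
  have hwV : w ∈ V p n k := mkV_mem _
  have hw1 : w ∈ Kc p n 1 := (mkV_mem_Kc hW).2 hW1
  have hw0 : w ∈ Kc p n 0 := Kc_anti (Nat.zero_le _) hw1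
  have hwR : w ∈ R := Rw_w hW _
  have hRV : R ≤ V p n k := Rw_le_V hW _
  have hRm : R ≤ Rw hW m := Rw_ind hW _ (Rw_w _ _) fun v hv hv' => Rw_V hW hv (Kc_anti (Nat.le_succ _) hv')
  set Λ : (GG p n → 𝔽) →ₗ[𝔽] U := D ∘ₗ (ρ w - LinearMap.id) ∘ₗ σ with hΛ
  have hΛa : ∀ h, Λ h = D (ρ w (σ h) - σ h) := fun h => rfl
  -- comparing lifts
  have hcomp : ∀ h ∈ PS T ψ, ∀ x, φ x = h → Λ h = D (ρ w x - x) := by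
    intro h hh x hx
    have ha : σ h - x ∈ A := E.sub.2 (by rw [hσ h hh, hx])
    have := hD w hwV _ ha
    rw [map_sub, map_sub, map_sub] at this
    rw [hΛa, map_sub, map_sub]
    rwa [sub_eq_sub_iff_sub_eq_sub]
  have hcommγ : ∀ γ ∈ Γ, γ⁻¹ * w * γ * w⁻¹ ∈ V p n k ∧ γ⁻¹ * w * γ * w⁻¹ ∈ Kc p n (m+2) := by
    intro γ hγ
    refine ⟨mul_mem (V_conj' (hΓP hγ) hwV) (inv_mem hwV), ?_⟩
    have : γ⁻¹ * w * γ * w⁻¹ = γ⁻¹ * (w * γ * w⁻¹) := by group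
    rw [this]
    exact mul_mem (inv_mem (hΓK hγ)) (Kc_conj hw0 (hΓK hγ))
  -- normalizer
  have hconj : ∀ γ ∈ Γ, ∀ r ∈ R, γ⁻¹ * r * γ ∈ R := by
    intro γ hγ
    have : R ≤ R.comap (MulAut.conj γ⁻¹).toMonoidHom := by
      refine Rw_ind hW _ ?_ fun v hv hv' => ?_
      · change γ⁻¹ * w * γ⁻¹⁻¹ ∈ R
        obtain ⟨h1, h2⟩ := hcommγ γ hγ
        have e : γ⁻¹ * w * γ⁻¹⁻¹ = (γ⁻¹ * w * γ * w⁻¹) * w := by group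
        rw [e]
        exact mul_mem (Rw_V hW h1 (Kc_anti (by omega) h2)) hwR
      · change γ⁻¹ * v * γ⁻¹⁻¹ ∈ R
        rw [inv_inv]
        exact Rw_V hW (V_conj' (hΓP hγ) hv) (Kc_conj' (Kc_anti (Nat.zero_le _) (hΓK hγ)) hv')
    intro r hr
    have := this hr
    change γ⁻¹ * r * γ⁻¹⁻¹ ∈ R at this
    rwa [inv_inv] at this
  have hconj' : ∀ γ ∈ Γ, ∀ r ∈ R, γ * r * γ⁻¹ ∈ R := by
    intro γ hγ r hr
    have := hconj _ (inv_mem hγ) r hr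
    rwa [inv_inv] at this
  have hactR : ∀ q, (∀ r ∈ R, q⁻¹ * r * q ∈ R) → ∀ h : GG p n → 𝔽, (∀ r ∈ R, ∀ x, h (x * r) = h x) →
      ∀ r ∈ R, ∀ x, act q h (x * r) = act q h x := by
    intro q hq h hh r hr x
    have := hh _ (hq r hr) (x * q)
    rw [act_apply, act_apply, ← this]; congr 1; group
  let S : Subgroup (GG p n) :=
    { carrier := {q | (∀ r ∈ R, q * r * q⁻¹ ∈ R) ∧ (∀ r ∈ R, q⁻¹ * r * q ∈ R) ∧
        ∀ h ∈ PS T ψ, (∀ r ∈ R, ∀ x, h (x * r) = h x) → Λ (act q h) = Λ h}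
      one_mem' := ⟨by simp, by simp, by simp [act_one]⟩
      mul_mem' := by
        rintro a b ⟨a1, a2, a3⟩ ⟨b1, b2, b3⟩
        refine ⟨fun r hr => ?_, fun r hr => ?_, fun h hh hR => ?_⟩
        · have := a1 _ (b1 r hr)
          convert this using 1; group
        · have := b2 _ (a2 r hr)
          convert this using 1; group
        · rw [act_mul, a3 _ (PS_act hh b) (hactR b b2 h hR), b3 h hh hR]
      inv_mem' := by
        rintro a ⟨a1, a2, a3⟩
        refine ⟨by simpa using a2, by simpa using a1, fun h hh hR => ?_⟩
        rw [← a3 _ (PS_act hh a⁻¹) (hactR a⁻¹ (by simpa using a1) h hR), ← act_mul, mul_inv_cancel, act_one] }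
  have hfixA : ∀ h ∈ PS T ψ, (∀ r ∈ R, ∀ x, h (x * r) = h x) → ∀ r ∈ R, ρ r (σ h) - σ h ∈ A := by
    intro h hh hhR r hr
    rw [E.fix, hσ h hh]; exact hhR r hr
  have hQS : Q ≤ S := by
    refine sup_le (fun v hv => ?_) (fun γ hγ => ?_)
    · have hvV := Rw_le_V hW _ hv
      refine ⟨fun r hr => ?_, fun r hr => ?_, fun h hh hhR => ?_⟩
      · rw [V_comm hvV (hRV hr), mul_inv_cancel_right]; exact hr
      · rw [mul_assoc, V_comm (hRV hr) hvV, inv_mul_cancel_left]; exact hr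
      · rw [hcomp _ (PS_act hh v) (ρ v (σ h)) (by rw [E.equi, hσ h hh]), hΛa]
        have : ρ w (ρ v (σ h)) - ρ v (σ h) = ρ v (ρ w (σ h) - σ h) := by
          rw [map_sub, ← Module.End.mul_apply, ← Module.End.mul_apply, ← map_mul, ← map_mul, V_comm hwV hvV]
        rw [this, hD v hvV _ (hfixA h hh hhR w hwR)]
    · refine ⟨hconj' γ hγ, hconj γ hγ, fun h hh hhR => ?_⟩
      rw [hcomp _ (PS_act hh γ) (ρ γ (σ h)) (by rw [E.equi, hσ h hh]), hΛa]
      obtain ⟨h1, h2⟩ := hcommγ γ hγ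
      set u := γ⁻¹ * w * γ * w⁻¹ with hu
      have e1 : γ⁻¹ * w * γ = u * w := by rw [hu]; group
      have e2 : ρ w (ρ γ (σ h)) - ρ γ (σ h) = ρ γ (ρ (u * w) (σ h) - σ h) := by
        rw [map_sub, ← Module.End.mul_apply, ← Module.End.mul_apply, ← map_mul, ← map_mul, ← e1]
        congr 3; group
      have huR : u ∈ R := Rw_V hW h1 (Kc_anti (by omega) h2)
      rw [e2, hDΓ γ hγ _ (hfixA h hh hhR _ (mul_mem huR hwR)),
        D_mul E hD h1 (hfixA h hh hhR w hwR)]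
      obtain ⟨u1, hu1, hu1K, hu1p⟩ := V_root h1 h2
      rw [← hu1p, D_root E hD hu1 (hfixA h hh hhR u1 (Rw_V hW hu1 hu1K)), zero_add]
  have hfQ : ∀ q ∈ Q, ∀ y, φ x (y * q) = φ x y := by
    let S' : Subgroup (GG p n) :=
      { carrier := {q | ∀ y, φ x (y * q) = φ x y}
        one_mem' := by simp
        mul_mem' := by
          intro a b ha hb y
          rw [← mul_assoc, hb, ha]
        inv_mem' := by
          intro a ha y
          rw [← ha (y * a⁻¹), inv_mul_cancel_right] }
    have : Q ≤ S' := by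
      refine sup_le (Rw_ind hW _ (E.fix.1 hwx) fun v hv hv' => hinv v hv') fun γ hγ => hinv γ (Kc_anti (by omega) (hΓK hγ))
    exact fun q hq => this hq
  have := Klemma (ψ := ψ) hT Q R (sup_le (Rw_le_Kc hW hW1 hm) (hΓK.trans (Kc_anti (by omega))))
    (hRm.trans le_sup_left) (fun q hq => (hQS hq).1) Λ (fun h hh hhR q hq => (hQS hq).2.2 h hh hhR) (E.mem x) hfQ
    (fun y hy => by
      obtain ⟨q, hq, hb⟩ := good y hy
      refine ⟨q, hq, ?_⟩
      rw [Bad] at hb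
      push Not at hb
      exact hb)
  rwa [hcomp _ (E.mem x) x rfl] at this

lemma kill1 [CharP 𝔽 p] (hT : IsT T) (E : IsExt T ψ ρ A φ) {k : ℕ} (h : Gd k n) {w : GG p n}
    (hw : w ∈ V p n k) (hw1 : w ∈ Kc p n 1) {D : B →ₗ[𝔽] U} (hD : DInv ρ A D (V p n k))
    {x : B} (hwx : ρ w x - x ∈ A)
    (h0 : ∀ g ∈ Pb p n k, φ x g = 0) (h1 : ∀ g ∈ Pb p n k, φ x (sk h * g) = 0) :
    D (ρ w x - x) = 0 := by
  obtain ⟨W, hW, rfl⟩ := hw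
  rw [mkV_mem_Kc] at hw1
  obtain ⟨m, hm, hinv⟩ := PS_smooth hT (E.mem x)
  refine kill_core hT E hm hW hw1 hD (Γ := ⊥) bot_le bot_le ?_ hinv hwx ?_
  · intro v hv a _; rw [Subgroup.mem_bot.1 hv]; simp
  · intro y hy
    by_contra hc; push Not at hc
    rcases Vpart (m := m) h hW (hw1.mono (ep_le_one 1)) (x := y) (fun q hq hqm => hc q (le_sup_left (a := Rw hW m) (Rw_V hW hq hqm))) with hP | ⟨b, hb, g, hg, rfl⟩
    · exact hy (h0 y hP)
    · apply hy
      rw [mul_assoc, PS_ne hT hb (E.mem x)]; exact h1 g hg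

lemma kill2 [CharP 𝔽 p] (hT : IsT T) (E : IsExt T ψ ρ A φ) {k : ℕ} (h : Gd k n) {w : GG p n}
    (hw : w ∈ V p n k) (hw1 : w ∈ Kc p n 1) {D : B →ₗ[𝔽] U} (hD : DInv ρ A D (Nb p n))
    {x : B} (hwx : ρ w x - x ∈ A)
    (h0 : ∀ g ∈ Pb p n k, φ x g = 0) (h1 : ∀ b, φ x (sk h * u0 h b) = 0) :
    D (ρ w x - x) = 0 := by
  obtain ⟨W, hW, rfl⟩ := hw
  rw [mkV_mem_Kc] at hw1
  obtain ⟨m, hm, hinv⟩ := PS_smooth hT (E.mem x)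
  refine kill_core hT E hm hW hw1 (fun v hv => hD v (V_le_Nb hv)) (Γ := Nb p n ⊓ Kc p n (m+2))
    (inf_le_left.trans (Nb_le.trans (Bb_le k))) inf_le_right (fun v hv => hD v hv.1) hinv hwx ?_
  · intro y hy
    by_contra hc; push Not at hc
    rcases Vpart (m := m) h hW (hw1.mono (ep_le_one 1)) (x := y) (fun q hq hqm => hc q (le_sup_left (a := Rw hW m) (Rw_V hW hq hqm))) with hP | ⟨b, hb, g, hg, rfl⟩
    · exact hy (h0 y hP)
    · apply hy
      have hgB : g ∈ Bb p n := Nbad (m := m) (t := m+2) h hW (hw1.mono (ep_le_one 1)) hg fun q hq hqm => by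
        have := hc q (le_sup_right (a := Rw hW m) ⟨hq, hqm⟩)
        rw [mul_assoc] at this
        exact this.B hb
      obtain ⟨b', hb', c, e⟩ := sk_B h hgB
      rw [mul_assoc, PS_ne hT hb (E.mem x), e, mul_assoc, PS_ne hT hb' (E.mem x)]; exact h1 c

end F
end HX

namespace HX
set_option linter.unusedSectionVars false
set_option linter.unusedSimpArgs false
set_option linter.unusedVariables false
section G
variable {p n : ℕ} [hp : Fact p.Prime]

noncomputable def pu (p : ℕ) [Fact p.Prime] : ℚ_[p]ˣ := Units.mk0 (p : ℚ_[p]) p_ne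

noncomputable def zz (p n : ℕ) [Fact p.Prime] (k N : ℕ) : GG p n := dgl fun i => if i.val < k then 1 else (pu p) ^ N

lemma zz_add (k N M : ℕ) : zz p n k (N + M) = zz p n k N * zz p n k M := by
  ext1
  rw [Units.val_mul]
  simp only [zz, dgl_val, Matrix.diagonal_mul_diagonal]
  congr 1; ext i
  split_ifs <;> simp [pow_add]

lemma zz_B (k N : ℕ) : zz p n k N ∈ Bb p n := dgl_mem_Bb _
lemma zz_P (k l N : ℕ) : zz p n k N ∈ Pb p n l := Bb_le _ (zz_B k N)

lemma zz_mul_apply (k N : ℕ) (X : MM p n) (i j : Fin n) :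
    ((zz p n k N : GG p n) * X : MM p n) i j = (if i.val < k then 1 else (p:ℚ_[p])^N) * X i j := by
  simp only [zz, dgl_val, Matrix.diagonal_mul]
  split_ifs <;> simp [pu]
lemma mul_zz_apply (k N : ℕ) (X : MM p n) (i j : Fin n) :
    (X * (zz p n k N : GG p n) : MM p n) i j = X i j * (if j.val < k then 1 else (p:ℚ_[p])^N) := by
  simp only [zz, dgl_val, Matrix.mul_diagonal]
  split_ifs <;> simp [pu]

lemma zz_conj {k : ℕ} (N : ℕ) {X : MM p n} (hX : LB k X) :
    zz p n k N * mkV k X hX * (zz p n k N)⁻¹ = mkV k ((p:ℚ_[p])^N • X) (hX.smul _) := by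
  rw [mul_inv_eq_iff_eq_mul]
  ext1
  rw [Units.val_mul, Units.val_mul, mkV_val, mkV_val, mul_add, add_mul, mul_one, one_mul]
  congr 1
  ext i j
  rw [zz_mul_apply, mul_zz_apply, Matrix.smul_apply, smul_eq_mul]
  by_cases hij : k ≤ i.val → k ≤ j.val
  · rw [hX i j hij]; simp
  · push Not at hij
    rw [if_neg (by omega), if_pos hij.2, mul_one]

lemma zz_conj_Kc {k s : ℕ} (N : ℕ) {v : GG p n} (hv : v ∈ V p n k) (hs : v ∈ Kc p n s) :
    zz p n k N * v * (zz p n k N)⁻¹ ∈ Kc p n (s + N) := by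
  obtain ⟨X, hX, rfl⟩ := hv
  rw [mkV_mem_Kc] at hs
  rw [zz_conj, mkV_mem_Kc]
  exact (hs.smul _).mono (by rw [norm_p_pow, ep_add, mul_comm])

lemma zz_shrink {k : ℕ} {v : GG p n} (hv : v ∈ V p n k) (s : ℕ) : ∃ N, zz p n k N * v * (zz p n k N)⁻¹ ∈ Kc p n s := by
  obtain ⟨X, hX, rfl⟩ := hv
  obtain ⟨c, hc, hcc⟩ := MB_exists X
  obtain ⟨N, _, hN⟩ := ep_small (p := p) (ε := ep p s / c) (by have := ep_pos (p:=p) s; positivity)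
  refine ⟨N, ?_⟩
  rw [zz_conj, mkV_mem_Kc]
  refine (hcc.smul _).mono ?_
  rw [norm_p_pow]
  rwa [le_div_iff₀ hc] at hN

/-- upper block -/
def UB (k : ℕ) (Y : MM p n) : Prop := ∀ i j : Fin n, ¬ (i.val < k ∧ k ≤ j.val) → Y i j = 0

lemma UB.mul_zero {k : ℕ} {X Y : MM p n} (h : UB k X) (h' : UB k Y) : X * Y = 0 := by
  ext i j
  rw [Matrix.mul_apply]
  refine Finset.sum_eq_zero fun l _ => ?_
  by_cases hl : l.val < k
  · rw [h i l (by omega), zero_mul]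
  · rw [h' l j (by omega), MulZeroClass.mul_zero]

/-- the big set `P̄ V⁺(ℤ_p)` -/
def Om (p n : ℕ) [Fact p.Prime] (k : ℕ) : Set (GG p n) :=
  {g | ∃ q ∈ Pb p n k, ∃ Y : MM p n, UB k Y ∧ MB 1 Y ∧ (g : MM p n) = (q : MM p n) * (1 + Y)}

lemma Pb_Om {k : ℕ} {q g : GG p n} (hq : q ∈ Pb p n k) (hg : g ∈ Om p n k) : q * g ∈ Om p n k := by
  obtain ⟨q', hq', Y, hY, hY1, e⟩ := hg
  exact ⟨q * q', mul_mem hq hq', Y, hY, hY1, by rw [Units.val_mul, Units.val_mul, e, mul_assoc]⟩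

lemma Om_Pb {k : ℕ} {q : GG p n} (hq : q ∈ Pb p n k) : q ∈ Om p n k :=
  ⟨q, hq, 0, fun _ _ _ => rfl, MB_zero zero_le_one, by simp⟩

lemma Om_V {k : ℕ} {g v : GG p n} (hg : g ∈ Om p n k) (hv : v ∈ V p n k) (hv1 : v ∈ Kc p n 1) :
    g * v ∈ Om p n k := by
  obtain ⟨q, hq, Y, hY, hY1, e⟩ := hg
  obtain ⟨X, hX, rfl⟩ := hv
  rw [mkV_mem_Kc] at hv1
  obtain ⟨c, hc, hce⟩ := exists_Kc le_rfl (MB.mul_left (ep_pos 1).le hY1 hv1)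
  have hc0 := (mem_K0.1 (Kc_anti (Nat.zero_le _) hc)).2
  set C : MM p n := ((c⁻¹ : GG p n) : MM p n) with hC
  set Y' : MM p n := C * Y with hY'
  have h1 : Y' + Y * X * Y' = Y := by
    have : (1 + Y * X) * Y' = Y := by rw [← hce, hY', ← mul_assoc, gmul_inv, one_mul]
    rwa [add_mul, one_mul] at this
  have hUB : UB k Y' := by
    intro i j hij
    by_cases hj : k ≤ j.val
    · have := congrFun (congrFun h1 i) j
      rw [Matrix.add_apply, hY i j hij, mul_assoc, Matrix.mul_apply, Finset.sum_eq_zero, add_zero] at this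
      · exact this
      · intro l _; rw [hY i l (by omega), zero_mul]
    · rw [hY', Matrix.mul_apply]
      refine Finset.sum_eq_zero fun l _ => ?_
      rw [hY l j (by omega), mul_zero]
  have hMB : MB 1 Y' := MB.mul_left zero_le_one hc0 hY1
  have hsq : Y' * Y' = 0 := hUB.mul_zero hUB
  have hYY' : Y * Y' = 0 := hY.mul_zero hUB
  let uY : GG p n := ⟨1 + Y', 1 - Y', by noncomm_ring; simp [hsq], by noncomm_ring; simp [hsq]⟩
  refine ⟨g * mkV k X hX * uY⁻¹, ?_, Y', hUB, hMB, ?_⟩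
  · have e1 : ((q⁻¹ * (g * mkV k X hX * uY⁻¹) : GG p n) : MM p n) = 1 + X + Y * X - X * Y' := by
      have : ((uY⁻¹ : GG p n) : MM p n) = 1 - Y' := rfl
      rw [Units.val_mul, Units.val_mul, Units.val_mul, e, this, mkV_val, ← mul_assoc, ← mul_assoc, ← mul_assoc, ginv_mul, one_mul]
      have h2 : Y = Y' + Y * X * Y' := h1.symm
      calc (1 + Y) * (1 + X) * (1 - Y') = 1 + X + Y * X - X * Y' + (Y - (Y' + Y * X * Y')) - Y * Y' := by noncomm_ring
        _ = _ := by rw [h1, hYY']; simp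
    have e2 : q⁻¹ * (g * mkV k X hX * uY⁻¹) ∈ Pb p n k := by
      rw [mem_Pb, e1]
      intro i j hi hj
      rw [Matrix.sub_apply, Matrix.add_apply, Matrix.add_apply, Matrix.one_apply_ne (Fin.ne_of_lt (by rw [Fin.lt_def]; omega)),
        hX i j (by omega), Matrix.mul_apply, Matrix.mul_apply, Finset.sum_eq_zero, Finset.sum_eq_zero]
      · simp
      · intro l _; rw [hX i l (by omega), zero_mul]
      · intro l _; rw [hX l j (by omega), mul_zero]
    have := mul_mem hq e2
    rwa [mul_inv_cancel_left] at this
  · have : ((uY : GG p n) : MM p n) = 1 + Y' := rfl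
    rw [← this, ← Units.val_mul, inv_mul_cancel_right]

lemma Om_zz {k N r : ℕ} (hr : 1 ≤ r) (hN : r ≤ N) {g : GG p n} (hg : g ∈ Om p n k) :
    ∃ q ∈ Pb p n k, ∃ κ ∈ Kc p n r, g * zz p n k N = q * κ := by
  obtain ⟨q, hq, Y, hY, hY1, e⟩ := hg
  have hb : MB (ep p r) ((p:ℚ_[p])^N • Y) := (hY1.smul _).mono (by rw [norm_p_pow, mul_one]; exact ep_anti hN)
  obtain ⟨κ, hκ, hκe⟩ := exists_Kc hr hb
  refine ⟨q * zz p n k N, mul_mem hq (zz_P _ _ _), κ, hκ, ?_⟩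
  ext1
  rw [Units.val_mul, Units.val_mul, Units.val_mul, e, hκe, mul_assoc, mul_assoc]
  congr 1
  ext i j
  rw [mul_zz_apply, zz_mul_apply, Matrix.add_apply, Matrix.add_apply, Matrix.smul_apply, smul_eq_mul]
  by_cases hij : i.val < k ∧ k ≤ j.val
  · rw [Matrix.one_apply_ne (Fin.ne_of_lt (by rw [Fin.lt_def]; omega)), if_pos hij.1, if_neg (by omega)]; ring
  · rw [hY i j hij]
    by_cases e : i = j
    · subst e; rw [Matrix.one_apply_eq]; ring
    · rw [Matrix.one_apply_ne e]; ring

variable {𝔽 : Type*} [Field 𝔽] {T : Subgroup (GG p n)} {ψ : T →* 𝔽ˣ}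
variable {B : Type*} [AddCommGroup B] [Module 𝔽 B] {ρ : Representation 𝔽 (GG p n) B} {A : Submodule 𝔽 B}
  {φ : B →ₗ[𝔽] (GG p n → 𝔽)}

lemma rho_mul (g h : GG p n) (x : B) : ρ (g * h) x = ρ g (ρ h x) := by rw [map_mul, Module.End.mul_apply]

lemma IV_mem {k : ℕ} {v : GG p n} (hv : v ∈ V p n k) {a : B} (ha : a ∈ A) : ρ v a - a ∈ IV ρ k A :=
  Submodule.subset_span ⟨v, hv, a, ha, rfl⟩

lemma IV_le {k : ℕ} (hA : ∀ g, ∀ x ∈ A, ρ g x ∈ A) : IV ρ k A ≤ A := by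
  rw [IV, Submodule.span_le]
  rintro _ ⟨v, hv, a, ha, rfl⟩
  exact sub_mem (hA _ _ ha) ha

lemma IV_conj {g v : GG p n} (x : B) : ρ g (ρ v x - x) = ρ (g * v * g⁻¹) (ρ g x) - ρ g x := by
  rw [map_sub, ← rho_mul, ← rho_mul]; congr 3; group

lemma IV_stab {k : ℕ} (hA : ∀ g, ∀ x ∈ A, ρ g x ∈ A) {g : GG p n} (hg : g ∈ Pb p n k) {y : B} (hy : y ∈ IV ρ k A) :
    ρ g y ∈ IV ρ k A := by
  have : IV ρ k A ≤ (IV ρ k A).comap (ρ g) := by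
    conv_lhs => rw [IV]
    rw [Submodule.span_le]
    rintro _ ⟨v, hv, a, ha, rfl⟩
    change ρ g (ρ v a - a) ∈ IV ρ k A
    rw [IV_conj]
    exact IV_mem (V_conj hg hv) (hA _ _ ha)
  exact this hy

lemma IV_D {k : ℕ} {U : Type*} [AddCommGroup U] [Module 𝔽 U] {D : B →ₗ[𝔽] U} (hD : DInv ρ A D (V p n k)) {y : B}
    (hy : y ∈ IV ρ k A) : D y = 0 := by
  have : IV ρ k A ≤ LinearMap.ker D := by
    rw [IV, Submodule.span_le]
    rintro _ ⟨v, hv, a, ha, rfl⟩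
    change D _ = 0
    rw [map_sub, hD v hv a ha, sub_self]
  exact this hy

lemma DInv_mkQ (k : ℕ) : DInv ρ A (IV ρ k A).mkQ (V p n k) := by
  intro v hv a ha
  rw [← sub_eq_zero, ← map_sub, Submodule.mkQ_apply, Submodule.Quotient.mk_eq_zero]
  exact IV_mem hv ha

lemma mkQ0 {k : ℕ} {y : B} : (IV ρ k A).mkQ y = 0 ↔ y ∈ IV ρ k A := by
  rw [Submodule.mkQ_apply, Submodule.Quotient.mk_eq_zero]

/-- generators used in step 1 -/
def Mr (ρ : Representation 𝔽 (GG p n) B) (A : Submodule 𝔽 B) (φ : B →ₗ[𝔽] (GG p n → 𝔽)) (k r : ℕ) : Submodule 𝔽 B :=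
  IV ρ k A ⊔ Submodule.span 𝔽 {y | ∃ v ∈ V p n k, v ∈ Kc p n 1 ∧ ∃ x, Inv r (φ x) ∧ (∀ g ∈ Om p n k, φ x g = 0) ∧
    y = ρ v x - x}

lemma step1 [CharP 𝔽 p] (hT : IsT T) (E : IsExt T ψ ρ A φ) {k : ℕ} {y : B} (hy : y ∈ IV ρ k ⊤) :
    ∃ N0, ∀ N ≥ N0, ∃ r0, ∀ r ≥ r0, ρ (zz p n k N) y ∈ Mr ρ A φ k r := by
  rw [IV] at hy
  induction hy using Submodule.span_induction with
  | zero => exact ⟨0, fun N _ => ⟨0, fun r _ => by rw [map_zero]; exact zero_mem _⟩⟩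
  | add x y _ _ hx hy =>
    obtain ⟨N1, h1⟩ := hx
    obtain ⟨N2, h2⟩ := hy
    refine ⟨max N1 N2, fun N hN => ?_⟩
    obtain ⟨r1, h1⟩ := h1 N (le_trans (le_max_left _ _) hN)
    obtain ⟨r2, h2⟩ := h2 N (le_trans (le_max_right _ _) hN)
    refine ⟨max r1 r2, fun r hr => ?_⟩
    rw [map_add]
    exact add_mem (h1 r (le_trans (le_max_left _ _) hr)) (h2 r (le_trans (le_max_right _ _) hr))
  | smul c x _ hx =>
    obtain ⟨N1, h1⟩ := hx
    refine ⟨N1, fun N hN => ?_⟩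
    obtain ⟨r1, h1⟩ := h1 N hN
    refine ⟨r1, fun r hr => ?_⟩
    rw [map_smul]
    exact Submodule.smul_mem _ _ (h1 r hr)
  | mem y hy =>
    obtain ⟨v, hv, x, -, rfl⟩ := hy
    obtain ⟨N1, hN1⟩ := zz_shrink hv 1
    set z1 := zz p n k N1 with hz1
    set v1 := z1 * v * z1⁻¹ with hv1
    set x1 := ρ z1 x with hx1
    have hv1V : v1 ∈ V p n k := V_conj (zz_P _ _ _) hv
    have hf := E.mem x1
    set f := φ x1 with hfdef
    obtain ⟨r1, hr1, hinv⟩ := PS_smooth hT hf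
    set S : Set (GG p n) := {g | ∃ q ∈ Pb p n k, ∃ κ ∈ Kc p n r1, g = q * κ} with hS
    have hcutm : S.indicator f ∈ PS T ψ := PS_cut (s := r1) hT hf
      (by rintro b hb _ ⟨q, hq, κ, hκ, rfl⟩; exact ⟨b * q, mul_mem (Bb_le k hb) hq, κ, hκ, by group⟩)
      (by rintro κ' hκ' _ ⟨q, hq, κ, hκ, rfl⟩; exact ⟨q, hq, κ * κ', mul_mem hκ hκ', by group⟩)
    obtain ⟨x', hx'⟩ := E.surj _ hcutm
    obtain ⟨v', hv'V, hv'0, hv'p⟩ := V_root hv1V hN1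
    have hSv : ∀ u ∈ V p n k, u ∈ Kc p n 0 → ∀ g, g ∈ S → g * u ∈ S ∧ f (g * u) = f g := by
      rintro u hu hu0 _ ⟨q, hq, κ, hκ, rfl⟩
      have e : q * κ * u = (q * u) * (u⁻¹ * κ * u) := by group
      have hk := Kc_conj' hu0 hκ
      refine ⟨⟨q * u, mul_mem hq (V_le_Pb hu), _, hk, e⟩, ?_⟩
      have e2 : q * u = (q * u * q⁻¹) * q := by group
      rw [e, hinv _ hk, hinv _ hκ, e2, hf.2.2 _ (V_le_lowerUnipotent (V_conj hq hu))]
    have hfixv : ρ v' x' - x' ∈ A := by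
      rw [E.fix, hx']
      intro g
      by_cases hg : g ∈ S
      · obtain ⟨h1, h2⟩ := hSv v' hv'V hv'0 g hg
        rw [Set.indicator_of_mem h1, Set.indicator_of_mem hg, h2]
      · have : g * v' ∉ S := fun h => hg (by
          have := (hSv _ (inv_mem hv'V) (inv_mem hv'0) _ h).1
          rwa [mul_inv_cancel_right] at this)
        rw [Set.indicator_of_notMem hg, Set.indicator_of_notMem this]
    have hnear : ρ v1 x' - x' ∈ IV ρ k A := by
      have := D_root E (DInv_mkQ k) hv'V hfixv
      rwa [mkQ0, hv'p] at this
    set x2 := x1 - x' with hx2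
    have hx2f : ∀ g ∈ S, φ x2 g = 0 := by
      intro g hg
      rw [hx2, map_sub, hx', Pi.sub_apply, Set.indicator_of_mem hg, sub_self]
    refine ⟨N1 + r1, fun N hN => ?_⟩
    obtain ⟨N2, rfl⟩ : ∃ N2, N = N2 + N1 := ⟨N - N1, by omega⟩
    set z2 := zz p n k N2 with hz2
    obtain ⟨r0, _, hr0⟩ := PS_smooth hT (E.mem (ρ z2 x2))
    refine ⟨r0, fun r hr => ?_⟩
    have e : ρ (zz p n k (N2 + N1)) (ρ v x - x) = ρ z2 (ρ v1 x' - x') +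
        (ρ (z2 * v1 * z2⁻¹) (ρ z2 x2) - ρ z2 x2) := by
      rw [zz_add, rho_mul, IV_conj, ← IV_conj (g := z2), ← map_add]
      congr 1
      rw [hx2, map_sub]; abel
    rw [e]
    refine add_mem (Submodule.mem_sup_left (IV_stab E.stab (zz_P _ _ _) hnear))
      (Submodule.mem_sup_right (Submodule.subset_span ⟨_, V_conj (zz_P _ _ _) hv1V,
        Kc_anti (by omega) (zz_conj_Kc N2 hv1V hN1), _, hr0.mono hr, fun g hg => ?_, rfl⟩))
    rw [E.equi, act_apply]
    obtain ⟨q, hq, κ, hκ, e⟩ := Om_zz hr1 (by omega : r1 ≤ N2) hg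
    exact hx2f _ ⟨q, hq, κ, hκ, e⟩

end G
end HX

namespace HX
set_option linter.unusedSectionVars false
set_option linter.unusedSimpArgs false
set_option linter.unusedVariables false
section H
variable {p n : ℕ} [hp : Fact p.Prime]

noncomputable def V1 (p n : ℕ) [Fact p.Prime] (k : ℕ) : Subgroup (GG p n) := V p n k ⊓ Kc p n 1
lemma V1_le0 (k : ℕ) : V1 p n k ≤ Kc p n 0 := inf_le_right.trans (Kc_anti (Nat.zero_le _))
noncomputable def HH (p n : ℕ) [Fact p.Prime] (k r : ℕ) : Subgroup (GG p n) := RK (V1 p n k) (V1_le0 k) r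

lemma HH_V {k r : ℕ} {v : GG p n} (hv : v ∈ V1 p n k) : v ∈ HH p n k r := ⟨v, hv, 1, one_mem _, by simp⟩
lemma HH_K {k r : ℕ} : Kc p n r ≤ HH p n k r := fun x hx => ⟨1, one_mem _, x, hx, by simp⟩

lemma coarse {k r : ℕ} {a b : GG p n} (h : dmk (Kc p n r) a = dmk (Kc p n r) b) :
    dmk (HH p n k r) a = dmk (HH p n k r) b := by
  obtain ⟨c, hc, x, hx, e⟩ := (dmk_eq _).1 h
  exact (dmk_eq _).2 ⟨c, hc, x, HH_K hx, e⟩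

lemma dmk_mul {r : ℕ} {a b q : GG p n} (hq : q ∈ Kc p n 0) (h : dmk (Kc p n r) a = dmk (Kc p n r) b) :
    dmk (Kc p n r) (a * q) = dmk (Kc p n r) (b * q) := by
  obtain ⟨c, hc, x, hx, rfl⟩ := (dmk_eq _).1 h
  exact (dmk_eq _).2 ⟨c, hc, _, Kc_conj' hq hx, by group⟩

variable {𝔽 : Type*} [Field 𝔽] {T : Subgroup (GG p n)} {ψ : T →* 𝔽ˣ}

def Sup (r : ℕ) (x0 : GG p n) (e : GG p n → 𝔽) : Prop :=
  Inv r e ∧ ∀ g, e g ≠ 0 → dmk (Kc p n r) g = dmk (Kc p n r) x0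

lemma uniq (hT : IsT T) {r : ℕ} {x0 : GG p n} {e e' : GG p n → 𝔽} (he : e ∈ PS T ψ) (he' : e' ∈ PS T ψ)
    (h : Sup r x0 e) (h' : Sup r x0 e') (h0 : e x0 = e' x0) : e = e' := by
  ext g
  by_cases hg : dmk (Kc p n r) g = dmk (Kc p n r) x0
  · obtain ⟨b, hb, x, hx, rfl⟩ := (dmk_eq _).1 hg.symm
    obtain ⟨c, hc, h2⟩ := PS_B (ψ := ψ) hT hb
    rw [h.1 _ hx, h'.1 _ hx, h2 _ he, h2 _ he', h0]
  · have h1 : e g = 0 := by by_contra hh; exact hg (h.2 g hh)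
    have h2 : e' g = 0 := by by_contra hh; exact hg (h'.2 g hh)
    rw [h1, h2]

lemma Sup.act {r : ℕ} {x0 q : GG p n} {e : GG p n → 𝔽} (h : Sup r x0 e) (hq : q ∈ Kc p n 0) :
    Sup r (x0 * q⁻¹) (act q e) := by
  refine ⟨fun x hx g => ?_, fun g hg => ?_⟩
  · have e1 : g * x * q = (g * q) * (q⁻¹ * x * q) := by group
    rw [act_apply, act_apply, e1, h.1 _ (Kc_conj' hq hx)]
  · have := dmk_mul (inv_mem hq) (h.2 _ hg)
    rwa [mul_inv_cancel_right] at this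

lemma Sup.congr {r : ℕ} {x0 x1 : GG p n} {e : GG p n → 𝔽} (h : Sup r x0 e) (hx : dmk (Kc p n r) x0 = dmk (Kc p n r) x1) :
    Sup r x1 e := ⟨h.1, fun g hg => (h.2 g hg).trans hx⟩

lemma Sup.smul {r : ℕ} {x0 : GG p n} {e : GG p n → 𝔽} (h : Sup r x0 e) (c : 𝔽) : Sup r x0 (c • e) :=
  ⟨fun x hx g => by simp [h.1 x hx g], fun g hg => h.2 g (by rintro h0; simp [h0] at hg)⟩

/-- spike functions -/
def Spike (T : Subgroup (GG p n)) (ψ : T →* 𝔽ˣ) (r : ℕ) (x0 : GG p n) (e : GG p n → 𝔽) : Prop :=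
  e ∈ PS T ψ ∧ Sup r x0 e ∧ e x0 = 1

/-- `act w e = e` when `w ∈ K_1` stabilizes the class -/
lemma Spike.stab [CharP 𝔽 p] (hT : IsT T) {r : ℕ} {x0 w : GG p n} {e : GG p n → 𝔽} (h : Spike T ψ r x0 e)
    (hw : w ∈ Kc p n 1) (hx : dmk (Kc p n r) (x0 * w) = dmk (Kc p n r) x0) : act w e = e := by
  have hw0 : w ∈ Kc p n 0 := Kc_anti (Nat.zero_le _) hw
  have hx' : dmk (Kc p n r) (x0 * w⁻¹) = dmk (Kc p n r) x0 := by
    have := dmk_mul (inv_mem hw0) hx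
    rw [mul_inv_cancel_right] at this
    exact this.symm
  set c := e (x0 * w) with hc
  have h1 : act w e = c • e := by
    refine uniq hT (PS_act h.1 w) (Submodule.smul_mem _ _ h.1) ((h.2.1.act hw0).congr hx') (h.2.1.smul c) ?_
    simp [h.2.2, hc]
  have h2 : ∀ m : ℕ, act (w^m) e = c^m • e := by
    intro m
    induction m with
    | zero => simp
    | succ m ih => rw [pow_succ, act_mul, h1, map_smul, ih, smul_smul, pow_succ, mul_comm]
  have h3 : c ^ (p^r) = 1 := by
    have h4 := congrFun (h2 (p^r)) x0
    have h5 : w ^ (p^r) ∈ Kc p n r := Kc_anti (Nat.le_add_left r 1) (Kc_pow_pp le_rfl hw r)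
    rw [act_apply, h.2.1.1 _ h5] at h4
    simpa [h.2.2] using h4.symm
  have h6 : c = 1 := by
    have : (c - 1)^(p^r) = 0 := by
      have : ExpChar 𝔽 p := ExpChar.prime hp.out
      rw [sub_pow_expChar_pow, h3, one_pow, sub_self]
    exact sub_eq_zero.1 (pow_eq_zero_iff (by have := hp.out.pos; positivity) |>.1 this)
  rw [h1, h6, one_smul]

variable {B : Type*} [AddCommGroup B] [Module 𝔽 B] {ρ : Representation 𝔽 (GG p n) B} {A : Submodule 𝔽 B}
  {φ : B →ₗ[𝔽] (GG p n → 𝔽)}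

lemma HH_rep {k r : ℕ} {x y : GG p n} (h : dmk (HH p n k r) x = dmk (HH p n k r) y) :
    ∃ v ∈ V1 p n k, dmk (Kc p n r) x = dmk (Kc p n r) (y * v⁻¹) := by
  obtain ⟨c, hc, _, ⟨v, hv, x', hx', rfl⟩, rfl⟩ := (dmk_eq _).1 h
  refine ⟨v, hv, (dmk_eq _).2 ⟨c, hc, v * x' * v⁻¹, Kc_conj (V1_le0 _ hv) hx', by group⟩⟩

lemma stage2 [CharP 𝔽 p] (hT : IsT T) (E : IsExt T ψ ρ A φ) {k r : ℕ} (bp : DQ (HH p n k r) → GG p n)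
    (hbp : ∀ O, dmk (HH p n k r) (bp O) = O) (CL : Set (DQ (HH p n k r))) (et : DQ (HH p n k r) → B)
    (het : ∀ O ∈ CL, Spike T ψ r (bp O) (φ (et O)))
    (hCL : ∀ x, Inv r (φ x) → (∀ g ∈ Om p n k, φ x g = 0) → ∀ g, φ x g ≠ 0 → dmk (HH p n k r) g ∈ CL)
    {y : B} (hyA : y ∈ A) (hy : y ∈ Mr ρ A φ k r) :
    y ∈ IV ρ k A ⊔ Submodule.span 𝔽 {z | ∃ O ∈ CL, ∃ w ∈ V1 p n k, ρ w (et O) - et O ∈ A ∧ z = ρ w (et O) - et O} := by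
  classical
  set N := IV ρ k A ⊔ Submodule.span 𝔽 {z | ∃ O ∈ CL, ∃ w ∈ V1 p n k, ρ w (et O) - et O ∈ A ∧ z = ρ w (et O) - et O} with hN
  have hNA : N ≤ A := by
    refine sup_le (IV_le E.stab) ?_
    rw [Submodule.span_le]
    rintro _ ⟨O, _, w, _, h, rfl⟩
    exact h
  have hJN : IV ρ k A ≤ N := le_sup_left
  have hfin : Finite (DQ (Kc p n r)) := DC_finite _ le_rfl
  have : Fintype (DQ (Kc p n r)) := Fintype.ofFinite _
  have hch : ∀ γ : DQ (Kc p n r), ∃ O, ∃ v ∈ V1 p n k, γ = dmk (Kc p n r) (bp O * v⁻¹) ∧ (γ = dmk (Kc p n r) (bp O) → v = 1) := by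
    intro γ
    obtain ⟨x, rfl⟩ := dmk_surj _ γ
    by_cases h : dmk (Kc p n r) x = dmk (Kc p n r) (bp (dmk (HH p n k r) x))
    · exact ⟨dmk (HH p n k r) x, 1, one_mem _, by simpa using h, fun _ => rfl⟩
    · obtain ⟨v, hv, h2⟩ := HH_rep (k := k) (r := r) (x := x) (y := bp (dmk (HH p n k r) x)) (hbp _).symm
      exact ⟨_, v, hv, h2, fun h' => absurd h' h⟩
  choose Oc vc hv hγ hγ1 using hch
  have hO : ∀ γ g, dmk (Kc p n r) g = γ → Oc γ = dmk (HH p n k r) g := by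
    intro γ g hg
    rw [hγ γ] at hg
    have := coarse (k := k) hg
    rw [this, dmk_H _ (HH_V (inv_mem (hv γ))), hbp]
  set d : DQ (Kc p n r) → B := fun γ => if Oc γ ∈ CL then ρ (vc γ) (et (Oc γ)) - et (Oc γ) else 0 with hd
  set S := N ⊔ Submodule.span 𝔽 (Set.range d) with hS
  have hdS : ∀ γ, d γ ∈ S := fun γ => Submodule.mem_sup_right (Submodule.subset_span ⟨γ, rfl⟩)
  have key : ∀ O ∈ CL, ∀ v ∈ V1 p n k, ρ v (et O) - et O ∈ S := by
    intro O hOC v hvV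
    set γ := dmk (Kc p n r) (bp O * v⁻¹) with hγd
    have hOγ : Oc γ = O := by rw [hO γ _ rfl, dmk_H _ (HH_V (inv_mem hvV)), hbp]
    set w := (vc γ)⁻¹ * v with hw
    have hwV : w ∈ V1 p n k := mul_mem (inv_mem (hv γ)) hvV
    have hst : act w (φ (et O)) = φ (et O) := by
      refine (het O hOC).stab hT hwV.2 ?_
      have h1 := hγ γ
      rw [hOγ, hγd] at h1
      have h2 := dmk_mul (V1_le0 _ hvV) h1
      rw [inv_mul_cancel_right] at h2
      rw [h2, hw, mul_assoc]
    have hA : ρ w (et O) - et O ∈ A := by rw [E.sub, E.equi, hst]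
    have e : ρ v (et O) - et O = (ρ (vc γ) (ρ w (et O) - et O) - (ρ w (et O) - et O)) + (ρ w (et O) - et O) + d γ := by
      have e1 : v = vc γ * w := by rw [hw]; group
      simp only [hd, hOγ, if_pos hOC]
      rw [map_sub, ← rho_mul, ← e1]; abel
    rw [e]
    refine add_mem (Submodule.mem_sup_left (add_mem (hJN (IV_mem (hv γ).1 hA)) ?_)) (hdS γ)
    exact Submodule.mem_sup_right (Submodule.subset_span ⟨O, hOC, w, hwV, hA, rfl⟩)
  have hMS : Mr ρ A φ k r ≤ S := by
    refine sup_le (hJN.trans le_sup_left) ?_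
    rw [Submodule.span_le]
    rintro _ ⟨v, hvV, hv1, x, hinv, hOm, rfl⟩
    set F := φ x with hF
    set xr : DQ (Kc p n r) → GG p n := fun γ => bp (Oc γ) * (vc γ)⁻¹ with hxr
    have hFC : ∀ γ, F (xr γ) ≠ 0 → Oc γ ∈ CL := by
      intro γ h
      have := hCL x hinv hOm _ h
      rwa [hxr, dmk_H _ (HH_V (inv_mem (hv γ))), hbp] at this
    have hsum : F = ∑ γ, F (xr γ) • φ (ρ (vc γ) (et (Oc γ))) := by
      ext g
      rw [Finset.sum_apply, Finset.sum_eq_single (dmk (Kc p n r) g)]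
      · set γ := dmk (Kc p n r) g with hg
        by_cases h0 : F (xr γ) = 0
        · rw [h0, zero_smul]
          obtain ⟨b, hb, x', hx', e⟩ := (dmk_eq _).1 ((hγ γ).symm.trans hg)
          rw [e, hinv _ hx']
          exact (PS_ne hT hb (E.mem x) _).2 h0
        · obtain ⟨b, hb, x', hx', e⟩ := (dmk_eq _).1 ((hγ γ).symm.trans hg)
          obtain ⟨c, hc, h2⟩ := PS_B (ψ := ψ) hT hb
          have hsp := het _ (hFC _ h0)
          have h3 : act (vc γ) (φ (et (Oc γ))) g = c := by
            rw [e, (hsp.2.1.act (V1_le0 _ (hv γ))).1 _ hx', h2 _ (PS_act hsp.1 _), act_apply, inv_mul_cancel_right, hsp.2.2, mul_one]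
          rw [Pi.smul_apply, E.equi, h3]
          conv_lhs => rw [e]
          rw [hinv _ hx', hF, h2 _ (E.mem x), smul_eq_mul, mul_comm]
      · intro γ _ hne
        by_cases h0 : F (xr γ) = 0
        · rw [h0, zero_smul]; rfl
        · have hsp := het _ (hFC _ h0)
          rw [Pi.smul_apply, E.equi]
          by_contra hh
          have h1 := (hsp.2.1.act (V1_le0 _ (hv γ))).2 g (right_ne_zero_of_smul hh)
          exact hne (h1.trans (hγ γ).symm).symm
      · simp
    have hA : x - ∑ γ, F (xr γ) • ρ (vc γ) (et (Oc γ)) ∈ A := by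
      rw [E.sub, map_sum]
      refine hsum.trans (Finset.sum_congr rfl fun γ _ => ?_)
      rw [map_smul]
    have e : ρ v x - x = (ρ v (x - ∑ γ, F (xr γ) • ρ (vc γ) (et (Oc γ))) - (x - ∑ γ, F (xr γ) • ρ (vc γ) (et (Oc γ)))) +
        ∑ γ, F (xr γ) • ((ρ (v * vc γ) (et (Oc γ)) - et (Oc γ)) - (ρ (vc γ) (et (Oc γ)) - et (Oc γ))) := by
      have : ∑ γ, F (xr γ) • ((ρ (v * vc γ) (et (Oc γ)) - et (Oc γ)) - (ρ (vc γ) (et (Oc γ)) - et (Oc γ))) =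
         ρ v (∑ γ, F (xr γ) • ρ (vc γ) (et (Oc γ))) - ∑ γ, F (xr γ) • ρ (vc γ) (et (Oc γ)) := by
        rw [map_sum, ← Finset.sum_sub_distrib]
        refine Finset.sum_congr rfl fun γ _ => ?_
        rw [map_smul, ← smul_sub, rho_mul]; congr 1; abel
      rw [this, map_sub]; abel
    change ρ v x - x ∈ S
    rw [e]
    refine add_mem (Submodule.mem_sup_left (hJN (IV_mem hvV hA))) (sum_mem fun γ _ => ?_)
    by_cases h0 : F (xr γ) = 0
    · rw [h0, zero_smul]; exact zero_mem _
    · exact Submodule.smul_mem _ _ (sub_mem (key _ (hFC _ h0) _ (mul_mem ⟨hvV, hv1⟩ (hv γ))) (key _ (hFC _ h0) _ (hv γ)))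
  obtain ⟨ν, hν, z, hz, rfl⟩ := Submodule.mem_sup.1 (hMS hy)
  have hzA : z ∈ A := by
    have := sub_mem hyA (hNA hν)
    rwa [add_sub_cancel_left] at this
  obtain ⟨c, rfl⟩ := (Submodule.mem_span_range_iff_exists_fun 𝔽).1 hz
  refine add_mem hν ?_
  suffices h : ∑ γ, c γ • d γ = 0 by rw [h]; exact zero_mem _
  refine Finset.sum_eq_zero fun γ _ => ?_
  by_cases hC : Oc γ ∈ CL
  swap
  · simp [hd, hC]
  by_cases hb : γ = dmk (Kc p n r) (bp (Oc γ))
  · simp [hd, hγ1 γ hb]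
  have h0 := congrFun ((E.ker _).2 hzA) (bp (Oc γ) * (vc γ)⁻¹)
  rw [map_sum, Finset.sum_apply, Finset.sum_eq_single γ] at h0
  · have hsp := het _ hC
    simp only [hd, if_pos hC, map_smul, map_sub, E.equi, Pi.smul_apply, Pi.sub_apply, act_apply, inv_mul_cancel_right,
      hsp.2.2, Pi.zero_apply, smul_eq_mul] at h0
    have h1 : φ (et (Oc γ)) (bp (Oc γ) * (vc γ)⁻¹) = 0 := by
      by_contra hh
      exact hb ((hγ γ).trans (hsp.2.1.2 _ hh))
    rw [h1, sub_zero, mul_one] at h0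
    rw [h0, zero_smul]
  · intro γ' _ hne
    by_cases hC' : Oc γ' ∈ CL
    swap
    · simp [hd, hC']
    have hsp := het _ hC'
    simp only [hd, if_pos hC', map_smul, map_sub, E.equi, Pi.smul_apply, Pi.sub_apply]
    have h1 : φ (et (Oc γ')) (bp (Oc γ) * (vc γ)⁻¹) = 0 := by
      by_contra hh
      have h2 := (hγ γ).trans (hsp.2.1.2 _ hh)
      have h3 : Oc γ = Oc γ' := by rw [hO γ (bp (Oc γ')) h2.symm, hbp]
      rw [← h3] at h2
      exact hb h2
    have h2 : act (vc γ') (φ (et (Oc γ'))) (bp (Oc γ) * (vc γ)⁻¹) = 0 := by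
      by_contra hh
      have := (hsp.2.1.act (V1_le0 _ (hv γ'))).2 _ hh
      rw [← hγ, ← hγ] at this
      exact hne this.symm
    rw [h1, h2]; simp
  · simp

end H
end HX

namespace HX
set_option linter.unusedSectionVars false
set_option linter.unusedSimpArgs false
set_option linter.unusedVariables false
section I1
variable {p n : ℕ} [hp : Fact p.Prime]

def IsL (k : ℕ) (κ : GG p n) : Prop := κ ∈ Pb p n k ∧ κ ∈ Kc p n 0 ∧
  ∀ i j : Fin n, k ≤ i.val → j.val < k → (κ : MM p n) i j = 0 ∧ ((κ⁻¹ : GG p n) : MM p n) i j = 0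

lemma IsL_one (k : ℕ) : IsL k (1 : GG p n) := by
  refine ⟨one_mem _, one_mem _, fun i j hi hj => ?_⟩
  have : i ≠ j := by rintro rfl; omega
  simp [this]

noncomputable def bdm (k : ℕ) (X : MM p n) : MM p n := fun i j => if (i.val < k ↔ j.val < k) then X i j else 0

lemma bdm_mul {k : ℕ} {X Y : MM p n} (hX : ∀ i j : Fin n, i.val < k → k ≤ j.val → X i j = 0)
    (hY : ∀ i j : Fin n, i.val < k → k ≤ j.val → Y i j = 0) : bdm k X * bdm k Y = bdm k (X * Y) := by
  ext i j
  rw [Matrix.mul_apply]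
  simp only [bdm]
  by_cases hij : i.val < k ↔ j.val < k
  · rw [if_pos hij, Matrix.mul_apply]
    refine Finset.sum_congr rfl fun l _ => ?_
    by_cases hl : i.val < k ↔ l.val < k
    · rw [if_pos hl, if_pos (by tauto)]
    · rw [if_neg hl, zero_mul]
      by_cases hi : i.val < k
      · rw [hX i l hi (by omega), zero_mul]
      · rw [hY l j (by omega) (by omega), mul_zero]
  · rw [if_neg hij]
    refine Finset.sum_eq_zero fun l _ => ?_
    by_cases hl : i.val < k ↔ l.val < k
    · rw [if_neg (c := (l.val < k ↔ j.val < k)) (by tauto), mul_zero]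
    · rw [if_neg hl, zero_mul]

lemma bdm_one (k : ℕ) : bdm k (1 : MM p n) = 1 := by
  ext i j
  simp only [bdm]
  by_cases h : i = j
  · subst h; simp
  · simp [h]

lemma bdm_MB {k : ℕ} {X : MM p n} (h : MB 1 X) : MB 1 (bdm k X) := by
  intro i j
  simp only [bdm]
  split_ifs
  · exact h i j
  · simp

lemma L_decomp {k : ℕ} {q : GG p n} (hq : q ∈ Pb p n k) (hq0 : q ∈ Kc p n 0) :
    ∃ κ, IsL k κ ∧ ∃ v ∈ V p n k, q = v * κ := by
  have hqi := inv_mem hq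
  let l : GG p n := ⟨bdm k (q : MM p n), bdm k ((q⁻¹ : GG p n) : MM p n),
    by rw [bdm_mul hq hqi, gmul_inv, bdm_one], by rw [bdm_mul hqi hq, ginv_mul, bdm_one]⟩
  have hl1 : (l : MM p n) = bdm k (q : MM p n) := rfl
  have hl2 : ((l⁻¹ : GG p n) : MM p n) = bdm k ((q⁻¹ : GG p n) : MM p n) := rfl
  have hlP : l ∈ Pb p n k := by
    intro i j hi hj
    rw [hl1]; simp only [bdm]; rw [if_neg (by omega)]
  refine ⟨l, ⟨hlP, mem_K0.2 ⟨bdm_MB (mem_K0.1 hq0).1, bdm_MB (mem_K0.1 hq0).2⟩, ?_⟩, ?_⟩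
  · intro i j hi hj
    rw [hl1, hl2]
    constructor <;> (simp only [bdm]; rw [if_neg (by omega)])
  · have hLB : LB k ((q : MM p n) - bdm k (q : MM p n)) := by
      intro i j hij
      rw [Matrix.sub_apply]
      simp only [bdm]
      by_cases h : i.val < k ↔ j.val < k
      · rw [if_pos h, sub_self]
      · rw [if_neg h, sub_zero]
        exact hq i j (by omega) (by omega)
    refine ⟨mkV k _ (LB_UZ_mul (inv_mem hlP) hLB), mkV_mem _, ?_⟩
    ext1
    rw [Units.val_mul, mkV_val, add_mul, one_mul, mul_assoc, ginv_mul, mul_one, hl1]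
    abel

/-- `s u(c) κ ∈ Ω` when `|c| ≥ 1` -/
lemma sk_Om {k : ℕ} (h : Gd k n) {c : ℚ_[p]} (hc : 1 ≤ ‖c‖) {κ : GG p n} (hκ : IsL k κ) :
    sk h * u0 h c * κ ∈ Om p n k := by
  have hc0 : c ≠ 0 := by rintro rfl; simp at hc; linarith
  set E : MM p n := Matrix.single h.lo h.hi c⁻¹ with hE
  have hEE : E * E = 0 := by rw [hE, Matrix.single_mul_single_of_ne]; exact h.lo_ne.symm
  let x : GG p n := ⟨1 - E, 1 + E, by noncomm_ring; simp [hEE], by noncomm_ring; simp [hEE]⟩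
  have hx : (x : MM p n) = 1 - E := rfl
  have hxi : ((x⁻¹ : GG p n) : MM p n) = 1 + E := rfl
  have hb : sk h * u0 h c * x ∈ Bb p n := by
    rw [mem_Bb]
    intro i j hij
    rw [mul_assoc, sk, sw_mul, u0_mul_apply, hx]
    simp only [hE, Matrix.sub_apply]
    have hlo := h.lo_val
    have hhi := h.hi_val
    have hne := h.lo_ne
    by_cases h1 : i = h.lo
    · subst h1
      rw [Equiv.swap_apply_left, if_pos rfl]
      by_cases h2 : j = h.hi
      · subst h2
        rw [Matrix.single_apply_same, Matrix.single_apply_of_row_ne hne, Matrix.one_apply_eq, Matrix.one_apply_ne hne]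
        field_simp; ring
      · rw [Matrix.single_apply_of_row_ne hne, Matrix.single_apply_of_col_ne _ _ (Ne.symm h2), Matrix.one_apply_ne (Ne.symm h2), Matrix.one_apply_ne hij.ne]
        simp
    · by_cases h2 : i = h.hi
      · subst h2
        rw [Equiv.swap_apply_right, if_neg hne, Matrix.one_apply_ne (h.lo_lt_hi.trans hij).ne, Matrix.single_apply_of_col_ne _ _ hij.ne]
        simp
      · rw [Equiv.swap_apply_of_ne_of_ne h1 h2, if_neg h2, Matrix.one_apply_ne hij.ne, Matrix.single_apply_of_row_ne (Ne.symm h1)]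
        simp
  refine ⟨sk h * u0 h c * x * κ, mul_mem (Bb_le k hb) hκ.1, ((κ⁻¹ : GG p n) : MM p n) * E * (κ : MM p n), ?_, ?_, ?_⟩
  · intro i j hij
    have e : (((κ⁻¹ : GG p n) : MM p n) * E * (κ : MM p n)) i j = phi κ⁻¹ i j E := by
      simp [phi]
    rw [e, hE, phi_single, inv_inv]
    by_cases hi : k ≤ i.val
    · rw [(hκ.2.2 i h.lo hi h.lo_lt).2]; simp
    · rw [(hκ.2.2 h.hi j h.hi_val.ge (by omega)).1]; simp
  · have hE1 : MB 1 E := by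
      intro i j
      rw [hE, Matrix.single_apply]
      split_ifs
      · rw [norm_inv]; exact inv_le_one_of_one_le₀ hc
      · simp
    have := mem_K0.1 hκ.2.1
    exact MB.mul_left zero_le_one (MB.mul_left zero_le_one this.2 hE1) this.1 
  · have e : (sk h * u0 h c * x * κ) * (κ⁻¹ * x⁻¹ * κ) = sk h * u0 h c * κ := by group
    have e2 : ((κ⁻¹ * x⁻¹ * κ : GG p n) : MM p n) = 1 + ((κ⁻¹ : GG p n) : MM p n) * E * (κ : MM p n) := by
      rw [Units.val_mul, Units.val_mul, hxi, mul_add, add_mul, mul_one, ginv_mul]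
    rw [← e2, ← Units.val_mul, e]

lemma sk_sk {k : ℕ} (h : Gd k n) : (sk h : GG p n) * sk h = 1 := sw_sw _ _
lemma sk_K0 {k : ℕ} (h : Gd k n) : (sk h : GG p n) ∈ Kc p n 0 := sw_mem_K0 _ _

lemma sk_low {k : ℕ} (h : Gd k n) {X : MM p n} (hX : LB k X) (h0 : X h.hi h.lo = 0) :
    sk h * mkV k X hX * sk h ∈ lowerUnipotent p n := by
  have hlo := h.lo_val
  have hhi := h.hi_val
  have hne := h.lo_ne
  have key : ∀ i j : Fin n, i ≤ j → X (Equiv.swap h.lo h.hi i) (Equiv.swap h.lo h.hi j) = 0 := by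
    intro i j hij
    rw [Fin.le_def] at hij
    by_contra hc
    have h1 : ¬ (k ≤ (Equiv.swap h.lo h.hi i).val → k ≤ (Equiv.swap h.lo h.hi j).val) := fun hh => hc (hX _ _ hh)
    push Not at h1
    have h2 : i = h.lo ∨ (k < i.val ∧ i ≠ h.lo ∧ i ≠ h.hi) := by
      by_cases e1 : i = h.lo
      · left; exact e1
      by_cases e2 : i = h.hi
      · exfalso; rw [e2, Equiv.swap_apply_right] at h1; omega
      rw [Equiv.swap_apply_of_ne_of_ne e1 e2] at h1
      right; refine ⟨?_, e1, e2⟩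
      have : i.val ≠ k := fun hh => e2 (Fin.ext (hh.trans hhi.symm))
      omega
    have h3 : j = h.hi ∨ (j.val + 1 < k ∧ j ≠ h.lo ∧ j ≠ h.hi) := by
      by_cases e1 : j = h.hi
      · left; exact e1
      by_cases e2 : j = h.lo
      · exfalso; rw [e2, Equiv.swap_apply_left] at h1; omega
      rw [Equiv.swap_apply_of_ne_of_ne e2 e1] at h1
      right; refine ⟨?_, e2, e1⟩
      have : j.val ≠ h.lo.val := fun hh => e2 (Fin.ext hh)
      omega
    rcases h2 with rfl | h2 <;> rcases h3 with rfl | h3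
    · rw [Equiv.swap_apply_left, Equiv.swap_apply_right] at hc; exact hc h0
    all_goals omega
  have e : ∀ i j, ((sk h * mkV k X hX * sk h : GG p n) : MM p n) i j =
      (1 : MM p n) i j + X (Equiv.swap h.lo h.hi i) (Equiv.swap h.lo h.hi j) := by
    intro i j
    rw [sk, mul_sw, sw_mul, mkV_val, Matrix.add_apply]
    congr 1
    simp [Matrix.one_apply]
  refine ⟨fun i j hij => ?_, fun i => ?_⟩
  · rw [e, key i j hij.le, Matrix.one_apply_ne hij.ne, add_zero]
  · rw [e, key i i le_rfl, Matrix.one_apply_eq, add_zero]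

lemma single_MB {i j : Fin n} {c : ℚ_[p]} {d : ℝ} (hd : 0 ≤ d) (hc : ‖c‖ ≤ d) : MB d (Matrix.single i j c : MM p n) := by
  intro a b
  rw [Matrix.single_apply]
  split_ifs
  · exact hc
  · simpa using hd

lemma u0_Kc {k s : ℕ} (h : Gd k n) {c : ℚ_[p]} : (u0 h c : GG p n) ∈ Kc p n s ↔ ‖c‖ ≤ ep p s := by
  rw [u0, mkV_mem_Kc]
  refine ⟨fun hh => by simpa using hh h.hi h.lo, fun hh => single_MB (ep_pos s).le hh⟩

/-- if `s κ w` and `s κ` are in the same class then the entry is small -/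
lemma entry_small {k r : ℕ} (h : Gd k n) {X : MM p n} (hX : LB k X) (hX1 : MB 1 X) 
    (hd : dmk (Kc p n r) (sk h * mkV k X hX) = dmk (Kc p n r) (sk h)) : ‖X h.hi h.lo‖ ≤ ep p r := by
  obtain ⟨b, hb, x, hx, e⟩ := (dmk_eq _).1 hd.symm
  set m : GG p n := sk h * mkV k X hX * sk h with hm
  set x' : GG p n := sk h * x * (sk h)⁻¹ with hx'
  have hx'K : x' ∈ Kc p n r := Kc_conj (sk_K0 h) hx
  have hsi : (sk h : GG p n)⁻¹ = sk h := sw_inv _ _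
  have eb : b = m * x'⁻¹ := by
    rw [eq_mul_inv_iff_mul_eq, hm, e, hx', hsi]
    group
  have hm1 : MB 1 (m : MM p n) := by
    have h1 : MB 1 ((mkV k X hX : GG p n) : MM p n) := by rw [mkV_val]; exact MB_one.add hX1
    rw [hm, Units.val_mul, Units.val_mul]
    have hs := (mem_K0.1 (sk_K0 (p := p) h)).1
    exact MB.mul_left zero_le_one (MB.mul_left zero_le_one hs h1) hs
  have h1 : (m : MM p n) h.lo h.hi = X h.hi h.lo := by
    rw [hm, sk, mul_sw, sw_mul, mkV_val, Matrix.add_apply, Equiv.swap_apply_left, Equiv.swap_apply_right, Matrix.one_apply_ne h.lo_ne.symm, zero_add]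
  have h2 : (b : MM p n) h.lo h.hi = 0 := mem_Bb.1 hb _ _ h.lo_lt_hi
  have h3 : (b : MM p n) = m + m * (((x'⁻¹ : GG p n) : MM p n) - 1) := by
    rw [eb, Units.val_mul]; noncomm_ring
  have h4 := MB.mul_left (ep_pos r).le hm1 (mem_Kc.1 hx'K).2
  rw [h3, Matrix.add_apply, h1] at h2
  rw [eq_neg_of_add_eq_zero_left h2, norm_neg]
  exact h4 _ _

lemma zp_split {r : ℕ} {a : ℚ_[p]} (ha : ‖a‖ ≤ ep p r) : ∃ N : ℕ, ∃ a' : ℚ_[p], ‖a'‖ ≤ ep p r ∧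
    a = N * (p : ℚ_[p])^r + p * a' := by
  have hne : (p : ℚ_[p])^r ≠ 0 := pow_ne_zero _ p_ne
  have h1 : ‖a / (p : ℚ_[p])^r‖ ≤ 1 := by
    rw [norm_div, norm_p_pow, div_le_one (ep_pos r)]; exact ha
  obtain ⟨u, hu⟩ : ∃ u : ℤ_[p], (u : ℚ_[p]) = a / (p : ℚ_[p])^r := ⟨⟨_, h1⟩, rfl⟩
  obtain ⟨N, _, hN⟩ := PadicInt.exists_mem_range (p := p) u
  rw [PadicInt.maximalIdeal_eq_span_p, Ideal.mem_span_singleton] at hN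
  obtain ⟨c, hc⟩ := hN
  refine ⟨N, (p : ℚ_[p])^r * c, ?_, ?_⟩
  · rw [norm_mul, norm_p_pow]
    exact mul_le_of_le_one_right (ep_pos r).le c.2
  · have h2 := congrArg (fun x : ℤ_[p] => (x : ℚ_[p])) hc
    rw [PadicInt.coe_sub, PadicInt.coe_mul, PadicInt.coe_natCast, PadicInt.coe_natCast, hu] at h2
    have h3 : a = (p : ℚ_[p])^r * (a / (p : ℚ_[p])^r) := by field_simp
    have h5 : a / (p : ℚ_[p])^r - N = p * c := h2
    have h4 : a / (p : ℚ_[p])^r = N + p * c := by rw [← h5]; ring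
    rw [h3, h4]; ring

end I1
end HX

namespace HX
set_option linter.unusedSectionVars false
set_option linter.unusedSimpArgs false
set_option linter.unusedVariables false
section I2
variable {p n : ℕ} [hp : Fact p.Prime]
variable {𝔽 : Type*} [Field 𝔽] {T : Subgroup (GG p n)} {ψ : T →* 𝔽ˣ}
variable {B : Type*} [AddCommGroup B] [Module 𝔽 B] {ρ : Representation 𝔽 (GG p n) B} {A : Submodule 𝔽 B}
  {φ : B →ₗ[𝔽] (GG p n → 𝔽)}

noncomputable def wk {k : ℕ} (h : Gd k n) (r : ℕ) (κ : GG p n) : GG p n := κ⁻¹ * u0 h ((p : ℚ_[p])^r) * κ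

lemma wk_V {k : ℕ} (h : Gd k n) (r : ℕ) {κ : GG p n} (hκ : IsL k κ) : wk h r κ ∈ V p n k :=
  V_conj' hκ.1 (u0_mem h _)
lemma wk_Kc {k : ℕ} (h : Gd k n) (r : ℕ) {κ : GG p n} (hκ : IsL k κ) : wk h r κ ∈ Kc p n r :=
  Kc_conj' hκ.2.1 ((u0_Kc h).2 (norm_p_pow _).le)

lemma sk_move {k r : ℕ} (h : Gd k n) {Z : MM p n} (hZ : LB k Z) (hz : ‖Z h.hi h.lo‖ ≤ ep p r) {κ : GG p n} (hκ : κ ∈ Kc p n 0) :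
    ∃ u ∈ lowerUnipotent p n, ∃ x ∈ Kc p n r, sk h * mkV k Z hZ * κ = u * (sk h * κ) * x := by
  set a := Z h.hi h.lo with ha
  have hZ0 : LB k (Z - Matrix.single h.hi h.lo a) := by
    rw [sub_eq_add_neg]; exact hZ.add (u0_LB h a).neg
  have e : mkV k Z hZ = mkV k _ hZ0 * u0 h a := by
    rw [u0, mkV_mul]; exact mkV_congr _ (by abel)
  refine ⟨_, sk_low h hZ0 (by simp [ha]), κ⁻¹ * u0 h a * κ, Kc_conj' hκ ((u0_Kc h).2 hz), ?_⟩
  rw [e]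
  have := sk_sk (p := p) h
  calc _ = sk h * mkV k _ hZ0 * (1 : GG p n) * u0 h a * κ := by group
    _ = _ := by rw [← this]; group

lemma case2 [CharP 𝔽 p] (hT : IsT T) (E : IsExt T ψ ρ A φ) {k r : ℕ} (hr : 1 ≤ r) (h : Gd k n) {κ : GG p n} (hκ : IsL k κ)
    {et : B} (he : Spike T ψ r (sk h * κ) (φ et)) {w : GG p n} (hw : w ∈ V1 p n k) (hwA : ρ w et - et ∈ A) :
    ρ (wk h r κ) et - et ∈ A ∧ ∃ N : ℕ, (ρ w et - et) - (N : 𝔽) • (ρ (wk h r κ) et - et) ∈ IV ρ k A := by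
  have hwkA : ρ (wk h r κ) et - et ∈ A := E.fix.2 fun y => he.2.1.1 _ (wk_Kc h r hκ) y
  refine ⟨hwkA, ?_⟩
  obtain ⟨X, hX, eX⟩ := V_conj hκ.1 hw.1
  have hX1 : MB (ep p 1) X := by
    have := Kc_conj hκ.2.1 hw.2
    rwa [eX, mkV_mem_Kc] at this
  have hd : dmk (Kc p n r) (sk h * mkV k X hX) = dmk (Kc p n r) (sk h) := by
    have h1 : dmk (Kc p n r) (sk h * κ * w) = dmk (Kc p n r) (sk h * κ) := by
      apply he.2.1.2
      rw [E.fix.1 hwA, he.2.2]; exact one_ne_zero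
    have h2 := dmk_mul (inv_mem hκ.2.1) h1
    rw [mul_inv_cancel_right] at h2
    rw [← eX, ← h2]; congr 1; group
  obtain ⟨N, a', ha', hsp⟩ := zp_split (entry_small h hX (hX1.mono (ep_le_one 1)) hd)
  set Y : MM p n := (p : ℚ_[p])⁻¹ • (X - (N : ℚ_[p]) • Matrix.single h.hi h.lo ((p : ℚ_[p])^r)) with hY
  have hpne : (p : ℚ_[p]) ≠ 0 := p_ne
  have hYLB : LB k Y := by
    rw [hY, sub_eq_add_neg]
    exact (hX.add ((u0_LB h _).smul _).neg).smul _
  have hYe : Y h.hi h.lo = a' := by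
    rw [hY, Matrix.smul_apply, Matrix.sub_apply, Matrix.smul_apply, Matrix.single_apply_same, hsp, smul_eq_mul, smul_eq_mul]
    field_simp; ring
  have hY1 : MB 1 Y := by
    have h1 : MB (ep p 1) (X - (N : ℚ_[p]) • Matrix.single h.hi h.lo ((p : ℚ_[p])^r)) := by
      refine hX1.sub ?_
      have h2 : MB (ep p 1) (Matrix.single h.hi h.lo ((p : ℚ_[p])^r) : MM p n) :=
        single_MB (ep_pos _).le (by rw [norm_p_pow]; exact ep_anti hr)
      refine (h2.smul _).mono ?_
      refine mul_le_of_le_one_left (ep_pos _).le ?_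
      have := Padic.norm_int_le_one (p := p) (N : ℤ)
      simpa using this
    refine (h1.smul _).mono (le_of_eq ?_)
    have h3 := norm_p_pow (p := p) 1
    rw [pow_one] at h3
    rw [norm_inv, h3, inv_mul_cancel₀ (ep_pos _).ne']
  have hdecomp : mkV k X hX = u0 h ((p : ℚ_[p])^r) ^ N * mkV k Y hYLB ^ p := by
    rw [u0, mkV_pow, mkV_pow, mkV_mul]
    refine mkV_congr _ ?_
    rw [hY, smul_smul, mul_inv_cancel₀ hpne, one_smul]; abel
  set v' : GG p n := κ⁻¹ * mkV k Y hYLB * κ with hv'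
  have hv'V : v' ∈ V p n k := V_conj' hκ.1 (mkV_mem _)
  have hv'0 : v' ∈ Kc p n 0 := Kc_conj' hκ.2.1 ((mkV_mem_Kc _).2 (by rwa [ep_zero]))
  have hwdec : w = wk h r κ ^ N * v' ^ p := by
    have e1 : wk h r κ ^ N = κ⁻¹ * u0 h ((p : ℚ_[p])^r) ^ N * κ := by
      have := conj_pow (i := N) (a := κ⁻¹) (b := u0 h ((p : ℚ_[p])^r))
      rw [inv_inv] at this; exact this
    have e2 : v' ^ p = κ⁻¹ * mkV k Y hYLB ^ p * κ := by
      have := conj_pow (i := p) (a := κ⁻¹) (b := mkV k Y hYLB)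
      rw [inv_inv] at this; exact this
    have e3 : w = κ⁻¹ * (κ * w * κ⁻¹) * κ := by group
    rw [e3, eX, hdecomp, e1, e2]; group
  have hv'A : ρ v' et - et ∈ A := by
    rw [E.sub, E.equi]
    obtain ⟨u, hu, x, hx, e⟩ := sk_move (r := r) h hYLB (by rw [hYe]; exact ha') hκ.2.1
    have e' : sk h * κ * v' = u * (sk h * κ) * x := by rw [← e, hv']; group
    have hdm : dmk (Kc p n r) (sk h * κ) = dmk (Kc p n r) (sk h * κ * v'⁻¹) := by
      have h1 : dmk (Kc p n r) (sk h * κ * v') = dmk (Kc p n r) (sk h * κ) := by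
        rw [e', dmk_H _ hx, dmk_B _ (lowerUnipotent_sub hu)]
      have h2 := dmk_mul (inv_mem hv'0) h1
      rwa [mul_inv_cancel_right] at h2
    refine uniq hT (PS_act he.1 _) he.1 ((he.2.1.act hv'0).congr hdm.symm) he.2.1 ?_
    rw [act_apply, e', he.2.1.1 _ hx, he.1.2.2 _ hu]
  refine ⟨N, ?_⟩
  rw [← mkQ0, map_sub, map_smul]
  have hD := DInv_mkQ (ρ := ρ) (A := A) k
  have hp1 := D_pow E hD hv'V hv'A p
  have hp2 := D_pow E hD (wk_V h r hκ) hwkA N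
  conv_lhs => rw [hwdec]
  rw [D_mul E hD (pow_mem (wk_V h r hκ) N) hp1.1, D_root E hD hv'V hv'A, add_zero, hp2.2, sub_self]

lemma class_V1 {k r : ℕ} (h : Gd k n) {κ : GG p n} (hκ : IsL k κ) {b : ℚ_[p]} (hb : ¬ 1 ≤ ‖b‖) :
    dmk (HH p n k r) (sk h * u0 h b * κ) = dmk (HH p n k r) (sk h * κ) := by
  have e : sk h * u0 h b * κ = (sk h * κ) * (κ⁻¹ * u0 h b * κ) := by group
  rw [e]
  refine dmk_H _ (HH_V ⟨V_conj' hκ.1 (u0_mem h b), Kc_conj' hκ.2.1 ((u0_Kc h).2 ?_)⟩)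
  push Not at hb
  have h1 : ‖b‖ ≤ (p : ℝ) ^ (-1 : ℤ) := by
    have := (Padic.norm_le_pow_iff_norm_lt_pow_add_one b (-1)).2 (by simpa using hb)
    exact this
  refine h1.trans (le_of_eq ?_)
  rw [← norm_p_pow 1, pow_one, Padic.norm_p, zpow_neg_one]

lemma bp_exists {k r : ℕ} (h : Gd k n) (O : DQ (HH p n k r)) : ∃ x, dmk (HH p n k r) x = O ∧
    ((∀ g, dmk (HH p n k r) g = O → g ∉ Om p n k) →
      (∃ κ, IsL k κ ∧ x = sk h * κ ∧ (dmk (HH p n k r) (sk h) = O → κ = 1)) ∨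
      ∀ q ∈ Pb p n k, dmk (HH p n k r) (sk h * q) ≠ O) := by
  by_cases h1 : dmk (HH p n k r) (sk h) = O
  · exact ⟨sk h, h1, fun _ => Or.inl ⟨1, IsL_one k, by simp, fun _ => rfl⟩⟩
  by_cases h2 : ∀ q ∈ Pb p n k, dmk (HH p n k r) (sk h * q) ≠ O
  · obtain ⟨x, hx⟩ := dmk_surj _ O
    exact ⟨x, hx, fun _ => Or.inr h2⟩
  push Not at h2
  obtain ⟨q, hq, hO⟩ := h2
  by_cases h3 : ∀ g, dmk (HH p n k r) g = O → g ∉ Om p n k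
  swap
  · exact ⟨_, hO, fun hh => absurd hh h3⟩
  obtain ⟨b, hb, κ', hκ', rfl⟩ := iwasawa' q
  have hκ'P : κ' ∈ Pb p n k := by
    have := mul_mem (inv_mem (Bb_le k hb)) hq
    rwa [inv_mul_cancel_left] at this
  obtain ⟨κ, hκ, v, hv, rfl⟩ := L_decomp hκ'P hκ'
  obtain ⟨b', hb', c, e⟩ := sk_B h (mul_mem hb (V_le_Bb hv))
  have e2 : sk h * (b * (v * κ)) = b' * (sk h * u0 h c * κ) := by
    calc _ = (sk h * (b * v)) * κ := by group
      _ = _ := by rw [e]; group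
  rw [e2, dmk_B _ hb'] at hO
  have hc : ¬ 1 ≤ ‖c‖ := fun hc => h3 _ hO (sk_Om h hc hκ)
  rw [class_V1 h hκ hc] at hO
  exact ⟨_, hO, fun _ => Or.inl ⟨κ, hκ, rfl, fun hh => absurd hh h1⟩⟩

lemma lemmaN [CharP 𝔽 p] (hT : IsT T) (E : IsExt T ψ ρ A φ) {k : ℕ} (h : Gd k n) {y : B} (hyA : y ∈ A) (hy : y ∈ IV ρ k ⊤) :
    ∃ N r : ℕ, 1 ≤ r ∧ ∃ (ι : Type) (_ : Fintype ι) (κ : ι → GG p n) (et : ι → B) (c : ι → 𝔽),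
      (∀ o, IsL k (κ o)) ∧
      (ρ (zz p n k N) y - ∑ o, c o • (ρ (wk h r (κ o)) (et o) - et o) ∈ IV ρ k A) ∧
      (∀ o, ρ (wk h r (κ o)) (et o) - et o ∈ A) ∧
      (∀ o, Spike T ψ r (sk h) (act (κ o) (φ (et o)))) ∧
      (∀ o, ∀ g ∈ Om p n k, φ (et o) g = 0) ∧
      (∀ o o', o ≠ o' → ∀ b, φ (et o) (sk h * u0 h b * κ o') = 0) ∧
      (∀ o, κ o = 1 ∨ ∀ b, φ (et o) (sk h * u0 h b) = 0) := by
  classical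
  obtain ⟨N, hN⟩ := step1 hT E hy
  obtain ⟨r0, hr0⟩ := hN N le_rfl
  set r := max r0 1 with hr
  have hr1 : 1 ≤ r := le_max_right _ _
  have hMr := hr0 r (le_max_left _ _)
  have hzA : ρ (zz p n k N) y ∈ A := E.stab _ _ hyA
  choose bp hbp hbp2 using fun O : DQ (HH p n k r) => bp_exists (r := r) h O
  set CL : Set (DQ (HH p n k r)) := {O | (∀ g, dmk (HH p n k r) g = O → g ∉ Om p n k) ∧ ∃ x : B, Spike T ψ r (bp O) (φ x)} with hCLd
  have hex : ∀ O, ∃ x : B, O ∈ CL → Spike T ψ r (bp O) (φ x) := by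
    intro O
    by_cases hO : O ∈ CL
    · obtain ⟨x, hx⟩ := hO.2
      exact ⟨x, fun _ => hx⟩
    · exact ⟨0, fun hh => absurd hh hO⟩
  choose et het using hex
  have hCL : ∀ x, Inv r (φ x) → (∀ g ∈ Om p n k, φ x g = 0) → ∀ g, φ x g ≠ 0 → dmk (HH p n k r) g ∈ CL := by
    intro x hinv hOm g hg
    refine ⟨fun g' hg' hOg => hg ?_, ?_⟩
    · obtain ⟨b, hb, _, ⟨v, hv, x', hx', rfl⟩, rfl⟩ := (dmk_eq _).1 hg'
      rw [← mul_assoc, hinv _ hx']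
      exact hOm _ (Om_V (Pb_Om (Bb_le k hb) hOg) hv.1 hv.2)
    · obtain ⟨v, hv, hd⟩ := HH_rep (k := k) (r := r) (x := g) (y := bp (dmk (HH p n k r) g)) (hbp _).symm
      set x0 := bp (dmk (HH p n k r) g) with hx0
      have hne : φ x (x0 * v⁻¹) ≠ 0 := by
        intro h0
        obtain ⟨b, hb, x', hx', e⟩ := (dmk_eq _).1 hd.symm
        rw [e, hinv _ hx'] at hg
        exact hg ((PS_ne hT hb (E.mem x) _).2 h0)
      set c := φ x (x0 * v⁻¹) with hc
      set f : GG p n → 𝔽 := c⁻¹ • cut (Kc p n r) (dmk _ (x0 * v⁻¹)) (φ x) with hf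
      have hfm : f ∈ PS T ψ := Submodule.smul_mem _ _ (cut_mem hT le_rfl _ (E.mem x))
      have hfS : Sup r (x0 * v⁻¹) f := by
        refine Sup.smul ⟨fun x' hx' g => cut_H _ hx' (fun g => hinv _ hx' g) g, fun g hg => ?_⟩ _
        by_contra hh
        exact hg (cut_apply_ne hh)
      obtain ⟨x', hx'⟩ := E.surj _ (PS_act hfm v⁻¹)
      refine ⟨x', ?_⟩
      rw [hx']
      have hv0 := inv_mem (V1_le0 _ hv)
      refine ⟨PS_act hfm _, ?_, ?_⟩
      · have := hfS.act hv0
        rwa [inv_inv, inv_mul_cancel_right] at this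
      · rw [act_apply, hf, Pi.smul_apply, cut_apply_of rfl, ← hc, smul_eq_mul, inv_mul_cancel₀ hne]
  have hst := stage2 hT E bp hbp CL et het hCL hzA hMr
  have hcl : ∀ O ∈ CL, ∀ g, φ (et O) g ≠ 0 → dmk (HH p n k r) g = O := by
    intro O hO g hg
    have := coarse (k := k) ((het O hO).2.1.2 g hg)
    rw [this, hbp]
  have hOm0 : ∀ O ∈ CL, ∀ g ∈ Om p n k, φ (et O) g = 0 := by
    intro O hO g hg
    by_contra hh
    exact hO.1 g (hcl O hO g hh) hg
  let P : DQ (HH p n k r) → GG p n → Prop := fun O κ => IsL k κ ∧ bp O = sk h * κ ∧ (dmk (HH p n k r) (sk h) = O → κ = 1)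
  let ι : Type := {O : DQ (HH p n k r) // O ∈ CL ∧ ∃ κ, P O κ}
  have hfin : Finite (DQ (HH p n k r)) := DC_finite _ HH_K
  have hfι : Finite ι := Subtype.finite
  let iι : Fintype ι := Fintype.ofFinite _
  let κ : ι → GG p n := fun o => o.2.2.choose
  have hκ : ∀ o, P o.1 (κ o) := fun o => o.2.2.choose_spec
  have hspk : ∀ o : ι, Spike T ψ r (sk h * κ o) (φ (et o.1)) := fun o => by
    have := het o.1 o.2.1
    rwa [(hκ o).2.1] at this
  have hwkA : ∀ o : ι, ρ (wk h r (κ o)) (et o.1) - et o.1 ∈ A := fun o =>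
    E.fix.2 fun y => (hspk o).2.1.1 _ (wk_Kc h r (hκ o).1) y
  have hmem : ρ (zz p n k N) y ∈ IV ρ k A ⊔ Submodule.span 𝔽 (Set.range fun o : ι => ρ (wk h r (κ o)) (et o.1) - et o.1) := by
    refine SetLike.le_def.1 ?_ hst
    refine sup_le le_sup_left ?_
    rw [Submodule.span_le]
    rintro _ ⟨O, hO, w, hw, hwA, rfl⟩
    rcases hbp2 O hO.1 with ⟨κ', hκ'⟩ | hno
    · let o : ι := ⟨O, hO, κ', hκ'⟩
      obtain ⟨-, N', hN'⟩ := case2 hT E hr1 h (hκ o).1 (hspk o) hw hwA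
      have := add_mem (Submodule.mem_sup_left (T := Submodule.span 𝔽 (Set.range fun o : ι => ρ (wk h r (κ o)) (et o.1) - et o.1)) hN')
        (Submodule.mem_sup_right (Submodule.smul_mem _ (N' : 𝔽) (Submodule.subset_span ⟨o, rfl⟩)))
      rw [sub_add_cancel] at this
      exact this
    · refine Submodule.mem_sup_left ?_
      rw [← mkQ0]
      refine kill1 hT E h hw.1 hw.2 (DInv_mkQ k) hwA (fun g hg => hOm0 O hO g (Om_Pb hg)) (fun g hg => ?_)
      by_contra hh
      exact hno g hg (hcl O hO _ hh)
  obtain ⟨j, hj, z, hz, e⟩ := Submodule.mem_sup.1 hmem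
  obtain ⟨c, rfl⟩ := (Submodule.mem_span_range_iff_exists_fun 𝔽).1 hz
  have hgen : ∀ (o : ι) (κ' : GG p n), IsL k κ' → dmk (HH p n k r) (sk h * κ') ≠ o.1 → ∀ b, φ (et o.1) (sk h * u0 h b * κ') = 0 := by
    intro o κ' hκ' hne b
    by_cases hb : 1 ≤ ‖b‖
    · exact hOm0 _ o.2.1 _ (sk_Om h hb hκ')
    · by_contra hh
      have := hcl _ o.2.1 _ hh
      rw [class_V1 h hκ' hb] at this
      exact hne this
  refine ⟨N, r, hr1, ι, iι, κ, fun o => et o.1, c, fun o => (hκ o).1, ?_, hwkA, fun o => ?_, fun o => hOm0 _ o.2.1, ?_, ?_⟩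
  · rw [← e, add_sub_cancel_right]; exact hj
  · refine ⟨PS_act (hspk o).1 _, ?_, ?_⟩
    · have := (hspk o).2.1.act (hκ o).1.2.1
      rwa [mul_inv_cancel_right] at this
    · exact (hspk o).2.2
  · intro o o' hne b
    refine hgen o _ (hκ o').1 ?_ b
    rw [← (hκ o').2.1, hbp]
    exact fun hh => hne (Subtype.ext hh.symm)
  · intro o
    by_cases hs : dmk (HH p n k r) (sk h) = o.1
    · exact Or.inl ((hκ o).2.2 hs)
    · right
      intro b
      have := hgen o 1 (IsL_one k) (by rwa [mul_one]) b
      rwa [mul_one] at this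

end I2
end HX

namespace HX
set_option linter.unusedSectionVars false
set_option linter.unusedSimpArgs false
set_option linter.unusedVariables false
section J
variable {p n : ℕ} [hp : Fact p.Prime]
variable {𝔽 : Type*} [Field 𝔽] {T : Subgroup (GG p n)} {ψ η : T →* 𝔽ˣ}
variable {B : Type*} [AddCommGroup B] [Module 𝔽 B] {ρ : Representation 𝔽 (GG p n) B} {A : Submodule 𝔽 B}
  {φ : B →ₗ[𝔽] (GG p n → 𝔽)} {D : B →ₗ[𝔽] 𝔽}

lemma lt_one_ep {x : ℚ_[p]} (hx : ‖x‖ < 1) : ‖x‖ ≤ ep p 1 := by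
  have h1 := (Padic.norm_le_pow_iff_norm_lt_pow_add_one x (-1)).2 (by simpa using hx)
  refine h1.trans (le_of_eq ?_)
  rw [← norm_p_pow 1, pow_one, Padic.norm_p, zpow_neg_one]

/-- profile functions -/
def Prof {k : ℕ} (h : Gd k n) (r : ℕ) (f : GG p n → 𝔽) : Prop :=
  (∀ g ∈ Pb p n k, f g = 0) ∧
  (∀ b, ‖b‖ ≤ ep p r → f (sk h * u0 h b) = 1) ∧ (∀ b, ¬ ‖b‖ ≤ ep p r → f (sk h * u0 h b) = 0) ∧
  (∀ b, ‖b‖ ≤ ep p r → ∀ y, f (y * u0 h b) = f y)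

def DEig (T : Subgroup (GG p n)) (η : T →* 𝔽ˣ) (ρ : Representation 𝔽 (GG p n) B) (A : Submodule 𝔽 B) (D : B →ₗ[𝔽] 𝔽) : Prop :=
  ∀ b ∈ Bb p n, ∀ t : T, (∀ i, ((t : GG p n) : MM p n) i i = (b : MM p n) i i) → ∀ a ∈ A, D (ρ b a) = (η t : 𝔽) * D a

lemma DEig.inv (hD : DEig T η ρ A D) : DInv ρ A D (Nb p n) := by
  intro v hv a ha
  rw [hD v (Nb_le hv) 1 (fun i => by simp [hv.2 i]) a ha]; simp

lemma DInv.V {k : ℕ} (hD : DInv ρ A D (Nb p n)) : DInv ρ A D (V p n k) := fun v hv a ha => hD v (V_le_Nb hv) a ha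

lemma spike_prof {k r : ℕ} (h : Gd k n) {f : GG p n → 𝔽} (hf : Spike T ψ r (sk h) f)
    (h0 : ∀ g ∈ Pb p n k, f g = 0) (h1 : ∀ b, 1 ≤ ‖b‖ → f (sk h * u0 h b) = 0) : Prof h r f := by
  refine ⟨h0, fun b hb => ?_, fun b hb => ?_, fun b hb y => hf.2.1.1 _ ((u0_Kc h).2 hb) y⟩
  · rw [hf.2.1.1 _ ((u0_Kc h).2 hb), hf.2.2]
  · by_cases hb1 : 1 ≤ ‖b‖
    · exact h1 b hb1
    by_contra hh
    have := entry_small h (u0_LB h b) (single_MB zero_le_one (not_le.1 hb1).le) (hf.2.1.2 _ hh)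
    rw [Matrix.single_apply_same] at this
    exact hb this

lemma Prof.raise (hT : IsT T) {k r r' : ℕ} (h : Gd k n) {f : GG p n → 𝔽} (hm : f ∈ PS T ψ) (hf : Prof h r f) (hr : r ≤ r') :
    ∃ f' ∈ PS T ψ, Prof h r' f' := by
  refine ⟨cut (Kc p n r') (dmk _ (sk h)) f, cut_mem hT le_rfl _ hm, fun g hg => ?_, fun b hb => ?_, fun b hb => ?_, fun b hb y => ?_⟩
  · by_cases hh : dmk (Kc p n r') g = dmk _ (sk h)
    · rw [cut_apply_of hh, hf.1 g hg]
    · exact cut_apply_ne hh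
  · rw [cut_apply_of (dmk_H _ ((u0_Kc h).2 hb)), hf.2.1 b (hb.trans (ep_anti hr))]
  · by_cases hh : dmk (Kc p n r') (sk h * u0 h b) = dmk _ (sk h)
    · rw [cut_apply_of hh]
      refine hf.2.2.1 b fun hb' => hb ?_
      have := entry_small h (u0_LB h b) (single_MB zero_le_one (hb'.trans (ep_le_one _))) hh
      rwa [Matrix.single_apply_same] at this
    · exact cut_apply_ne hh
  · exact cut_H _ ((u0_Kc h).2 hb) (hf.2.2.2 b (hb.trans (ep_anti hr))) y

variable [CharP 𝔽 p]

lemma compare (hT : IsT T) (E : IsExt T ψ ρ A φ) {k : ℕ} (h : Gd k n) (hD : DInv ρ A D (Nb p n)) {w : GG p n} (hw : w ∈ V p n k)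
    (hw1 : w ∈ Kc p n 1) {x x' : B} (hx : ρ w x - x ∈ A) (hx' : ρ w x' - x' ∈ A)
    (h0 : ∀ g ∈ Pb p n k, φ x g = φ x' g) (h1 : ∀ b, φ x (sk h * u0 h b) = φ x' (sk h * u0 h b)) :
    D (ρ w x - x) = D (ρ w x' - x') := by
  have e : ρ w (x - x') - (x - x') = (ρ w x - x) - (ρ w x' - x') := by rw [map_sub]; abel
  have := kill2 hT E h hw hw1 hD (x := x - x') (by rw [e]; exact sub_mem hx hx')
    (fun g hg => by rw [map_sub, Pi.sub_apply, h0 g hg, sub_self]) (fun b => by rw [map_sub, Pi.sub_apply, h1, sub_self])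
  rwa [e, map_sub, sub_eq_zero] at this

lemma Prof.mem (E : IsExt T ψ ρ A φ) {k r : ℕ} {h : Gd k n} {x : B} (hx : Prof h r (φ x)) {b : ℚ_[p]} (hb : ‖b‖ ≤ ep p r) :
    ρ (u0 h b) x - x ∈ A := E.fix.2 (hx.2.2.2 b hb)

lemma u0_pow {k : ℕ} (h : Gd k n) (b : ℚ_[p]) (m : ℕ) : (u0 h b : GG p n) ^ m = u0 h ((m : ℚ_[p]) * b) := by
  rw [u0, mkV_pow]; exact mkV_congr _ (by simp)

lemma sum_prof {k r : ℕ} {h : Gd k n} {f : GG p n → 𝔽} (hf : Prof h (r+1) f) (b : ℚ_[p]) :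
    (‖b‖ ≤ ep p r → ∑ i ∈ Finset.range p, f (sk h * u0 h (b + (i : ℚ_[p]) * (p:ℚ_[p])^r)) = 1) ∧
    (¬ ‖b‖ ≤ ep p r → ∑ i ∈ Finset.range p, f (sk h * u0 h (b + (i : ℚ_[p]) * (p:ℚ_[p])^r)) = 0) := by
  have hpr : (p:ℚ_[p])^r ≠ 0 := pow_ne_zero _ p_ne
  have key : ∀ i : ℕ, ‖(i : ℚ_[p]) * (p:ℚ_[p])^r‖ ≤ ep p r := fun i => by
    rw [norm_mul, norm_p_pow]
    exact mul_le_of_le_one_left (ep_pos r).le (by exact_mod_cast Padic.norm_int_le_one (p := p) (i : ℤ))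
  constructor
  · intro hb
    have hβ : ‖-b / (p:ℚ_[p])^r‖ ≤ 1 := by
      rw [norm_div, norm_neg, norm_p_pow]; exact div_le_one_of_le₀ hb (ep_pos r).le
    set β : ℤ_[p] := ⟨-b / (p:ℚ_[p])^r, hβ⟩ with hβd
    obtain ⟨m, ⟨hm, hm2⟩, huniq⟩ := PadicInt.existsUnique_mem_range β
    have hiff : ∀ i : ℕ, ‖b + (i : ℚ_[p]) * (p:ℚ_[p])^r‖ ≤ ep p (r+1) ↔ β - i ∈ IsLocalRing.maximalIdeal ℤ_[p] := by
      intro i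
      have e : b + (i : ℚ_[p]) * (p:ℚ_[p])^r = -((β - i : ℤ_[p]) : ℚ_[p]) * (p:ℚ_[p])^r := by
        rw [PadicInt.coe_sub, PadicInt.coe_natCast]
        simp only [hβd]
        field_simp; ring
      rw [e, norm_mul, norm_neg, norm_p_pow, ep_add, mul_comm (ep p r), mul_le_mul_iff_left₀ (ep_pos r),
        IsLocalRing.mem_maximalIdeal, PadicInt.mem_nonunits, PadicInt.norm_def]
      refine ⟨fun h1 => h1.trans_lt ?_, fun h1 => lt_one_ep h1⟩
      rw [ep, pow_one]
      exact inv_lt_one_of_one_lt₀ (by exact_mod_cast hp.out.one_lt)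
    rw [Finset.sum_eq_single_of_mem m (Finset.mem_range.2 hm)]
    · exact hf.2.1 _ ((hiff m).2 hm2)
    · intro i hi hne
      exact hf.2.2.1 _ fun hh => hne (huniq i ⟨Finset.mem_range.1 hi, (hiff i).1 hh⟩)
  · intro hb
    refine Finset.sum_eq_zero fun i _ => hf.2.2.1 _ fun hh => hb ?_
    have : b = (b + (i : ℚ_[p]) * (p:ℚ_[p])^r) + -(i * (p:ℚ_[p])^r) := by ring
    rw [this]
    refine (Padic.nonarchimedean _ _).trans (max_le (hh.trans (ep_anti (Nat.le_succ r))) ?_)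
    rw [norm_neg]; exact key i

lemma c_step (hT : IsT T) (E : IsExt T ψ ρ A φ) {k r : ℕ} (h : Gd k n) (hD : DInv ρ A D (Nb p n)) (hr : 1 ≤ r)
    {x x' : B} (hx : Prof h r (φ x)) (hx' : Prof h (r+1) (φ x')) :
    D (ρ (u0 h ((p:ℚ_[p])^r)) x - x) = D (ρ (u0 h ((p:ℚ_[p])^(r+1))) x' - x') := by
  set X : B := ∑ i ∈ Finset.range p, ρ (u0 h ((i : ℚ_[p]) * (p:ℚ_[p])^r)) x' with hX
  have e1 : ρ (u0 h ((p:ℚ_[p])^r)) X - X = ρ (u0 h ((p:ℚ_[p])^(r+1))) x' - x' := by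
    rw [hX, map_sum, ← Finset.sum_sub_distrib]
    have : ∀ i ∈ Finset.range p, ρ (u0 h ((p:ℚ_[p])^r)) (ρ (u0 h ((i : ℚ_[p]) * (p:ℚ_[p])^r)) x') - ρ (u0 h ((i : ℚ_[p]) * (p:ℚ_[p])^r)) x'
        = ρ (u0 h ((i+1 : ℕ) * (p:ℚ_[p])^r)) x' - ρ (u0 h ((i : ℚ_[p]) * (p:ℚ_[p])^r)) x' := by
      intro i _
      rw [← rho_mul, u0_add]; congr 4; push_cast; ring
    rw [Finset.sum_congr rfl this, Finset.sum_range_sub (fun i : ℕ => ρ (u0 h ((i : ℚ_[p]) * (p:ℚ_[p])^r)) x')]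
    congr 1
    · congr 3; rw [pow_succ]; ring
    · have : (u0 h ((0:ℕ) * (p:ℚ_[p])^r) : GG p n) = 1 := by
        rw [← u0_pow, pow_zero]
      rw [this, map_one]; rfl
  have hXv : ∀ g, φ X g = ∑ i ∈ Finset.range p, φ x' (g * u0 h ((i : ℚ_[p]) * (p:ℚ_[p])^r)) := by
    intro g
    rw [hX, map_sum, Finset.sum_apply]
    exact Finset.sum_congr rfl fun i _ => by rw [E.equi]; rfl
  rw [← e1]
  refine compare hT E h hD (u0_mem h _) ((u0_Kc h).2 ?_) (hx.mem E (norm_p_pow _).le) ?_ (fun g hg => ?_) (fun b => ?_)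
  · rw [norm_p_pow]; exact ep_anti hr
  · rw [e1]; exact hx'.mem E (norm_p_pow _).le
  · rw [hx.1 g hg, hXv]
    exact (Finset.sum_eq_zero fun i _ => hx'.1 _ (mul_mem hg (V_le_Pb (u0_mem h _)))).symm
  · rw [hXv]
    have : ∀ i ∈ Finset.range p, φ x' (sk h * u0 h b * u0 h ((i : ℚ_[p]) * (p:ℚ_[p])^r)) = φ x' (sk h * u0 h (b + (i : ℚ_[p]) * (p:ℚ_[p])^r)) := by
      intro i _; rw [mul_assoc, u0_add]
    rw [Finset.sum_congr rfl this]
    by_cases hb : ‖b‖ ≤ ep p r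
    · rw [hx.2.1 b hb, (sum_prof hx' b).1 hb]
    · rw [hx.2.2.1 b hb, (sum_prof hx' b).2 hb]

lemma c_indep_aux (hT : IsT T) (E : IsExt T ψ ρ A φ) {k : ℕ} (h : Gd k n) (hD : DInv ρ A D (Nb p n)) {r : ℕ} (hr : 1 ≤ r)
    {x : B} (hx : Prof h r (φ x)) (j : ℕ) : ∀ x', Prof h (r + j) (φ x') →
    D (ρ (u0 h ((p:ℚ_[p])^r)) x - x) = D (ρ (u0 h ((p:ℚ_[p])^(r+j))) x' - x') := by
  induction j with
  | zero =>
    intro x' hx'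
    refine compare hT E h hD (u0_mem h _) ((u0_Kc h).2 ?_) (hx.mem E (norm_p_pow _).le) (hx'.mem E (norm_p_pow _).le)
      (fun g hg => ?_) (fun b => ?_)
    · rw [norm_p_pow]; exact ep_anti hr
    · rw [hx.1 g hg, hx'.1 g hg]
    · by_cases hb : ‖b‖ ≤ ep p r
      · rw [hx.2.1 b hb, hx'.2.1 b hb]
      · rw [hx.2.2.1 b hb, hx'.2.2.1 b hb]
  | succ j ih =>
    intro x' hx'
    obtain ⟨f, hf, hfP⟩ := Prof.raise hT h (E.mem x) hx (Nat.le_add_right r j)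
    obtain ⟨x1, rfl⟩ := E.surj f hf
    rw [ih x1 hfP]
    exact c_step hT E h hD (by omega) hfP hx'

lemma c_indep (hT : IsT T) (E : IsExt T ψ ρ A φ) {k : ℕ} (h : Gd k n) (hD : DInv ρ A D (Nb p n)) {r r' : ℕ} (hr : 1 ≤ r) (hr' : 1 ≤ r')
    {x x' : B} (hx : Prof h r (φ x)) (hx' : Prof h r' (φ x')) :
    D (ρ (u0 h ((p:ℚ_[p])^r)) x - x) = D (ρ (u0 h ((p:ℚ_[p])^r')) x' - x') := by
  rcases le_total r r' with hle | hle
  · obtain ⟨j, rfl⟩ := Nat.exists_eq_add_of_le hle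
    exact c_indep_aux hT E h hD hr hx j x' hx'
  · obtain ⟨j, rfl⟩ := Nat.exists_eq_add_of_le hle
    exact (c_indep_aux hT E h hD hr' hx' j x hx).symm

lemma D_unit (E : IsExt T ψ ρ A φ) {k r : ℕ} (h : Gd k n) (hD : DInv ρ A D (Nb p n)) {x : B} (hx : Prof h r (φ x))
    {ε : ℚ_[p]} {m : ℕ} (hm : ‖ε - m‖ < 1) :
    D (ρ (u0 h ((p:ℚ_[p])^r * ε)) x - x) = (m : 𝔽) * D (ρ (u0 h ((p:ℚ_[p])^r)) x - x) := by
  set a := (ε - m) / p with ha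
  have hpp : ‖(p:ℚ_[p])‖ = ep p 1 := by rw [← norm_p_pow, pow_one]
  have ha1 : ‖a‖ ≤ 1 := by
    rw [ha, norm_div, hpp]; exact div_le_one_of_le₀ (lt_one_ep hm) (ep_pos 1).le
  have he : (u0 h ((p:ℚ_[p])^r * ε) : GG p n) = u0 h ((p:ℚ_[p])^r) ^ m * u0 h ((p:ℚ_[p])^r * a) ^ p := by
    rw [u0_pow, u0_pow, u0_add]; congr 1
    have := p_ne (p := p)
    rw [ha]; field_simp; ring
  have h1 := hx.mem E (norm_p_pow r).le
  have h2 := hx.mem E (b := (p:ℚ_[p])^r * a) (by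
    rw [norm_mul, norm_p_pow]; exact mul_le_of_le_one_right (ep_pos r).le ha1)
  have m1 := V_le_Nb (u0_mem h ((p:ℚ_[p])^r))
  have m2 := V_le_Nb (u0_mem h ((p:ℚ_[p])^r * a))
  rw [he, D_mul E hD (pow_mem m1 m) (D_pow E hD m2 h2 p).1, D_root E hD m2 h2, add_zero, (D_pow E hD m1 h1 m).2, smul_eq_mul]

lemma u0_dgl {k : ℕ} (h : Gd k n) (b : ℚ_[p]) (d : Fin n → ℚ_[p]ˣ) :
    (u0 h b * dgl d : GG p n) = dgl d * u0 h (b * ((d h.lo : ℚ_[p]) / (d h.hi : ℚ_[p]))) := by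
  ext i j
  rw [u0_mul_apply, Units.val_mul, dgl_val, u0_val, mul_add, mul_one, Matrix.add_apply, Matrix.diagonal_mul, Matrix.single_apply,
    Matrix.diagonal_apply, Matrix.diagonal_apply]
  congr 1
  have := (d h.hi).ne_zero
  by_cases h1 : i = h.hi
  · subst h1
    by_cases h2 : h.lo = j
    · subst h2; simp; field_simp
    · simp [h2]
  · simp [h1, Ne.symm h1]

lemma sk_dgl {k : ℕ} (h : Gd k n) (d : Fin n → ℚ_[p]ˣ) :
    (sk h * dgl d : GG p n) = dgl (fun i => d (Equiv.swap h.lo h.hi i)) * sk h := by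
  ext i j
  rw [sk, sw_mul, mul_sw, dgl_val, dgl_val, Matrix.diagonal_apply, Matrix.diagonal_apply]
  by_cases h1 : Equiv.swap h.lo h.hi i = j
  · subst h1; simp
  · rw [if_neg h1, if_neg]; rintro rfl; simp at h1

/-- eigenvalue relation -/
lemma rel (hT : IsT T) (E : IsExt T ψ ρ A φ) {k : ℕ} (h : Gd k n) (hD : DEig T η ρ A D) {r : ℕ} (hr : 1 ≤ r)
    {x : B} (hx : Prof h r (φ x)) (hne : D (ρ (u0 h ((p:ℚ_[p])^r)) x - x) ≠ 0)
    (d : Fin n → ℚ_[p]ˣ) (j : ℤ) (m : ℕ) (h1 : ‖(p:ℚ_[p])^j * ((d h.lo : ℚ_[p]) / (d h.hi : ℚ_[p]))‖ = 1)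
    (h2 : ‖(p:ℚ_[p])^j * ((d h.lo : ℚ_[p]) / (d h.hi : ℚ_[p])) - m‖ < 1) :
    (η ⟨dgl d, hT.dgl d⟩ : 𝔽) * m = ψ ⟨dgl (fun i => d (Equiv.swap h.lo h.hi i)), hT.dgl _⟩ := by
  set l : ℚ_[p] := (d h.lo : ℚ_[p]) / (d h.hi : ℚ_[p]) with hl
  set c := D (ρ (u0 h ((p:ℚ_[p])^r)) x - x) with hc
  set t : GG p n := dgl d with ht
  set s : 𝔽 := ((ψ ⟨dgl (fun i => d (Equiv.swap h.lo h.hi i)), hT.dgl _⟩ : 𝔽ˣ) : 𝔽) with hs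
  obtain ⟨r2, hr2⟩ : ∃ r2 : ℕ, (r2 : ℤ) = ((r + j.natAbs : ℕ) : ℤ) + j := ⟨(((r + j.natAbs : ℕ) : ℤ) + j).toNat, by omega⟩
  set r1 := r + j.natAbs with hr1
  have hrr2 : r ≤ r2 := by omega
  obtain ⟨f1, hf1, hP1⟩ := Prof.raise hT h (E.mem x) hx (show r ≤ r1 by omega)
  obtain ⟨x1, rfl⟩ := E.surj f1 hf1
  obtain ⟨f2, hf2, hP2⟩ := Prof.raise hT h (E.mem x) hx hrr2
  obtain ⟨x2, rfl⟩ := E.surj f2 hf2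
  have hDi := hD.inv
  have hc1 : D (ρ (u0 h ((p:ℚ_[p])^r1)) x1 - x1) = c := (c_indep hT E h hDi hr (by omega) hx hP1).symm
  have hc2 : D (ρ (u0 h ((p:ℚ_[p])^r2)) x2 - x2) = c := (c_indep hT E h hDi hr (by omega) hx hP2).symm
  have hpe : (p:ℚ_[p])^r2 * l = (p:ℚ_[p])^r1 * ((p:ℚ_[p])^j * l) := by
    rw [← mul_assoc, ← zpow_natCast, ← zpow_natCast, ← zpow_add₀ p_ne, hr2]
  have hnl : ep p r2 * ‖l‖ = ep p r1 := by
    rw [← norm_p_pow, ← norm_mul, hpe, norm_mul, h1, mul_one, norm_p_pow]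
  have hl0 : 0 < ‖l‖ := by
    rw [norm_pos_iff, hl]; exact div_ne_zero (d _).ne_zero (d _).ne_zero
  have hval : ∀ b, φ (ρ t x1) (sk h * u0 h b) = s * φ x1 (sk h * u0 h (b * l)) := by
    intro b
    rw [E.equi, act_apply, mul_assoc, ht, u0_dgl, ← mul_assoc, sk_dgl, mul_assoc]
    exact PS_B' hT (E.mem x1) (dgl_mem_Bb _) ⟨_, hT.dgl _⟩ (fun i => rfl) _
  have hconj : ρ (u0 h ((p:ℚ_[p])^r2)) (ρ t x1) - ρ t x1 = ρ t (ρ (u0 h ((p:ℚ_[p])^r1 * ((p:ℚ_[p])^j * l))) x1 - x1) := by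
    rw [← rho_mul, u0_dgl, rho_mul, ← map_sub, ← hl, hpe]
  have hA1 : ρ (u0 h ((p:ℚ_[p])^r1 * ((p:ℚ_[p])^j * l))) x1 - x1 ∈ A :=
    hP1.mem E (by rw [norm_mul, h1, mul_one, norm_p_pow])
  have key := compare hT E h hDi (w := u0 h ((p:ℚ_[p])^r2)) (x := ρ t x1) (x' := s • x2) (u0_mem h _)
    ((u0_Kc h).2 (by rw [norm_p_pow]; exact ep_anti (hr.trans hrr2)))
    (by rw [hconj]; exact E.stab _ _ hA1)
    (by rw [map_smul, ← smul_sub]; exact Submodule.smul_mem _ _ (hP2.mem E (norm_p_pow _).le))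
    (fun g hg => by
      rw [E.equi, act_apply, hP1.1 _ (mul_mem hg (Bb_le k (dgl_mem_Bb d))), map_smul, Pi.smul_apply, hP2.1 g hg, smul_zero])
    (fun b => by
      rw [hval, map_smul, Pi.smul_apply, smul_eq_mul]
      congr 1
      have hiff : ‖b * l‖ ≤ ep p r1 ↔ ‖b‖ ≤ ep p r2 := by
        rw [norm_mul, ← hnl, mul_le_mul_iff_left₀ hl0]
      by_cases hb : ‖b‖ ≤ ep p r2
      · rw [hP2.2.1 b hb, hP1.2.1 _ (hiff.2 hb)]
      · rw [hP2.2.2.1 b hb, hP1.2.2.1 _ (fun hh => hb (hiff.1 hh))])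
  rw [hconj, hD t (dgl_mem_Bb d) ⟨t, hT.dgl d⟩ (fun i => rfl) _ hA1, D_unit E h hDi hP1 h2, hc1, map_smul, ← smul_sub, map_smul, hc2,
    smul_eq_mul, ← mul_assoc] at key
  exact mul_right_cancel₀ hne key

lemma lemmaC (hT : IsT T) (E : IsExt T ψ ρ A φ) {k : ℕ} (h : Gd k n) (hD : DEig T η ρ A D) {y : B} (hyA : y ∈ A)
    (hy : y ∈ IV ρ k ⊤) (hDy : D y ≠ 0) :
    (∀ r, 1 ≤ r → ∀ x, Prof h r (φ x) → D (ρ (u0 h ((p:ℚ_[p])^r)) x - x) ≠ 0) ∧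
    ∀ (d : Fin n → ℚ_[p]ˣ) (j : ℤ) (m : ℕ), ‖(p:ℚ_[p])^j * ((d h.lo : ℚ_[p]) / (d h.hi : ℚ_[p]))‖ = 1 →
      ‖(p:ℚ_[p])^j * ((d h.lo : ℚ_[p]) / (d h.hi : ℚ_[p])) - m‖ < 1 →
      (η ⟨dgl d, hT.dgl d⟩ : 𝔽) * m = ψ ⟨dgl (fun i => d (Equiv.swap h.lo h.hi i)), hT.dgl _⟩ := by
  obtain ⟨N, r, hr, ι, _, κ, et, c, hL, hmem, hA, hsp, hOm, hoo, hk1⟩ := lemmaN hT E h hyA hy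
  have hDi := hD.inv
  have h0 := IV_D hDi.V hmem
  rw [map_sub, hD _ (zz_B k N) ⟨zz p n k N, hT.dgl _⟩ (fun i => rfl) y hyA, sub_eq_zero, map_sum] at h0
  have hs : ∑ o, D (c o • (ρ (wk h r (κ o)) (et o) - et o)) ≠ 0 := by
    rw [← h0]; exact mul_ne_zero (Units.ne_zero _) hDy
  obtain ⟨o, -, ho⟩ := Finset.exists_ne_zero_of_sum_ne_zero hs
  rw [map_smul] at ho
  have ho' := right_ne_zero_of_smul ho
  have hκ : κ o = 1 := by
    refine (hk1 o).resolve_right fun hb => ho' ?_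
    exact kill2 hT E h (wk_V h r (hL o)) (Kc_anti hr (wk_Kc h r (hL o))) hDi (hA o) (fun g hg => hOm o g (Om_Pb hg)) hb
  have hP : Prof h r (φ (et o)) := by
    have h1 := hsp o
    rw [hκ, act_one] at h1
    refine spike_prof h h1 (fun g hg => hOm o g (Om_Pb hg)) (fun b hb => hOm o _ ?_)
    have := sk_Om h hb (IsL_one k)
    rwa [mul_one] at this
  have hne : D (ρ (u0 h ((p:ℚ_[p])^r)) (et o) - et o) ≠ 0 := by
    have : wk h r (κ o) = u0 h ((p:ℚ_[p])^r) := by rw [hκ, wk]; simp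
    rwa [this] at ho'
  refine ⟨fun r' hr' x hx => ?_, fun d j m h1 h2 => rel hT E h hD hr hP hne d j m h1 h2⟩
  rw [← c_indep hT E h hDi hr hr' hP hx]
  exact hne

lemma lemma4 (hT : IsT T) (E : IsExt T ψ ρ A φ) {k : ℕ} (h : Gd k n) (hDi : DInv ρ A D (Nb p n))
    (hne : ∀ r, 1 ≤ r → ∀ x, Prof h r (φ x) → D (ρ (u0 h ((p:ℚ_[p])^r)) x - x) ≠ 0) {y : B} (hyA : y ∈ A)
    (hy : y ∈ IV ρ k ⊤) (hDy : ∀ g, D (ρ g y) = 0) : y ∈ IV ρ k A := by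
  obtain ⟨N, r, hr, ι, _, κ, et, c, hL, hmem, hA, hsp, hOm, hoo, -⟩ := lemmaN hT E h hyA hy
  have hc : ∀ o', c o' = 0 := by
    intro o'
    have h0 := IV_D hDi.V (IV_stab E.stab (hL o').1 hmem)
    rw [map_sub, map_sub, ← rho_mul, hDy, zero_sub, neg_eq_zero, map_sum, map_sum, Finset.sum_eq_single o'] at h0
    · rw [map_smul, map_smul, IV_conj] at h0
      refine (smul_eq_zero.1 h0).resolve_right ?_
      have e : κ o' * wk h r (κ o') * (κ o')⁻¹ = u0 h ((p:ℚ_[p])^r) := by rw [wk]; group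
      rw [e]
      refine hne r hr _ ?_
      rw [E.equi]
      refine spike_prof h (hsp o') (fun g hg => hOm o' _ (Om_Pb (mul_mem hg (hL o').1))) (fun b hb => hOm o' _ (sk_Om h hb (hL o')))
    · intro o _ hoo'
      rw [map_smul, map_smul, IV_conj]
      have : D (ρ (κ o' * wk h r (κ o) * (κ o')⁻¹) (ρ (κ o') (et o)) - ρ (κ o') (et o)) = 0 := by
        refine kill2 hT E h (V_conj (hL o').1 (wk_V h r (hL o))) (Kc_conj (hL o').2.1 (Kc_anti hr (wk_Kc h r (hL o)))) hDi ?_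
          (fun g hg => ?_) (fun b => ?_)
        · rw [← IV_conj]; exact E.stab _ _ (hA o)
        · rw [E.equi]; exact hOm o _ (Om_Pb (mul_mem hg (hL o').1))
        · rw [E.equi]; exact hoo o o' hoo' b
      rw [this, smul_zero]
    · intro hh; exact absurd (Finset.mem_univ _) hh
  have : ρ (zz p n k N) y ∈ IV ρ k A := by
    simpa [hc] using hmem
  have h2 := IV_stab E.stab (inv_mem (zz_P (p := p) (n := n) k k N)) this
  rwa [← rho_mul, inv_mul_cancel, map_one] at h2

end J
end HX

namespace HX
set_option linter.unusedSectionVars false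
set_option linter.unusedSimpArgs false
set_option linter.unusedVariables false
section K
variable {p n : ℕ} [hp : Fact p.Prime]

noncomputable def zc (p n : ℕ) [Fact p.Prime] (k : ℕ) (a : ℚ_[p]ˣ) : GG p n := dgl fun i => if i.val < k then a else 1

lemma dgl_mul (d d' : Fin n → ℚ_[p]ˣ) : (dgl d * dgl d' : GG p n) = dgl (fun i => d i * d' i) := by
  ext1
  rw [Units.val_mul, dgl_val, dgl_val, dgl_val, Matrix.diagonal_mul_diagonal]; simp

lemma zc_inv (k : ℕ) (a : ℚ_[p]ˣ) : (zc p n k a)⁻¹ = zc p n k a⁻¹ := by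
  rw [inv_eq_iff_mul_eq_one, zc, zc, dgl_mul]
  ext i j
  rw [dgl_val, Units.val_one, Matrix.diagonal_apply, Matrix.one_apply]
  split_ifs <;> simp

lemma zc_comm (k : ℕ) (a : ℚ_[p]ˣ) {b : GG p n} (hb : b ∈ Pb p n k) : zc p n k a * b * (zc p n k a)⁻¹ * b⁻¹ ∈ V p n k := by
  set z := zc p n k a with hz
  set X : MM p n := ((z * b * z⁻¹ : GG p n) : MM p n) - b with hX
  have hXL : LB k X := by
    intro i j hij
    rw [hX, hz, zc_inv, Units.val_mul, Units.val_mul, zc, zc, dgl_val, dgl_val, Matrix.sub_apply, Matrix.mul_diagonal, Matrix.diagonal_mul]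
    by_cases hi : i.val < k
    · by_cases hj : j.val < k
      · simp only [hi, hj, if_true]
        rw [mul_right_comm, Units.mul_inv, one_mul, sub_self]
      · rw [hb i j hi (by omega)]; simp
    · have : ¬ j.val < k := by omega
      simp [hi, this]
  refine ⟨X * ((b⁻¹ : GG p n) : MM p n), LB_UZ_mul (inv_mem hb) hXL, ?_⟩
  ext1
  rw [mkV_val, Units.val_mul, hX, sub_mul, gmul_inv]
  abel

variable {𝔽 : Type*} [Field 𝔽] {T : Subgroup (GG p n)} {ψ η : T →* 𝔽ˣ}

lemma T_dgl (hT : IsT T) (t : T) : ∃ d : Fin n → ℚ_[p]ˣ, t = ⟨dgl d, hT.dgl d⟩ := by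
  refine ⟨fun i => Units.mk0 _ (Bb_diag_ne (hT.le_Bb t.2) i), ?_⟩
  ext i j
  rw [dgl_val, Matrix.diagonal_apply]
  split_ifs with h
  · subst h; simp
  · exact (hT _).1 t.2 i j h

lemma exists_zc (hT : IsT T) (hne : η ≠ ψ) : ∃ k, 1 ≤ k ∧ k ≤ n ∧ ∃ a, η ⟨zc p n k a, hT.dgl _⟩ ≠ ψ ⟨zc p n k a, hT.dgl _⟩ := by
  by_contra hcon
  push Not at hcon
  refine hne (MonoidHom.ext fun t => ?_)
  obtain ⟨d, rfl⟩ := T_dgl hT t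
  have key : ∀ m ≤ n, ∀ d : Fin n → ℚ_[p]ˣ, (∀ i : Fin n, m ≤ i.val → d i = 1) →
      η ⟨dgl d, hT.dgl d⟩ = ψ ⟨dgl d, hT.dgl d⟩ := by
    intro m
    induction m with
    | zero =>
      intro _ d hd
      have : (⟨dgl d, hT.dgl d⟩ : T) = 1 := by
        ext i j
        rw [dgl_val, OneMemClass.coe_one, Units.val_one, Matrix.diagonal_apply, Matrix.one_apply]
        split_ifs <;> simp [hd]
      rw [this, map_one, map_one]
    | succ m ih =>
      intro hm d hd
      set e := d ⟨m, hm⟩ with he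
      set d' : Fin n → ℚ_[p]ˣ := fun i => if i.val < m + 1 then d i * e⁻¹ else 1 with hd'
      have h1 : (⟨dgl d, hT.dgl d⟩ : T) = ⟨dgl d', hT.dgl d'⟩ * ⟨zc p n (m+1) e, hT.dgl _⟩ := by
        ext1
        change dgl d = dgl d' * zc p n (m+1) e
        rw [zc, dgl_mul]
        congr 1; ext1 i
        simp only [hd']
        split_ifs with hi
        · simp
        · rw [hd i (by omega)]; simp
      rw [h1, map_mul, map_mul, hcon (m+1) (by omega) hm e, ih (by omega) d' ?_]
      intro i hi
      simp only [hd']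
      split_ifs with hi2
      · have : i = ⟨m, hm⟩ := Fin.ext (by simp; omega)
        rw [this, ← he]; simp
      · rfl
  exact key n le_rfl d (fun i hi => absurd i.2 (by omega))

variable {B : Type*} [AddCommGroup B] [Module 𝔽 B] {ρ : Representation 𝔽 (GG p n) B} {A A1 : Submodule 𝔽 B}
  {φ : B →ₗ[𝔽] (GG p n → 𝔽)} {D : B →ₗ[𝔽] 𝔽}

/-- `D` realizes `A/A1` as the principal series -/
structure Rea (T : Subgroup (GG p n)) (η : T →* 𝔽ˣ) (ρ : Representation 𝔽 (GG p n) B) (A A1 : Submodule 𝔽 B) (D : B →ₗ[𝔽] 𝔽) : Prop where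
  stab : ∀ g, ∀ x ∈ A, ρ g x ∈ A
  eig : DEig T η ρ A D
  mem : ∀ a ∈ A, (fun g => D (ρ g a)) ∈ PS T η
  sur : ∀ f ∈ PS T η, ∃ a ∈ A, ∀ g, D (ρ g a) = f g
  ker : ∀ a ∈ A, (∀ g, D (ρ g a) = 0) ↔ a ∈ A1
  le : A1 ≤ A

lemma Rea.congr (R : Rea T η ρ A A1 D) {D' : B →ₗ[𝔽] 𝔽} (h : ∀ a ∈ A, D' a = D a) : Rea T η ρ A A1 D' where
  stab := R.stab
  eig := fun b hb t ht a ha => by rw [h _ (R.stab _ _ ha), h _ ha]; exact R.eig b hb t ht a ha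
  mem := fun a ha => by
    have : (fun g => D' (ρ g a)) = fun g => D (ρ g a) := funext fun g => h _ (R.stab _ _ ha)
    rw [this]; exact R.mem a ha
  sur := fun f hf => by
    obtain ⟨a, ha, h1⟩ := R.sur f hf
    exact ⟨a, ha, fun g => by rw [h _ (R.stab _ _ ha), h1]⟩
  ker := fun a ha => by
    rw [← R.ker a ha]
    exact forall_congr' fun g => by rw [h _ (R.stab _ _ ha)]
  le := R.le

lemma split (R : Rea T η ρ A A1 D) (hsm : ∀ x : B, IsOpen {g : GG p n | ρ g x = x}) (hT : IsT T) (hD : DEig T η ρ ⊤ D) :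
    ∃ C : Submodule 𝔽 B, (∀ g, ∀ x ∈ C, ρ g x ∈ C) ∧ C ⊓ A = A1 ∧ C ⊔ A = ⊤ := by
  let C : Submodule 𝔽 B := ⨅ g : GG p n, LinearMap.ker (D ∘ₗ ρ g)
  have hC : ∀ x, x ∈ C ↔ ∀ g, D (ρ g x) = 0 := fun x => by
    simp only [C, Submodule.mem_iInf, LinearMap.mem_ker, LinearMap.comp_apply]
  refine ⟨C, fun g x hx => (hC _).2 fun g' => ?_, ?_, ?_⟩
  · rw [← rho_mul]; exact (hC x).1 hx _
  · ext x
    rw [Submodule.mem_inf, hC]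
    exact ⟨fun ⟨h1, h2⟩ => (R.ker x h2).1 h1, fun h => ⟨(R.ker x (R.le h)).2 h, R.le h⟩⟩
  · rw [eq_top_iff]
    intro x _
    have hf : (fun g => D (ρ g x)) ∈ PS T η := by
      refine ⟨?_, fun t g => ?_, fun u hu g => ?_⟩
      · obtain ⟨s, -, hs⟩ := Kc_basis (hsm x) (by simp)
        refine Inv.loc (s := s) fun k hk g => ?_
        have : ρ k x = x := hs hk
        simp only [rho_mul, this]
      · simp only [rho_mul]
        exact hD _ (hT.le_Bb t.2) t (fun i => rfl) _ trivial
      · simp only [rho_mul]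
        exact hD.inv u hu _ trivial
    obtain ⟨a, ha, h1⟩ := R.sur _ hf
    rw [← sub_add_cancel x a]
    refine Submodule.add_mem_sup ((hC _).2 fun g => ?_) ha
    rw [map_sub, map_sub, h1, sub_self]

lemma ext_kill {W : Submodule 𝔽 B} (hk : ∀ x ∈ A, x ∈ W → D x = 0) :
    ∃ D' : B →ₗ[𝔽] 𝔽, (∀ a ∈ A, D' a = D a) ∧ ∀ w ∈ W, D' w = 0 := by
  let g : A →ₗ[𝔽] (B ⧸ W) := W.mkQ ∘ₗ A.subtype
  have h1 : (D ∘ₗ A.subtype) ∈ LinearMap.range g.dualMap := by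
    rw [LinearMap.range_dualMap_eq_dualAnnihilator_ker, Submodule.mem_dualAnnihilator]
    intro x hx
    refine hk _ x.2 ?_
    have : W.mkQ (x : B) = 0 := hx
    rwa [Submodule.mkQ_apply, Submodule.Quotient.mk_eq_zero] at this
  obtain ⟨f, hf⟩ := h1
  refine ⟨f ∘ₗ W.mkQ, fun a ha => ?_, fun w hw => ?_⟩
  · exact LinearMap.congr_fun hf ⟨a, ha⟩
  · rw [LinearMap.comp_apply, Submodule.mkQ_apply, (Submodule.Quotient.mk_eq_zero W).2 hw, map_zero]

variable [CharP 𝔽 p]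

lemma lift_lemma1 (hT : IsT T) (E : IsExt T ψ ρ A φ) (k : ℕ) {x : B} (hx : ∀ g ∈ Pb p n k, φ x g = 0) : x ∈ IV ρ k ⊤ ⊔ A := by
  have h1 := lemma1 hT k (E.mem x) hx
  have h2 : φ x ∈ (IV ρ k ⊤).map φ := by
    refine Submodule.span_le.2 ?_ h1
    rintro _ ⟨v, hv, g, hg, rfl⟩
    obtain ⟨a, rfl⟩ := E.surj g hg
    exact ⟨ρ v a - a, IV_mem hv trivial, by rw [map_sub, E.equi]⟩
  obtain ⟨w, hw, e⟩ := h2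
  rw [← add_sub_cancel w x]
  exact Submodule.add_mem_sup hw ((E.sub).2 e.symm)

lemma step2 (hT : IsT T) (E : IsExt T ψ ρ A φ) (R : Rea T η ρ A A1 D) (hsm : ∀ x : B, IsOpen {g : GG p n | ρ g x = x}) (hne : η ≠ ψ)
    (hns : ¬ ∃ C : Submodule 𝔽 B, (∀ g, ∀ x ∈ C, ρ g x ∈ C) ∧ C ⊓ A = A1 ∧ C ⊔ A = ⊤) :
    ∃ k, Gd k n ∧ ∃ y ∈ A, y ∈ IV ρ k ⊤ ∧ D y ≠ 0 := by
  obtain ⟨k, hk1, hkn, a, ha⟩ := exists_zc hT hne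
  by_contra hcon
  have hcon2 : ∀ y ∈ A, y ∈ IV ρ k ⊤ → D y = 0 := by
    intro y hyA hy
    by_contra hDy
    rcases Nat.lt_or_ge k n with hlt | hge
    · exact hcon ⟨k, ⟨hk1, hlt⟩, y, hyA, hy, hDy⟩
    · have h0 : IV ρ k ⊤ ≤ (⊥ : Submodule 𝔽 B) := by
        rw [IV, Submodule.span_le]
        rintro _ ⟨_, ⟨X, hX, rfl⟩, x, -, rfl⟩
        have : mkV k X hX = 1 := by
          ext i j
          rw [mkV_val, Units.val_one, Matrix.add_apply, hX i j (fun h => absurd i.2 (by omega)), add_zero]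
        simp [this]
      have := h0 hy
      rw [Submodule.mem_bot] at this
      rw [this, map_zero] at hDy
      exact hDy rfl
  obtain ⟨D1, hD1A, hD1W⟩ := ext_kill hcon2
  set z := zc p n k a with hz
  have hzB : z ∈ Bb p n := dgl_mem_Bb _
  set tz : T := ⟨z, hT.dgl _⟩ with htz
  have hV : ∀ v ∈ V p n k, ∀ x, D1 (ρ v x) = D1 x := fun v hv x => by
    rw [← sub_eq_zero, ← map_sub]; exact hD1W _ (IV_mem hv trivial)
  set e : 𝔽 := (η tz : 𝔽) - ψ tz with he
  have he0 : e ≠ 0 := sub_ne_zero.2 fun h => ha (Units.ext h)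
  let D2 : B →ₗ[𝔽] 𝔽 := e⁻¹ • (D1 ∘ₗ ρ z - (ψ tz : 𝔽) • D1)
  have hD2 : ∀ x, D2 x = e⁻¹ * (D1 (ρ z x - (ψ tz : 𝔽) • x)) := fun x => by
    simp [D2]
  have hD2A : ∀ x ∈ A, D2 x = D x := by
    intro x hx
    rw [hD2, map_sub, map_smul, hD1A _ (R.stab _ _ hx), hD1A _ hx, R.eig z hzB tz (fun i => rfl) x hx, smul_eq_mul, ← sub_mul, ← he,
      inv_mul_cancel_left₀ he0]
  have hX : ∀ x, ρ z x - (ψ tz : 𝔽) • x ∈ IV ρ k ⊤ ⊔ A := by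
    intro x
    refine lift_lemma1 hT E k fun g hg => ?_
    rw [map_sub, map_smul, Pi.sub_apply, Pi.smul_apply, E.equi, act_apply, smul_eq_mul, sub_eq_zero]
    have hv := zc_comm (n := n) k a⁻¹ hg
    rw [← zc_inv, inv_inv] at hv
    have e1 : g * z = z * (z⁻¹ * g * z * g⁻¹) * g := by group
    rw [e1]
    refine PS_B' hT (E.mem x) (mul_mem hzB (V_le_Bb hv)) tz (fun i => ?_) g
    rw [Bb_mul_diag hzB (V_le_Bb hv), (V_le_lowerUnipotent hv).2, mul_one]
  refine hns (split (R.congr hD2A) hsm hT fun b hb t ht x _ => ?_)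
  have e1 : D1 (ρ z (ρ b x)) = D1 (ρ b (ρ z x)) := by
    have := hV _ (zc_comm k a (Bb_le k hb)) (ρ b (ρ z x))
    rw [← hz] at this
    rw [← this, ← rho_mul, ← rho_mul, ← rho_mul]
    congr 3; group
  obtain ⟨w, hw, a', ha', hwa⟩ := Submodule.mem_sup.1 (hX x)
  have e2 : D1 (ρ z (ρ b x) - (ψ tz : 𝔽) • ρ b x) = D1 (ρ b (ρ z x - (ψ tz : 𝔽) • x)) := by
    rw [map_sub, e1, map_sub (ρ b), map_sub, map_smul, map_smul, map_smul]
  rw [hD2, hD2, e2, ← hwa, map_add, map_add, map_add, hD1W _ (IV_stab (A := ⊤) (fun _ _ _ => trivial) (Bb_le k hb) hw), hD1W w hw, zero_add, zero_add,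
    hD1A _ (R.stab _ _ ha'), hD1A _ ha', R.eig b hb t ht a' ha']
  ring

/-- step 3 -/
lemma step3 (hT : IsT T) (R : Rea T η ρ A A1 D) (hirr : principalSeriesIrreducible p n 𝔽 T η) {k : ℕ} {y : B} (hyA : y ∈ A)
    (hy : y ∈ IV ρ k ⊤) (hDy : D y ≠ 0) : ∀ x ∈ A, ∃ w ∈ A, w ∈ IV ρ k ⊤ ∧ x - w ∈ A1 := by
  classical
  let F : B →ₗ[𝔽] (GG p n → 𝔽) := LinearMap.pi fun g => D ∘ₗ ρ g
  have hF : ∀ x g, F x g = D (ρ g x) := fun x g => rfl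
  have hFact : ∀ g x, F (ρ g x) = act g (F x) := fun g x => by
    ext g'; rw [act_apply, hF, hF, rho_mul]
  have hFmem : ∀ a ∈ A, F a ∈ PS T η := R.mem
  let S : Submodule 𝔽 (GG p n → 𝔽) := (A ⊓ IV ρ k ⊤).map F
  have hSP : S ≤ PS T η := by
    rintro _ ⟨w, hw, rfl⟩; exact hFmem _ hw.1
  have hSstab : ∀ q ∈ Pb p n k, ∀ f ∈ S, act q f ∈ S := by
    rintro q hq _ ⟨w, hw, rfl⟩
    exact ⟨ρ q w, ⟨R.stab _ _ hw.1, IV_stab (A := ⊤) (fun _ _ _ => trivial) hq hw.2⟩, hFact _ _⟩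
  have hS0 : ∀ f ∈ PS T η, (∀ x ∈ Pb p n k, f x = 0) → f ∈ S := by
    intro f hf h0
    refine Submodule.span_le.2 ?_ (lemma1 hT k hf h0)
    rintro _ ⟨v, hv, g, hg, rfl⟩
    obtain ⟨a, ha, e⟩ := R.sur g hg
    have e' : F a = g := funext e
    exact ⟨ρ v a - a, ⟨sub_mem (R.stab _ _ ha) ha, IV_mem hv trivial⟩, by rw [map_sub, hFact, e']⟩
  have hS1 : ∀ f ∈ PS T η, ∀ f' ∈ S, (∀ x ∈ Pb p n k, f x = f' x) → f ∈ S := by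
    intro f hf f' hf' h
    have := hS0 (f - f') (sub_mem hf (hSP hf')) (fun x hx => by rw [Pi.sub_apply, h x hx, sub_self])
    rw [← sub_add_cancel f f']; exact add_mem this hf'
  set f0 := F y with hf0
  have hf0S : f0 ∈ S := ⟨y, ⟨hyA, hy⟩, rfl⟩
  obtain ⟨s, hs, hinv⟩ := PS_smooth hT (hSP hf0S)
  set Q : Set (GG p n) := {x | ∃ q ∈ Pb p n k, ∃ κ ∈ Kc p n s, x = q * κ} with hQ
  have hQK : ∀ x, ∀ κ ∈ Kc p n s, (x * κ ∈ Q ↔ x ∈ Q) := by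
    intro x κ hκ
    constructor
    · rintro ⟨q, hq, κ', hκ', e⟩
      exact ⟨q, hq, κ' * κ⁻¹, mul_mem hκ' (inv_mem hκ), by rw [← mul_assoc, ← e]; group⟩
    · rintro ⟨q, hq, κ', hκ', rfl⟩
      exact ⟨q, hq, κ' * κ, mul_mem hκ' hκ, by group⟩
  set f1 := Q.indicator f0 with hf1
  have hQP : ∀ x ∈ Pb p n k, x ∈ Q := fun x hx => ⟨x, hx, 1, one_mem _, by simp⟩
  have hf1m : f1 ∈ PS T η := by
    refine PS_cut (s := s) hT (hSP hf0S) ?_ (fun κ hκ x hx => (hQK x κ hκ).2 hx)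
    rintro b hb _ ⟨q, hq, κ', hκ', rfl⟩
    exact ⟨b * q, mul_mem (Bb_le k hb) hq, κ', hκ', by group⟩
  have hf1inv : ∀ x, ∀ κ ∈ Kc p n s, f1 (x * κ) = f1 x := by
    intro x κ hκ
    simp only [hf1, Set.indicator, hQK x κ hκ, hinv κ hκ x]
  have hf1S : f1 ∈ S := hS1 f1 hf1m f0 hf0S fun x hx => Set.indicator_of_mem (hQP x hx) _
  let U : Submodule 𝔽 (GG p n → 𝔽) := ⨅ g : GG p n, S.comap (act g)
  have hU : ∀ f, f ∈ U ↔ ∀ g, act g f ∈ S := fun f => by simp [U, Submodule.mem_iInf]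
  have hUS : U ≤ S := fun f hf => by have := (hU f).1 hf 1; rwa [act_one] at this
  have hf1U : f1 ∈ U := by
    rw [hU]
    intro g
    by_cases hg : g ∈ Q
    · obtain ⟨q', hq', κ, hκ, rfl⟩ := hg
      refine hS1 _ (PS_act hf1m _) _ (hSstab q' hq' _ hf1S) fun x hx => ?_
      rw [act_apply, act_apply, ← mul_assoc, hf1inv _ κ hκ]
    · refine hS0 _ (PS_act hf1m _) fun x hx => ?_
      rw [act_apply, hf1]
      refine Set.indicator_of_notMem ?_ _
      rintro ⟨q, hq, κ, hκ, e⟩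
      exact hg ⟨x⁻¹ * q, mul_mem (inv_mem hx) hq, κ, hκ, by rw [mul_assoc, ← e]; group⟩
  have hUne : U ≠ ⊥ := by
    intro hh
    rw [hh, Submodule.mem_bot] at hf1U
    have h1 : f1 1 = D y := by
      rw [hf1, Set.indicator_of_mem (hQP 1 (one_mem _)), hf0, hF, map_one]; rfl
    rw [hf1U] at h1
    exact hDy h1.symm
  have hUeq := (hirr.2 U (fun f hf => hSP (hUS hf)) (fun g f hf => by
    rw [hU] at hf ⊢
    intro g'
    have := hf (g' * g)
    rwa [act_mul] at this)).resolve_left hUne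
  intro x hx
  have hFx : F x ∈ U := by
    have : F x ∈ principalSeries p n 𝔽 T η := hFmem x hx
    rw [← hUeq] at this; exact this
  obtain ⟨w, hw, e⟩ := hUS hFx
  refine ⟨w, hw.1, hw.2, (R.ker _ (sub_mem hx hw.1)).1 fun g => ?_⟩
  rw [map_sub, map_sub, sub_eq_zero]
  exact (congr_fun e g).symm

/-- step 5 -/
lemma step5 (hT : IsT T) (R : Rea T η ρ A A1 D) (hsm : ∀ x : B, IsOpen {g : GG p n | ρ g x = x}) {W : Submodule 𝔽 B}
    (hW : ∀ b ∈ Bb p n, ∀ w ∈ W, ρ b w ∈ W) (hk : ∀ x ∈ A, x ∈ W → D x = 0) (hWA : ∀ x, ∃ w ∈ W, x - w ∈ A) :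
    ∃ C : Submodule 𝔽 B, (∀ g, ∀ x ∈ C, ρ g x ∈ C) ∧ C ⊓ A = A1 ∧ C ⊔ A = ⊤ := by
  obtain ⟨D1, h1, h2⟩ := ext_kill hk
  refine split (R.congr h1) hsm hT fun b hb t ht x _ => ?_
  obtain ⟨w, hw, ha⟩ := hWA x
  have e : x = (x - w) + w := by abel
  rw [e, map_add, map_add, map_add, h2 _ (hW b hb w hw), h2 w hw, add_zero, add_zero, h1 _ (R.stab _ _ ha), h1 _ ha, R.eig b hb t ht _ ha]

end K
end HX

namespace HX
set_option linter.unusedSectionVars false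
set_option linter.unusedSimpArgs false
set_option linter.unusedVariables false
section L
variable {p n : ℕ} [hp : Fact p.Prime]
variable {𝔽 : Type*} [Field 𝔽] {T : Subgroup (GG p n)} {ψ η : T →* 𝔽ˣ}
variable {B : Type*} [AddCommGroup B] [Module 𝔽 B] {ρ : Representation 𝔽 (GG p n) B} {A A1 : Submodule 𝔽 B}

lemma mkRea (hT : IsT T) (hst : ∀ g, ∀ x ∈ A, ρ g x ∈ A) (le : A1 ≤ A) (f : A →ₗ[𝔽] (GG p n → 𝔽))
    (hr : Set.range f = principalSeries p n 𝔽 T η) (hk : ∀ x : A, f x = 0 ↔ (x : B) ∈ A1)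
    (he : ∀ (g : GG p n) (x : A), f ⟨ρ g ↑x, hst g ↑x x.2⟩ = fun y => f x (y * g)) :
    ∃ D : B →ₗ[𝔽] 𝔽, Rea T η ρ A A1 D := by
  obtain ⟨D, hD⟩ := (LinearMap.proj (1 : GG p n) ∘ₗ f : A →ₗ[𝔽] 𝔽).exists_extend
  have hD1 : ∀ (a : B) (ha : a ∈ A), D a = f ⟨a, ha⟩ 1 := fun a ha => LinearMap.congr_fun hD ⟨a, ha⟩
  have hD2 : ∀ (a : B) (ha : a ∈ A) (g : GG p n), D (ρ g a) = f ⟨a, ha⟩ g := fun a ha g => by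
    rw [hD1 _ (hst g a ha), he g ⟨a, ha⟩]; change f ⟨a, ha⟩ (1 * g) = _; rw [one_mul]
  have hmem : ∀ x, f x ∈ PS T η := fun x => by
    have : f x ∈ principalSeries p n 𝔽 T η := hr ▸ Set.mem_range_self x
    exact this
  refine ⟨D, hst, fun b hb t ht a ha => ?_, fun a ha => ?_, fun q hq => ?_, fun a ha => ?_, le⟩
  · rw [hD2 a ha, hD1 a ha]
    have := PS_B' hT (hmem ⟨a, ha⟩) hb t ht 1
    rwa [mul_one] at this
  · have : (fun g => D (ρ g a)) = f ⟨a, ha⟩ := funext fun g => hD2 a ha g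
    rw [this]; exact hmem _
  · have hq' : q ∈ principalSeries p n 𝔽 T η := hq
    rw [← hr] at hq'
    obtain ⟨⟨a, ha⟩, rfl⟩ := hq'
    exact ⟨a, ha, hD2 a ha⟩
  · rw [← hk ⟨a, ha⟩, funext_iff]
    exact forall_congr' fun g => by rw [hD2 a ha]; rfl

lemma mkExt (hst : ∀ g, ∀ x ∈ A, ρ g x ∈ A) (f : B →ₗ[𝔽] (GG p n → 𝔽))
    (hr : Set.range f = principalSeries p n 𝔽 T η) (hk : ∀ x, f x = 0 ↔ x ∈ A)
    (he : ∀ (g : GG p n) (x : B), f (ρ g x) = fun y => f x (y * g)) : IsExt T η ρ A f where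
  stab := hst
  mem := fun x => by
    have : f x ∈ principalSeries p n 𝔽 T η := hr ▸ Set.mem_range_self x
    exact this
  surj := fun q hq => by
    have hq' : q ∈ principalSeries p n 𝔽 T η := hq
    rw [← hr] at hq'
    exact hq'
  ker := hk
  equi := fun g x => he g x

lemma ex_jm {l : ℚ_[p]} (hl : l ≠ 0) : ∃ (j : ℤ) (m : ℕ), ‖(p:ℚ_[p])^j * l‖ = 1 ∧ ‖(p:ℚ_[p])^j * l - m‖ < 1 := by
  have hp0 : (p : ℝ) ≠ 0 := by exact_mod_cast hp.out.ne_zero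
  have h1 : ‖(p:ℚ_[p])^(-l.valuation) * l‖ = 1 := by
    rw [norm_mul, Padic.norm_p_zpow, Padic.norm_eq_zpow_neg_valuation hl, neg_neg, ← zpow_add₀ hp0]; simp
  refine ⟨-l.valuation, PadicInt.zmodRepr (⟨_, h1.le⟩ : ℤ_[p]), h1, ?_⟩
  have := PadicInt.norm_sub_zmodRepr_lt_one (⟨_, h1.le⟩ : ℤ_[p])
  rw [PadicInt.norm_def] at this
  exact this

lemma rel_combine [CharP 𝔽 p] (hT : IsT T) {k : ℕ} (h : Gd k n) {c c' c'' : T →* 𝔽ˣ}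
    (r1 : ∀ (d : Fin n → ℚ_[p]ˣ) (j : ℤ) (m : ℕ), ‖(p:ℚ_[p])^j * ((d h.lo : ℚ_[p]) / (d h.hi : ℚ_[p]))‖ = 1 →
      ‖(p:ℚ_[p])^j * ((d h.lo : ℚ_[p]) / (d h.hi : ℚ_[p])) - m‖ < 1 →
      (c' ⟨dgl d, hT.dgl d⟩ : 𝔽) * m = c'' ⟨dgl (fun i => d (Equiv.swap h.lo h.hi i)), hT.dgl _⟩)
    (r2 : ∀ (d : Fin n → ℚ_[p]ˣ) (j : ℤ) (m : ℕ), ‖(p:ℚ_[p])^j * ((d h.lo : ℚ_[p]) / (d h.hi : ℚ_[p]))‖ = 1 →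
      ‖(p:ℚ_[p])^j * ((d h.lo : ℚ_[p]) / (d h.hi : ℚ_[p])) - m‖ < 1 →
      (c ⟨dgl d, hT.dgl d⟩ : 𝔽) * m = c' ⟨dgl (fun i => d (Equiv.swap h.lo h.hi i)), hT.dgl _⟩) : c = c'' := by
  refine MonoidHom.ext fun t => ?_
  obtain ⟨d, rfl⟩ := T_dgl hT t
  have hl0 : ((d h.lo : ℚ_[p]) / (d h.hi : ℚ_[p])) ≠ 0 := div_ne_zero (d _).ne_zero (d _).ne_zero
  obtain ⟨j, m, hj, hm⟩ := ex_jm hl0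
  set x := (p:ℚ_[p])^j * ((d h.lo : ℚ_[p]) / (d h.hi : ℚ_[p])) with hx
  have hp0 : (p : ℚ_[p]) ≠ 0 := by exact_mod_cast hp.out.ne_zero
  have hx0 : x ≠ 0 := mul_ne_zero (zpow_ne_zero _ hp0) hl0
  have hxi : ‖x⁻¹‖ = 1 := by rw [norm_inv, hj, inv_one]
  set m' := PadicInt.zmodRepr (⟨x⁻¹, hxi.le⟩ : ℤ_[p]) with hm'
  have hm1 : ‖x⁻¹ - m'‖ < 1 := by
    have := PadicInt.norm_sub_zmodRepr_lt_one (⟨x⁻¹, hxi.le⟩ : ℤ_[p])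
    rw [PadicInt.norm_def] at this
    push_cast at this
    exact this
  have e1 := r2 d j m hj hm
  have ex : (p:ℚ_[p])^(-j) * ((d (Equiv.swap h.lo h.hi h.lo) : ℚ_[p]) / (d (Equiv.swap h.lo h.hi h.hi) : ℚ_[p])) = x⁻¹ := by
    rw [Equiv.swap_apply_left, Equiv.swap_apply_right, hx, mul_inv, inv_div, zpow_neg]
  have e2 := r1 (fun i => d (Equiv.swap h.lo h.hi i)) (-j) m' (by rw [ex, hxi]) (by rw [ex]; exact hm1)
  simp only [Equiv.swap_apply_self] at e2
  have e3 : ((m * m' : ℕ) : 𝔽) = 1 := by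
    have h1 : ‖(((m * m' : ℕ) - 1 : ℤ) : ℚ_[p])‖ < 1 := by
      have : ((((m * m' : ℕ) : ℤ) - 1 : ℤ) : ℚ_[p]) = -((x - m) * m') + -(x * (x⁻¹ - m')) := by
        push_cast
        rw [mul_sub, mul_inv_cancel₀ hx0]; ring
      rw [this]
      refine lt_of_le_of_lt (Padic.nonarchimedean _ _) (max_lt ?_ ?_)
      · rw [norm_neg, norm_mul]
        refine mul_lt_one_of_nonneg_of_lt_one_left (norm_nonneg _) hm ?_
        exact_mod_cast Padic.norm_int_le_one (p := p) (m' : ℤ)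
      · rw [norm_neg, norm_mul, hj, one_mul]; exact hm1
    rw [Padic.norm_intCast_lt_one_iff] at h1
    have := (CharP.intCast_eq_zero_iff 𝔽 p _).2 h1
    push_cast at this ⊢
    exact sub_eq_zero.1 this
  refine Units.ext ?_
  rw [← e2, ← e1, mul_assoc, ← Nat.cast_mul, e3, mul_one]

end L

section M
variable {p n : ℕ} [hp : Fact p.Prime] {𝔽 : Type*} [Field 𝔽] {T : Subgroup (GG p n)}
variable {B : Type*} [AddCommGroup B] [Module 𝔽 B] 

/-- restriction of a representation to a stable subspace -/
noncomputable def resR (ρ : Representation 𝔽 (GG p n) B) (A : Submodule 𝔽 B) (h : ∀ g, ∀ x ∈ A, ρ g x ∈ A) : Representation 𝔽 (GG p n) A where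
  toFun g := (ρ g).restrict (h g)
  map_one' := by ext x; simp
  map_mul' g g' := by ext x; simp

lemma resR_coe (ρ : Representation 𝔽 (GG p n) B) (A : Submodule 𝔽 B) (h : ∀ g, ∀ x ∈ A, ρ g x ∈ A) (g : GG p n) (x : A) :
    ((resR ρ A h g x : A) : B) = ρ g x := rfl

lemma IV_res {ρ : Representation 𝔽 (GG p n) B} {A : Submodule 𝔽 B} (h : ∀ g, ∀ x ∈ A, ρ g x ∈ A) {k : ℕ} {y : A}
    (hy : (y : B) ∈ IV ρ k A) : y ∈ IV (resR ρ A h) k ⊤ := by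
  have : IV ρ k A ≤ (IV (resR ρ A h) k ⊤).map A.subtype := by
    conv_lhs => rw [IV]
    rw [Submodule.span_le]
    rintro _ ⟨v, hv, a, ha, rfl⟩
    exact ⟨resR ρ A h v ⟨a, ha⟩ - ⟨a, ha⟩, IV_mem (A := ⊤) hv trivial, rfl⟩
  obtain ⟨z, hz, e⟩ := this hy
  have : z = y := Subtype.ext e
  rwa [← this]

theorem main [CharP 𝔽 p] (hT : IsT T) (c c' c'' : T →* 𝔽ˣ) (hd2 : c ≠ c'') (hd3 : c' ≠ c'')
    (hirr' : principalSeriesIrreducible p n 𝔽 T c') (ρ : Representation 𝔽 (GG p n) B)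
    (hsm : ∀ x : B, IsOpen {g : GG p n | ρ g x = x}) (P1 P2 : Submodule 𝔽 B) (h12 : P1 ≤ P2)
    (h1 : ∀ g, ∀ x ∈ P1, ρ g x ∈ P1) (h2 : ∀ g, ∀ x ∈ P2, ρ g x ∈ P2)
    (f1 : P1 →ₗ[𝔽] (GG p n → 𝔽)) (f1i : Function.Injective f1) (f1r : Set.range f1 = principalSeries p n 𝔽 T c)
    (f1e : ∀ (g : GG p n) (x : P1), f1 ⟨ρ g ↑x, h1 g ↑x x.2⟩ = fun y => f1 x (y * g))
    (f2 : P2 →ₗ[𝔽] (GG p n → 𝔽)) (f2r : Set.range f2 = principalSeries p n 𝔽 T c')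
    (f2k : ∀ x : P2, f2 x = 0 ↔ (x : B) ∈ P1)
    (f2e : ∀ (g : GG p n) (x : P2), f2 ⟨ρ g ↑x, h2 g ↑x x.2⟩ = fun y => f2 x (y * g))
    (f3 : B →ₗ[𝔽] (GG p n → 𝔽)) (f3r : Set.range f3 = principalSeries p n 𝔽 T c'')
    (f3k : ∀ x : B, f3 x = 0 ↔ x ∈ P2)
    (f3e : ∀ (g : GG p n) (x : B), f3 (ρ g x) = fun y => f3 x (y * g))
    (ns1 : ¬ ∃ C : Submodule 𝔽 B, (∀ g : GG p n, ∀ x ∈ C, ρ g x ∈ C) ∧ C ⊓ P1 = ⊥ ∧ C ⊔ P1 = P2)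
    (ns2 : ¬ ∃ C : Submodule 𝔽 B, (∀ g : GG p n, ∀ x ∈ C, ρ g x ∈ C) ∧ C ⊓ P2 = P1 ∧ C ⊔ P2 = ⊤) : False := by
  have E3 : IsExt T c'' ρ P2 f3 := mkExt h2 f3 f3r f3k f3e
  obtain ⟨D, R1⟩ := mkRea hT h2 h12 f2 f2r f2k f2e
  obtain ⟨k, h, y, hyA, hy, hDy⟩ := step2 hT E3 R1 hsm hd3 ns2
  obtain ⟨hne1, rel1⟩ := lemmaC hT E3 h R1.eig hyA hy hDy
  have s3 := step3 hT R1 hirr' hyA hy hDy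
  set ρ2 := resR ρ P2 h2 with hρ2
  set A2 : Submodule 𝔽 P2 := P1.comap P2.subtype with hA2
  have hA2st : ∀ g, ∀ x ∈ A2, ρ2 g x ∈ A2 := fun g x hx => h1 g _ hx
  have E2 : IsExt T c' ρ2 A2 f2 := mkExt hA2st f2 f2r f2k f2e
  let ι : A2 →ₗ[𝔽] P1 := (P2.subtype ∘ₗ A2.subtype).codRestrict P1 (fun x => x.2)
  have hιi : Function.Injective ι := fun a b hab => Subtype.ext (Subtype.ext (congrArg (fun z : P1 => (z : B)) hab))
  have hιs : Function.Surjective ι := fun b => ⟨⟨⟨b, h12 b.2⟩, b.2⟩, rfl⟩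
  obtain ⟨D', R2⟩ := mkRea (ρ := ρ2) (A1 := ⊥) (η := c) hT hA2st bot_le (f1 ∘ₗ ι)
    (by rw [← f1r, LinearMap.coe_comp, hιs.range_comp])
    (fun x => by
      rw [Submodule.mem_bot, LinearMap.comp_apply]
      constructor
      · intro hx
        have : ι x = ι 0 := f1i (by rw [hx, map_zero, map_zero])
        rw [hιi this]; rfl
      · intro hx
        have : x = 0 := Subtype.ext hx
        rw [this, map_zero, map_zero])
    (fun g x => f1e g (ι x))
  have hsm2 : ∀ x : P2, IsOpen {g : GG p n | ρ2 g x = x} := fun x => by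
    have : {g : GG p n | ρ2 g x = x} = {g : GG p n | ρ g (x : B) = x} := by
      ext g; exact Subtype.ext_iff
    rw [this]; exact hsm _
  obtain ⟨C, hCst, hC1, hC2⟩ := step5 hT R2 hsm2 (W := (IV ρ k ⊤).comap P2.subtype)
    (fun b hb w hw => IV_stab (A := ⊤) (fun _ _ _ => trivial) (Bb_le k hb) hw)
    (fun x hx hxW => by
      by_contra hDx
      have hz : ∀ g, D (ρ g (x : B)) = 0 := (R1.ker x x.2).2 hx
      have h4 : (x : B) ∈ IV ρ k P2 := lemma4 hT E3 h R1.eig.inv hne1 x.2 hxW hz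
      obtain ⟨-, rel2⟩ := lemmaC hT E2 h R2.eig hx (IV_res h2 h4) hDx
      exact hd2 (rel_combine hT h rel1 rel2))
    (fun x => by
      obtain ⟨w, hw, hw2, hxw⟩ := s3 x x.2
      exact ⟨⟨w, hw⟩, hw2, hxw⟩)
  refine ns1 ⟨C.map P2.subtype, ?_, ?_, ?_⟩
  · rintro g _ ⟨x, hx, rfl⟩
    exact ⟨ρ2 g x, hCst g x hx, rfl⟩
  · rw [eq_bot_iff]
    rintro _ ⟨⟨x, hx, rfl⟩, hx1⟩
    have : x ∈ C ⊓ A2 := ⟨hx, hx1⟩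
    rw [hC1, Submodule.mem_bot] at this
    rw [this]; simp
  · have e : P1 = A2.map P2.subtype := by
      rw [hA2, Submodule.map_comap_subtype, inf_eq_right.2 h12]
    rw [e, ← Submodule.map_sup, hC2, Submodule.map_subtype_top]

end M
end HX

/-- (Hauseux, mod `p` case; reproved in the paper.)
Fix a prime `p`, `n ≥ 2` and a finite field `𝔽` of characteristic `p`.  Let `χ, χ', χ''` be
three pairwise distinct smooth characters of the diagonal torus `T ≤ GL_n(ℚ_p)` whose
principal series `Ind_{B̄}^G χ`, `Ind_{B̄}^G χ'`, `Ind_{B̄}^G χ''` are irreducible.  Then there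
is no smooth representation `π` of `G = GL_n(ℚ_p)` over `𝔽` admitting `G`-stable subspaces
`0 ⊊ π₁ ⊊ π₂ ⊊ π` with `π₁ ≅ Ind χ`, `π₂/π₁ ≅ Ind χ'`, `π/π₂ ≅ Ind χ''` such that neither
`0 → π₁ → π₂ → π₂/π₁ → 0` nor `0 → π₂/π₁ → π/π₁ → π/π₂ → 0` splits (nonsplitting being
expressed by the nonexistence of `G`-stable complements). -/
theorem stmt8 (p : ℕ) [Fact p.Prime] (n : ℕ) (hn : 2 ≤ n)
    (𝔽 : Type*) [Field 𝔽] [Fintype 𝔽] [CharP 𝔽 p]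
    (T : Subgroup (GL (Fin n) ℚ_[p]))
    (hT : ∀ g : GL (Fin n) ℚ_[p], g ∈ T ↔
      ∀ i j : Fin n, i ≠ j → (g : Matrix (Fin n) (Fin n) ℚ_[p]) i j = 0)
    (χ χ' χ'' : T →* 𝔽ˣ)
    (hχsm : IsOpen {t : T | χ t = 1}) (hχ'sm : IsOpen {t : T | χ' t = 1})
    (hχ''sm : IsOpen {t : T | χ'' t = 1})
    (hd1 : χ ≠ χ') (hd2 : χ ≠ χ'') (hd3 : χ' ≠ χ'')
    (hirr : principalSeriesIrreducible p n 𝔽 T χ)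
    (hirr' : principalSeriesIrreducible p n 𝔽 T χ')
    (hirr'' : principalSeriesIrreducible p n 𝔽 T χ'') :
    ∀ (π : Type*) [AddCommGroup π] [Module 𝔽 π] (ρ : Representation 𝔽 (GL (Fin n) ℚ_[p]) π),
      -- `π` is smooth
      (∀ x : π, IsOpen {g : GL (Fin n) ℚ_[p] | ρ g x = x}) →
      ∀ π₁ π₂ : Submodule 𝔽 π, ⊥ < π₁ → π₁ < π₂ → π₂ < ⊤ →
      ∀ h1 : (∀ g : GL (Fin n) ℚ_[p], ∀ x ∈ π₁, ρ g x ∈ π₁),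
      ∀ h2 : (∀ g : GL (Fin n) ℚ_[p], ∀ x ∈ π₂, ρ g x ∈ π₂),
      -- `π₁ ≅ Ind_{B̄}^G χ` as representations of `G`
      (∃ φ : π₁ →ₗ[𝔽] (GL (Fin n) ℚ_[p] → 𝔽),
        Function.Injective φ ∧ Set.range φ = principalSeries p n 𝔽 T χ ∧
        ∀ (g : GL (Fin n) ℚ_[p]) (x : π₁),
          φ ⟨ρ g ↑x, h1 g ↑x x.2⟩ = fun y => φ x (y * g)) →
      -- `π₂/π₁ ≅ Ind_{B̄}^G χ'` as representations of `G`
      (∃ φ : π₂ →ₗ[𝔽] (GL (Fin n) ℚ_[p] → 𝔽),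
        Set.range φ = principalSeries p n 𝔽 T χ' ∧
        (∀ x : π₂, φ x = 0 ↔ (x : π) ∈ π₁) ∧
        ∀ (g : GL (Fin n) ℚ_[p]) (x : π₂),
          φ ⟨ρ g ↑x, h2 g ↑x x.2⟩ = fun y => φ x (y * g)) →
      -- `π/π₂ ≅ Ind_{B̄}^G χ''` as representations of `G`
      (∃ φ : π →ₗ[𝔽] (GL (Fin n) ℚ_[p] → 𝔽),
        Set.range φ = principalSeries p n 𝔽 T χ'' ∧
        (∀ x : π, φ x = 0 ↔ x ∈ π₂) ∧
        ∀ (g : GL (Fin n) ℚ_[p]) (x : π),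
          φ (ρ g x) = fun y => φ x (y * g)) →
      -- the extension `0 → π₁ → π₂ → π₂/π₁ → 0` does not split
      (¬ ∃ C : Submodule 𝔽 π, (∀ g : GL (Fin n) ℚ_[p], ∀ x ∈ C, ρ g x ∈ C) ∧
        C ⊓ π₁ = ⊥ ∧ C ⊔ π₁ = π₂) →
      -- the extension `0 → π₂/π₁ → π/π₁ → π/π₂ → 0` does not split
      (¬ ∃ C : Submodule 𝔽 π, (∀ g : GL (Fin n) ℚ_[p], ∀ x ∈ C, ρ g x ∈ C) ∧
        C ⊓ π₂ = π₁ ∧ C ⊔ π₂ = ⊤) →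
      False := by
  intro π _ _ ρ hsm π₁ π₂ _ h12 _ h1 h2 ⟨f1, f1i, f1r, f1e⟩ ⟨f2, f2r, f2k, f2e⟩ ⟨f3, f3r, f3k, f3e⟩ ns1 ns2
  exact HX.main (p := p) (n := n) hT χ χ' χ'' hd2 hd3 hirr' ρ hsm π₁ π₂ h12.le h1 h2 f1 f1i f1r f1e f2 f2r f2k f2e f3 f3r f3k f3e ns1 ns2
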